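/- arXiv:2201.08159 — 8 statements merged into one kernel-verified Lean document; each statement's English description precedes it below -/
import Mathlib

section
/- Let p, σ ∈ ℝ. The one-dimensional equation -u''(x) = |x|^σ u(x)^p on ℝ admits at least one non-trivial, non-negative classical solution if, and only if, either (σ < -2 and p > -1-σ) or (-2 < σ < 0 and p < -1-σ). -/
open Set

lemma mul_sub_le_sub_of_le_hasDerivAt {f f' : ℝ → ℝ} (hf : ∀ t, HasDerivAt f (f' t) t)
    {a b C : ℝ} (hab : a ≤ b) (hC : ∀ t, a ≤ t → C ≤ f' t) : C * (b - a) ≤ f b - f a := by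
  refine (convex_Ici a).mul_sub_le_image_sub_of_le_deriv
    (fun t _ => (hf t).continuousAt.continuousWithinAt)
    (fun t _ => (hf t).differentiableAt.differentiableWithinAt) (fun t ht => ?_) a self_mem_Ici
    b hab hab
  rw [(hf t).deriv]
  rw [interior_Ici] at ht
  exact hC t (le_of_lt ht)

lemma not_exists_bounded_orbit_of_nonneg {W h : ℝ → ℝ} {a b : ℝ}
    (hW : ∀ t, HasDerivAt W (W t * (1 - W t) - Real.exp (h t)) t)
    (hh : ∀ t, HasDerivAt h (a * (1 - W t) + b * W t) t)
    (hW0 : ∀ t, 0 ≤ W t) (hW1 : ∀ t, W t ≤ 1) (ha : 0 ≤ a) (hb : 0 ≤ b)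
    (h0 : a + b = 0 → ∀ t, h t = 0) : False := by
  have mono : ∀ t, 0 ≤ t → h 0 ≤ h t := fun t ht => by
    have := mul_sub_le_sub_of_le_hasDerivAt (C := 0) hh ht fun s _ =>
      add_nonneg (mul_nonneg ha (sub_nonneg.2 (hW1 s))) (mul_nonneg hb (hW0 s))
    linarith
  obtain ⟨T, hT⟩ : ∃ T, ∀ t, T ≤ t → 0 ≤ h t := by
    rcases (add_nonneg ha hb).eq_or_lt with hc | hc
    · exact ⟨0, fun t _ => (h0 hc.symm t).ge⟩
    set k := (a + b) * Real.exp (h 0) with hk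
    have kpos : 0 < k := by positivity
    have key : ∀ t, 0 ≤ t → k * t ≤ h t - h 0 + (a + b) := fun t ht => by
      have := mul_sub_le_sub_of_le_hasDerivAt (C := k)
        (fun s => (hh s).sub ((hW s).const_mul (a + b))) ht fun s hs => by
          have h1 := mul_le_mul_of_nonneg_left (Real.exp_le_exp.2 (mono s hs)) hc.le
          nlinarith [mul_nonneg ha (sq_nonneg (1 - W s)), mul_nonneg hb (sq_nonneg (W s))]
      simp only [Pi.sub_apply] at this
      nlinarith [mul_nonneg hc.le (hW0 0), mul_nonneg hc.le (hW0 t),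
        mul_nonneg hc.le (sub_nonneg.2 (hW1 0)), mul_nonneg hc.le (sub_nonneg.2 (hW1 t))]
    refine ⟨max 0 ((a + b - h 0) / k), fun t ht => ?_⟩
    have h1 := key t ((le_max_left _ _).trans ht)
    have h2 := (div_le_iff₀' kpos).1 ((le_max_right _ _).trans ht)
    linarith
  have := mul_sub_le_sub_of_le_hasDerivAt (C := 3 / 4) (b := T + 2) (fun s => (hW s).neg)
    (le_add_of_nonneg_right zero_le_two) fun s hs => by
      have := Real.one_le_exp (hT s hs)
      nlinarith [sq_nonneg (W s - 1 / 2)]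
  simp only [Pi.neg_apply] at this
  linarith [hW0 (T + 2), hW1 T]

lemma not_exists_bounded_orbit_of_nonpos {W h : ℝ → ℝ} {a b : ℝ}
    (hW : ∀ t, HasDerivAt W (W t * (1 - W t) - Real.exp (h t)) t)
    (hh : ∀ t, HasDerivAt h (a * (1 - W t) + b * W t) t)
    (hW0 : ∀ t, 0 ≤ W t) (hW1 : ∀ t, W t ≤ 1) (ha : a ≤ 0) (hb : b ≤ 0)
    (h0 : a + b = 0 → ∀ t, h t = 0) : False := by
  refine not_exists_bounded_orbit_of_nonneg (W := fun t => 1 - W (-t)) (h := fun t => h (-t))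
    (a := -b) (b := -a) (fun t => ?_) (fun t => ?_) (fun t => sub_nonneg.2 (hW1 _))
    (fun t => sub_le_self _ (hW0 _)) (neg_nonneg.2 hb) (neg_nonneg.2 ha)
    (fun hc t => h0 (by linarith) _)
  · exact (((hW (-t)).comp t (hasDerivAt_neg t)).const_sub 1).congr_deriv (by ring)
  · exact ((hh (-t)).comp t (hasDerivAt_neg t)).congr_deriv (by ring)

lemma ConcaveOn.tangent_nonneg {D : Set ℝ} {f : ℝ → ℝ} (hf : ConcaveOn ℝ D f)
    (h0 : ∀ x ∈ D, 0 ≤ f x) {x y f' : ℝ} (hx : x ∈ D) (hy : y ∈ D) (hf' : HasDerivAt f f' x) :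
    0 ≤ f x + f' * (y - x) := by
  refine (h0 y hy).trans ?_
  rcases lt_trichotomy x y with h | rfl | h
  · have := hf.slope_le_of_hasDerivAt hx hy h hf'
    rw [slope_def_field, div_le_iff₀ (sub_pos.2 h)] at this
    linarith
  · simp
  · have := hf.le_slope_of_hasDerivAt hy hx h hf'
    rw [slope_def_field, le_div_iff₀ (sub_pos.2 h)] at this
    linarith

lemma ConcaveOn.pos_of_nonneg {f : ℝ → ℝ} (hf : ConcaveOn ℝ (Ioi 0) f)
    (h0 : ∀ x, 0 < x → 0 ≤ f x) {x₀ : ℝ} (hx₀ : 0 < x₀) (hf₀ : f x₀ ≠ 0) {y : ℝ} (hy : 0 < y) :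
    0 < f y := by
  have hp : 0 < f x₀ := (h0 _ hx₀).lt_of_ne' hf₀
  set e := y / (2 * (x₀ + y)) with he
  have e0 : 0 < e := by positivity
  have e1 : e < 1 := by rw [he, div_lt_one (by positivity)]; linarith
  have e2 : e * x₀ < y := by
    rw [he, div_mul_eq_mul_div, div_lt_iff₀ (by positivity)]; nlinarith
  have hz : 0 < (y - e * x₀) / (1 - e) := div_pos (by linarith) (by linarith)
  have := hf.2 (mem_Ioi.2 hx₀) (mem_Ioi.2 hz) e0.le (sub_nonneg.2 e1.le) (by ring)
  have h3 : e • x₀ + (1 - e) • ((y - e * x₀) / (1 - e)) = y := by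
    simp only [smul_eq_mul]
    field_simp [(sub_pos.2 e1).ne']
    ring
  rw [h3] at this
  refine lt_of_lt_of_le ?_ this
  exact add_pos_of_pos_of_nonneg (mul_pos e0 hp) (mul_nonneg (sub_nonneg.2 e1.le) (h0 _ hz))

lemma half_line_exponents {v : ℝ → ℝ} {p σ x₀ : ℝ} (h0 : ∀ x, 0 < x → 0 ≤ v x)
    (hd : DifferentiableOn ℝ v (Ioi 0)) (hd' : DifferentiableOn ℝ (deriv v) (Ioi 0))
    (heq : ∀ x, 0 < x → -(deriv (deriv v) x) = x ^ σ * v x ^ p) (hx₀ : 0 < x₀)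
    (hv₀ : v x₀ ≠ 0) : (σ < -2 ∧ -1 - σ < p) ∨ (-2 < σ ∧ p < -1 - σ) := by
  have conc : ConcaveOn ℝ (Ioi 0) v := concaveOn_of_deriv2_nonpos' (convex_Ioi 0) hd hd'
    fun x (hx : 0 < x) => by
      have h1 := heq x hx
      have h2 := mul_nonneg (Real.rpow_nonneg hx.le σ) (Real.rpow_nonneg (h0 x hx) p)
      change deriv (deriv v) x ≤ 0
      linarith
  have pos : ∀ x, 0 < x → 0 < v x := fun x hx => ConcaveOn.pos_of_nonneg conc h0 hx₀ hv₀ hx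
  have hv : ∀ x, 0 < x → HasDerivAt v (deriv v x) x := fun x hx =>
    (hd.differentiableAt (Ioi_mem_nhds hx)).hasDerivAt
  have hv' : ∀ x, 0 < x → HasDerivAt (deriv v) (-(x ^ σ * v x ^ p)) x := fun x hx => by
    rw [← heq x hx, neg_neg]
    exact (hd'.differentiableAt (Ioi_mem_nhds hx)).hasDerivAt
  have tangent : ∀ x y, 0 < x → 0 < y → 0 ≤ v x + deriv v x * (y - x) := fun x y hx hy =>
    ConcaveOn.tangent_nonneg conc h0 hx hy (hv x hx)
  have dnonneg : ∀ x, 0 < x → 0 ≤ deriv v x := fun x hx => by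
    by_contra! hneg
    have h1 := tangent x (x + (v x + 1) / (-deriv v x)) hx
      (add_pos hx (div_pos (by linarith [pos x hx]) (neg_pos.2 hneg)))
    have h2 : deriv v x * (x + (v x + 1) / (-deriv v x) - x) = -(v x + 1) := by
      field_simp [hneg.ne]
      ring
    linarith
  have dle : ∀ x, 0 < x → x * deriv v x ≤ v x := fun x hx => by
    by_contra! hlt
    have hd0 : 0 < deriv v x := (dnonneg x hx).lt_of_ne fun h => by
      rw [← h, mul_zero] at hlt
      exact hlt.not_ge (h0 x hx)
    have h1 := tangent x ((x * deriv v x - v x) / (2 * deriv v x)) hx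
      (div_pos (sub_pos.2 hlt) (by positivity))
    have h2 : deriv v x * ((x * deriv v x - v x) / (2 * deriv v x) - x)
        = -(x * deriv v x + v x) / 2 := by
      field_simp
      ring
    linarith
  set W : ℝ → ℝ := fun t => Real.exp t * deriv v (Real.exp t) / v (Real.exp t) with hWdef
  set h : ℝ → ℝ := fun t => (σ + 2) * t + (p - 1) * Real.log (v (Real.exp t)) with hhdef
  have hW0 : ∀ t, 0 ≤ W t := fun t =>
    div_nonneg (mul_nonneg (Real.exp_pos t).le (dnonneg _ (Real.exp_pos t))) (h0 _ (Real.exp_pos t))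
  have hW1 : ∀ t, W t ≤ 1 := fun t =>
    (div_le_one (pos _ (Real.exp_pos t))).2 (dle _ (Real.exp_pos t))
  have hcomp : ∀ t, HasDerivAt (fun t => v (Real.exp t))
      (deriv v (Real.exp t) * Real.exp t) t := fun t =>
    (hv _ (Real.exp_pos t)).comp t (Real.hasDerivAt_exp t)
  have hW : ∀ t, HasDerivAt W (W t * (1 - W t) - Real.exp (h t)) t := fun t => by
    have hp := pos _ (Real.exp_pos t)
    have hcomp' := (hv' _ (Real.exp_pos t)).comp t (Real.hasDerivAt_exp t)
    refine (((Real.hasDerivAt_exp t).mul hcomp').div (hcomp t) hp.ne').congr_deriv ?_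
    have e1 : Real.exp (h t) = Real.exp t ^ σ * v (Real.exp t) ^ p * Real.exp t ^ 2
        / v (Real.exp t) := by
      have e2 : h t = t * σ + Real.log (v (Real.exp t)) * p + 2 * t
          - Real.log (v (Real.exp t)) := by
        rw [hhdef]
        ring
      rw [e2, Real.rpow_def_of_pos (Real.exp_pos t), Real.rpow_def_of_pos hp, Real.log_exp,
        Real.exp_sub, Real.exp_add, Real.exp_add, Real.exp_log hp]
      norm_num [← Real.exp_nat_mul]
    rw [e1]
    simp only [hWdef, Pi.mul_apply, Function.comp_apply]
    field_simp
    ring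
  have hh : ∀ t, HasDerivAt h ((σ + 2) * (1 - W t) + (σ + 1 + p) * W t) t := fun t => by
    have hp := pos _ (Real.exp_pos t)
    refine (((hasDerivAt_id t).const_mul (σ + 2)).add
      (((hcomp t).log hp.ne').const_mul (p - 1))).congr_deriv ?_
    simp only [hWdef]
    field_simp
    ring
  by_contra hcon
  rcases le_total 0 (σ + 2) with ha | ha
  · by_cases hb : 0 ≤ σ + 1 + p
    · refine not_exists_bounded_orbit_of_nonneg hW hh hW0 hW1 ha hb fun hs t => ?_
      have e1 : σ + 2 = 0 := by linarith
      have e2 : p - 1 = 0 := by linarith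
      simp [hhdef, e1, e2]
    · rcases ha.eq_or_lt with ha' | ha'
      · refine not_exists_bounded_orbit_of_nonpos hW hh hW0 hW1 ha'.ge (not_le.1 hb).le
          fun hs t => ?_
        exact absurd (by linarith : 0 ≤ σ + 1 + p) hb
      · exact hcon (Or.inr ⟨by linarith, by linarith⟩)
  · by_cases hb : σ + 1 + p ≤ 0
    · refine not_exists_bounded_orbit_of_nonpos hW hh hW0 hW1 ha hb fun hs t => ?_
      have e1 : σ + 2 = 0 := by linarith
      have e2 : p - 1 = 0 := by linarith
      simp [hhdef, e1, e2]
    · rcases ha.eq_or_lt with ha' | ha'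
      · refine not_exists_bounded_orbit_of_nonneg hW hh hW0 hW1 ha'.ge (not_le.1 hb).le
          fun hs t => ?_
        exact absurd (by linarith : σ + 1 + p ≤ 0) hb
      · exact hcon (Or.inl ⟨by linarith, by linarith⟩)

lemma eq_zero_of_contDiff_solution {u : ℝ → ℝ} {p σ : ℝ} (h0 : ∀ x, 0 ≤ u x)
    (hu : ContDiff ℝ 2 u)
    (heq : ∀ x : ℝ, -(deriv (deriv u) x) = |x| ^ σ * u x ^ p) : u = 0 := by
  have hd : Differentiable ℝ u := hu.differentiable (by norm_num)
  have hd' : Differentiable ℝ (deriv u) :=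
    ((contDiff_succ_iff_deriv (n := 1)).1 (hu : ContDiff ℝ (1 + 1) u)).2.2.differentiable (by norm_num)
  have conc : ConcaveOn ℝ univ u := concaveOn_of_deriv2_nonpos' convex_univ hd.differentiableOn
    hd'.differentiableOn fun x _ => by
      have h2 := mul_nonneg (Real.rpow_nonneg (abs_nonneg x) σ) (Real.rpow_nonneg (h0 x) p)
      change deriv (deriv u) x ≤ 0
      linarith [heq x]
  have dz : ∀ x, deriv u x = 0 := fun x => by
    by_contra hne
    have h1 := ConcaveOn.tangent_nonneg conc (fun x _ => h0 x) (mem_univ x)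
      (mem_univ (x - (u x + 1) / deriv u x)) (hd x).hasDerivAt
    have h2 : deriv u x * (x - (u x + 1) / deriv u x - x) = -(u x + 1) := by
      field_simp
      ring
    linarith
  have h1 := heq 1
  rw [funext dz] at h1
  simp only [deriv_const, abs_one, Real.one_rpow, one_mul, neg_zero] at h1
  have h2 : u 1 = 0 := by
    by_contra hne
    exact (Real.rpow_pos_of_pos ((h0 1).lt_of_ne' hne) p).ne h1
  funext x
  rw [is_const_of_deriv_eq_zero hd dz x 1, h2, Pi.zero_apply]

lemma hasDerivAt_abs_rpow_of_ne {x : ℝ} (hx : x ≠ 0) (r : ℝ) :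
    HasDerivAt (fun y : ℝ => |y| ^ r) (r * |x| ^ (r - 2) * x) x := by
  refine ((hasDerivAt_abs hx).rpow_const (Or.inl (abs_ne_zero.2 hx))).congr_deriv ?_
  have h1 : |x| ^ (r - 1) = |x| ^ (r - 2) * |x| := by
    rw [← Real.rpow_add_one (abs_ne_zero.2 hx)]
    ring_nf
  rw [h1]
  linear_combination r * |x| ^ (r - 2) * sign_mul_abs x

lemma deriv_deriv_abs_rpow {x : ℝ} (hx : x ≠ 0) (C r : ℝ) :
    deriv (deriv fun y : ℝ => C * |y| ^ r) x = C * (r * (r - 1) * |x| ^ (r - 2)) := by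
  have h1 : deriv (fun y : ℝ => C * |y| ^ r) =ᶠ[nhds x]
      fun y => C * (r * |y| ^ (r - 2) * y) := by
    filter_upwards [isOpen_ne.mem_nhds hx] with y hy
    exact ((hasDerivAt_abs_rpow_of_ne hy r).const_mul C).deriv
  rw [h1.deriv_eq]
  refine (((((hasDerivAt_abs_rpow_of_ne hx (r - 2)).const_mul r).mul
    (hasDerivAt_id x)).const_mul C).congr_deriv ?_).deriv
  have h2 : |x| ^ (r - 2) = |x| ^ (r - 2 - 2) * x ^ 2 := by
    rw [← sq_abs x, ← Real.rpow_add_natCast (abs_ne_zero.2 hx)]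
    push_cast
    ring_nf
  rw [h2, id]
  ring

/-- **Theorem 1.2.** The equation `-u'' = |x|^σ u^p` on `ℝ` admits a non-trivial, non-negative
classical solution iff either (`σ < -2` and `p > -1-σ`) or (`-2 < σ < 0` and `p < -1-σ`). -/
theorem hardy_henon_one_dim_real_line_existence_iff (p σ : ℝ) :
    (∃ u : ℝ → ℝ,
      (∀ x, 0 ≤ u x) ∧
      (0 ≤ σ → ContDiff ℝ 2 u) ∧
      (σ < 0 → Continuous u ∧ ContDiffOn ℝ 2 u {(0 : ℝ)}ᶜ) ∧
      (∀ x : ℝ, x ≠ 0 → -(deriv (deriv u) x) = |x| ^ σ * u x ^ p) ∧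
      (0 ≤ σ → -(deriv (deriv u) 0) = |(0 : ℝ)| ^ σ * u 0 ^ p) ∧
      u ≠ 0) ↔
    ((σ < -2 ∧ -1 - σ < p) ∨ (-2 < σ ∧ σ < 0 ∧ p < -1 - σ)) := by
  constructor
  · rintro ⟨u, h0, hreg, hreg', heq, heq0, hne⟩
    rcases le_or_gt 0 σ with hσ | hσ
    · refine absurd (eq_zero_of_contDiff_solution (p := p) (σ := σ) h0 (hreg hσ) fun x => ?_) hne
      rcases eq_or_ne x 0 with rfl | hx
      exacts [heq0 hσ, heq x hx]
    obtain ⟨hc, hcd⟩ := hreg' hσ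
    have hd : DifferentiableOn ℝ u {(0 : ℝ)}ᶜ := hcd.differentiableOn (by norm_num)
    have hd' : DifferentiableOn ℝ (deriv u) {(0 : ℝ)}ᶜ :=
      ((contDiffOn_succ_iff_deriv_of_isOpen (n := 1) isOpen_compl_singleton).1
        (hcd : ContDiffOn ℝ (1 + 1) u _)).2.2.differentiableOn (by norm_num)
    obtain ⟨x, hx, hux⟩ : ∃ x, x ≠ 0 ∧ u x ≠ 0 := by
      by_contra! hcon
      refine hne (hc.ext_on (dense_compl_singleton (0 : ℝ)) continuous_zero fun x hx => ?_)
      exact hcon x hx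
    suffices (σ < -2 ∧ -1 - σ < p) ∨ (-2 < σ ∧ p < -1 - σ) from
      this.imp id fun h => ⟨h.1, hσ, h.2⟩
    rcases hx.lt_or_gt with hx | hx
    · have hsub : MapsTo (fun y : ℝ => -y) (Ioi 0) {(0 : ℝ)}ᶜ := fun y hy =>
        neg_ne_zero.2 (ne_of_gt hy)
      have e1 : deriv (fun y => u (-y)) = fun y => -deriv u (-y) :=
        funext fun y => deriv_comp_neg u y
      refine half_line_exponents (v := fun y => u (-y)) (x₀ := -x) (fun y _ => h0 _)
        (hd.comp differentiable_neg.differentiableOn hsub) ?_ (fun y hy => ?_)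
        (neg_pos.2 hx) (by simpa using hux)
      · rw [e1]
        exact (hd'.comp differentiable_neg.differentiableOn hsub).neg
      · have := heq (-y) (neg_ne_zero.2 hy.ne')
        rw [abs_neg, abs_of_pos hy] at this
        rw [e1, ← this, deriv.fun_neg, deriv_comp_neg (deriv u), neg_neg]
    · have hsub : Ioi (0 : ℝ) ⊆ {(0 : ℝ)}ᶜ := fun y hy => ne_of_gt hy
      refine half_line_exponents (fun y _ => h0 y) (hd.mono hsub) (hd'.mono hsub)
        (fun y hy => ?_) hx hux
      rw [heq y hy.ne', abs_of_pos hy]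
  · intro hcase
    have hσ : σ < 0 := by rcases hcase with h | h <;> linarith [h.1, h.2]
    have hp : 1 - p ≠ 0 := by
      rcases hcase with h | h
      · exact (by linarith : 1 - p < 0).ne
      · exact (by linarith : 0 < 1 - p).ne'
    set r := (2 + σ) / (1 - p) with hr
    have hr' : r * (1 - p) = 2 + σ := div_mul_cancel₀ _ hp
    have hr01 : 0 < r ∧ r < 1 := by
      rcases hcase with h | h
      · exact ⟨div_pos_of_neg_of_neg (by linarith) (by linarith),
          (div_lt_one_of_neg (by linarith)).2 (by linarith)⟩
      · exact ⟨div_pos (by linarith) (by linarith), (div_lt_one (by linarith)).2 (by linarith)⟩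
    have hk : 0 < r * (1 - r) := mul_pos hr01.1 (sub_pos.2 hr01.2)
    set C := (r * (1 - r)) ^ (1 / (p - 1)) with hC
    have hC0 : 0 < C := Real.rpow_pos_of_pos hk _
    have hCp : C ^ p = C * (r * (1 - r)) := by
      have h1 : C ^ (p - 1) = r * (1 - r) := by
        rw [hC, ← Real.rpow_mul hk.le, one_div_mul_cancel (by contrapose! hp; linarith),
          Real.rpow_one]
      rw [← h1, mul_comm, ← Real.rpow_add_one hC0.ne', sub_add_cancel]
    refine ⟨fun x => C * |x| ^ r, fun x => by positivity, fun h => absurd hσ h.not_gt,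
      fun _ => ⟨?_, ?_⟩, fun x hx => ?_, fun h => absurd hσ h.not_gt, fun h => ?_⟩
    · exact continuous_const.mul (continuous_abs.rpow_const fun _ => Or.inr hr01.1.le)
    · exact fun x (hx : x ≠ 0) => (contDiffAt_const.mul
        ((contDiffAt_abs hx).rpow_const_of_ne (abs_ne_zero.2 hx))).contDiffWithinAt
    · have hx' := abs_pos.2 hx
      rw [deriv_deriv_abs_rpow hx, Real.mul_rpow hC0.le (by positivity), hCp,
        ← Real.rpow_mul hx'.le, show r - 2 = σ + r * p by linarith, Real.rpow_add hx']
      ring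
    · have := congrFun h 1
      simp [hC0.ne'] at this
end

section
/- Let p, σ ∈ ℝ. The equation -u''(x) = x^σ u(x)^p on (0,+∞) admits at least one non-trivial, non-negative C² solution if, and only if, either (σ < -2 and p > -1-σ) or (σ > -2 and p < -1-σ). -/
open Set

/-- Real powers of comparable numbers are comparable. -/
lemma two_rpow_neg_abs_mul_rpow_le {s t : ℝ} (q : ℝ) (ht : 0 < t) (h₁ : t / 2 ≤ s)
    (h₂ : s ≤ 2 * t) : (2 : ℝ) ^ (-|q|) * t ^ q ≤ s ^ q := by
  have hs : 0 < s := by linarith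
  rcases le_total 0 q with hq | hq
  · rw [abs_of_nonneg hq]
    calc (2 : ℝ) ^ (-q) * t ^ q = (t / 2) ^ q := by
          rw [Real.div_rpow ht.le (by norm_num), Real.rpow_neg (by norm_num)]; ring
      _ ≤ s ^ q := Real.rpow_le_rpow (by positivity) h₁ hq
  · rw [abs_of_nonpos hq, neg_neg, ← Real.mul_rpow (by norm_num) ht.le]
    exact Real.rpow_le_rpow_of_nonpos hs h₂ hq

/-- A positive function on `(0, ∞)` cannot decrease at rate at least `k / x` near infinity. -/
lemma not_deriv_le_neg_const_div {g g' : ℝ → ℝ} {k : ℝ} (hk : 0 < k)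
    (hg : ∀ x, 0 < x → HasDerivAt g (g' x) x) (hpos : ∀ x, 0 < x → 0 < g x)
    (h : ∀ x, 1 ≤ x → g' x ≤ -(k / x)) : False := by
  have hanti : AntitoneOn (fun x => g x + k * Real.log x) (Ici 1) := by
    have hd : ∀ x ∈ Ici (1 : ℝ), HasDerivAt (fun x => g x + k * Real.log x) (g' x + k * x⁻¹) x :=
      fun x hx => (hg x (by have := mem_Ici.1 hx; linarith)).add
        ((Real.hasDerivAt_log (by have := mem_Ici.1 hx; linarith)).const_mul k)
    refine antitoneOn_of_hasDerivWithinAt_nonpos (f' := fun x => g' x + k * x⁻¹) (convex_Ici 1)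
      (fun x hx => (hd x hx).continuousAt.continuousWithinAt)
      (fun x hx => (hd x (interior_subset hx)).hasDerivWithinAt) (fun x hx => ?_)
    have := h x (mem_Ici.1 (interior_subset hx))
    rw [div_eq_mul_inv] at this
    linarith
  have hg1 := hpos 1 one_pos
  have hy : 1 ≤ Real.exp (g 1 / k) := Real.one_le_exp (by positivity)
  have h1 := hanti (mem_Ici.2 le_rfl) (mem_Ici.2 hy) hy
  simp only [Real.log_exp, Real.log_one] at h1
  rw [mul_div_cancel₀ _ hk.ne'] at h1
  linarith [hpos _ (Real.exp_pos (g 1 / k))]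

/-- A positive function on `(0, ∞)` cannot increase at rate at least `k / x` near zero. -/
lemma not_const_div_le_deriv {g g' : ℝ → ℝ} {k : ℝ} (hk : 0 < k)
    (hg : ∀ x, 0 < x → HasDerivAt g (g' x) x) (hpos : ∀ x, 0 < x → 0 < g x)
    (h : ∀ x, 0 < x → x ≤ 1 → k / x ≤ g' x) : False := by
  refine not_deriv_le_neg_const_div (g := fun x => g x⁻¹) (g' := fun x => g' x⁻¹ * -(x ^ 2)⁻¹) hk
    (fun x hx => (hg x⁻¹ (inv_pos.2 hx)).comp x (hasDerivAt_inv hx.ne'))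
    (fun x hx => hpos _ (inv_pos.2 hx)) (fun x hx => ?_)
  have hx0 : 0 < x := by linarith
  have h1 := h x⁻¹ (inv_pos.2 hx0) (inv_le_one_of_one_le₀ hx)
  have h2 := mul_le_mul_of_nonneg_right h1 (show 0 ≤ (x ^ 2)⁻¹ by positivity)
  have h3 : k / x⁻¹ * (x ^ 2)⁻¹ = k / x := by field_simp
  linarith

/-- The graph of a function with antitone derivative lies below its tangents. -/
lemma le_tangent_of_antitoneOn {u v : ℝ → ℝ} (hu : ∀ x, 0 < x → HasDerivAt u (v x) x)
    (hv : AntitoneOn v (Ioi 0)) {x y : ℝ} (hx : 0 < x) (hy : 0 < y) :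
    u y ≤ u x + v x * (y - x) := by
  rcases lt_trichotomy x y with h | h | h
  · obtain ⟨c, hc, he⟩ := exists_hasDerivAt_eq_slope u v h
      (fun z hz => (hu z (hx.trans_le hz.1)).continuousAt.continuousWithinAt)
      (fun z hz => hu z (hx.trans hz.1))
    rw [eq_div_iff (by linarith)] at he
    have := hv (mem_Ioi.2 hx) (mem_Ioi.2 (hx.trans hc.1)) hc.1.le
    nlinarith
  · subst h; simp
  · obtain ⟨c, hc, he⟩ := exists_hasDerivAt_eq_slope u v h
      (fun z hz => (hu z (hy.trans_le hz.1)).continuousAt.continuousWithinAt)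
      (fun z hz => hu z (hy.trans hz.1))
    rw [eq_div_iff (by linarith)] at he
    have := hv (mem_Ioi.2 (hy.trans hc.1)) (mem_Ioi.2 hx) hc.2.le
    nlinarith

/-- Basic properties of a nontrivial nonnegative concave function on `(0, ∞)`. -/
lemma concave_nonneg_properties {u v : ℝ → ℝ} (hu : ∀ x, 0 < x → HasDerivAt u (v x) x)
    (hv : AntitoneOn v (Ioi 0)) (h0 : ∀ x, 0 < x → 0 ≤ u x) (hne : ∃ x, 0 < x ∧ u x ≠ 0) :
    (∀ x, 0 < x → 0 < u x) ∧ (∀ x, 0 < x → 0 ≤ v x) ∧ (∀ x, 0 < x → x * v x ≤ u x) := by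
  have hT : ∀ {x y : ℝ}, 0 < x → 0 < y → u y ≤ u x + v x * (y - x) :=
    fun hx hy => le_tangent_of_antitoneOn hu hv hx hy
  have hv0 : ∀ x, 0 < x → 0 ≤ v x := by
    intro x hx
    by_contra! hneg
    have hd : 0 < (u x + 1) / (-v x) := div_pos (by linarith [h0 x hx]) (by linarith)
    have h1 := hT hx (add_pos hx hd)
    have h2 := h0 _ (add_pos hx hd)
    have h3 : v x * ((u x + 1) / (-v x)) = -(u x + 1) := by
      field_simp [hneg.ne]
    rw [add_sub_cancel_left, h3] at h1
    linarith
  refine ⟨fun x hx => ?_, hv0, fun x hx => ?_⟩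
  · refine lt_of_le_of_ne (h0 x hx) fun he => ?_
    obtain ⟨y, hy, hyne⟩ := hne
    have h1 := hT hx (half_pos hx)
    have h2 := h0 _ (half_pos hx)
    have h3 := hv0 x hx
    have h4 : v x = 0 := by nlinarith
    have h5 := hT hx hy
    rw [h4, ← he] at h5
    exact hyne (le_antisymm (by linarith) (h0 y hy))
  · by_contra! hlt
    have hux := h0 x hx
    have hvx : 0 < v x := by
      rcases (hv0 x hx).eq_or_lt with h | h
      · rw [← h] at hlt; linarith
      · exact h
    have hy : 0 < (x - u x / v x) / 2 := by
      have : u x / v x < x := by rw [div_lt_iff₀ hvx]; linarith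
      linarith
    have h1 := hT hx hy
    have h2 := h0 _ hy
    have h3 : v x * (u x / v x) = u x := mul_div_cancel₀ _ hvx.ne'
    nlinarith

/-- Integral-type lower bounds for `u'` and for `u - x u'`, for a positive solution. -/
lemma exists_lower_bounds {p σ : ℝ} {u v : ℝ → ℝ}
    (hu : ∀ x, 0 < x → HasDerivAt u (v x) x)
    (hv : ∀ x, 0 < x → HasDerivAt v (-(x ^ σ * u x ^ p)) x) (hanti : AntitoneOn v (Ioi 0))
    (hpos : ∀ x, 0 < x → 0 < u x) (hv0 : ∀ x, 0 < x → 0 ≤ v x)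
    (hxv : ∀ x, 0 < x → x * v x ≤ u x) :
    ∃ c, 0 < c ∧ (∀ x, 0 < x → c * (x ^ (σ + 1) * u x ^ p) ≤ v x) ∧
      (∀ x, 0 < x → c * (x ^ (σ + 2) * u x ^ p) ≤ u x - x * v x) := by
  have hT : ∀ {x y : ℝ}, 0 < x → 0 < y → u y ≤ u x + v x * (y - x) :=
    fun hx hy => le_tangent_of_antitoneOn hu hanti hx hy
  have hcmp : ∀ x s : ℝ, 0 < x → x / 2 ≤ s → s ≤ 2 * x →
      (2 : ℝ) ^ (-|σ|) * 2 ^ (-|p|) * (x ^ σ * u x ^ p) ≤ s ^ σ * u s ^ p := by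
    intro x s hx h1 h2
    have hs : 0 < s := by linarith
    have hux := hpos x hx
    have hus := hpos s hs
    have hlo : u x / 2 ≤ u s := by
      have h3 := hT hs hx
      have h4 := hxv s hs
      have h5 := hv0 s hs
      nlinarith
    have hhi : u s ≤ 2 * u x := by
      have h3 := hT hx hs
      have h4 := hxv x hx
      have h5 := hv0 x hx
      nlinarith
    calc (2 : ℝ) ^ (-|σ|) * 2 ^ (-|p|) * (x ^ σ * u x ^ p)
        = (2 ^ (-|σ|) * x ^ σ) * (2 ^ (-|p|) * u x ^ p) := by ring
      _ ≤ s ^ σ * u s ^ p := mul_le_mul (two_rpow_neg_abs_mul_rpow_le σ hx h1 h2)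
          (two_rpow_neg_abs_mul_rpow_le p hux hlo hhi) (by positivity) (by positivity)
  set C : ℝ := (2 : ℝ) ^ (-|σ|) * 2 ^ (-|p|) with hC
  have hCpos : 0 < C := by positivity
  refine ⟨C / 4, by positivity, fun x hx => ?_, fun x hx => ?_⟩
  · have hux := hpos x hx
    obtain ⟨s, hs, he⟩ := exists_hasDerivAt_eq_slope v (fun x => -(x ^ σ * u x ^ p))
      (show x < 2 * x by linarith)
      (fun z hz => (hv z (hx.trans_le hz.1)).continuousAt.continuousWithinAt)
      (fun z hz => hv z (hx.trans hz.1))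
    rw [eq_div_iff (by linarith)] at he
    have h1 := hcmp x s hx (by linarith [hs.1]) hs.2.le
    have h2 := hv0 (2 * x) (by linarith)
    have h3 := mul_le_mul_of_nonneg_right h1 hx.le
    have h4 : 0 ≤ C * (x ^ σ * u x ^ p) * x := by positivity
    rw [Real.rpow_add hx, Real.rpow_one]
    nlinarith
  · have hux := hpos x hx
    have hd : ∀ z, 0 < z → HasDerivAt (fun z => u z - z * v z) (z * (z ^ σ * u z ^ p)) z := by
      intro z hz
      have h := (hu z hz).sub ((hasDerivAt_id z).mul (hv z hz))
      refine h.congr_deriv ?_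
      simp
    obtain ⟨s, hs, he⟩ := exists_hasDerivAt_eq_slope (fun z => u z - z * v z)
      (fun z => z * (z ^ σ * u z ^ p)) (show x / 2 < x by linarith)
      (fun z hz => (hd z ((half_pos hx).trans_le hz.1)).continuousAt.continuousWithinAt)
      (fun z hz => hd z ((half_pos hx).trans hz.1))
    rw [eq_div_iff (by linarith)] at he
    have h1 := hcmp x s hx hs.1.le (by linarith [hs.2])
    have h2 := hxv (x / 2) (half_pos hx)
    have h4 : 0 ≤ C * (x ^ σ * u x ^ p) := by positivity
    have h3 := mul_le_mul hs.1.le h1 h4 (by linarith [hs.1])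
    rw [Real.rpow_add hx, Real.rpow_two]
    nlinarith

/-- For positive `u` with `u' = v`, the derivative of `u ^ (1 - p)`. -/
lemma hasDerivAt_rpow_one_sub {u : ℝ → ℝ} {p v x : ℝ} (hu : HasDerivAt u v x) (hpos : 0 < u x) :
    HasDerivAt (fun x => u x ^ (1 - p)) ((1 - p) * (v / u x ^ p)) x := by
  refine (hu.rpow_const (p := 1 - p) (Or.inl hpos.ne')).congr_deriv ?_
  rw [show 1 - p - 1 = -p by ring, Real.rpow_neg hpos.le]
  ring

/-- No positive solution exists outside the two regions. -/
lemma hardy_henon_exponents_of_pos {p σ : ℝ} {u v : ℝ → ℝ}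
    (hu : ∀ x, 0 < x → HasDerivAt u (v x) x)
    (hv : ∀ x, 0 < x → HasDerivAt v (-(x ^ σ * u x ^ p)) x) (hanti : AntitoneOn v (Ioi 0))
    (hpos : ∀ x, 0 < x → 0 < u x) (hv0 : ∀ x, 0 < x → 0 ≤ v x)
    (hxv : ∀ x, 0 < x → x * v x ≤ u x) :
    (σ < -2 ∧ -1 - σ < p) ∨ (-2 < σ ∧ p < -1 - σ) := by
  obtain ⟨c, hc, hcv, hch⟩ := exists_lower_bounds hu hv hanti hpos hv0 hxv
  have hB1 : ∀ x, 0 < x → c * x ^ (σ + 1) ≤ v x / u x ^ p := by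
    intro x hx
    have hup : 0 < u x ^ p := Real.rpow_pos_of_pos (hpos x hx) p
    rw [le_div_iff₀ hup]
    linarith [hcv x hx]
  have hw : ∀ x, 0 < x → HasDerivAt (fun x => u x / x) (-((u x - x * v x) / x ^ 2)) x := by
    intro x hx
    refine ((hu x hx).div (hasDerivAt_id x) hx.ne').congr_deriv ?_
    simp only [id]
    ring
  have hwpos : ∀ x, 0 < x → 0 < u x / x := fun x hx => div_pos (hpos x hx) hx
  have hB2 : ∀ x, 0 < x → c * x ^ (σ + p) ≤ (u x - x * v x) / x ^ 2 / (u x / x) ^ p := by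
    intro x hx
    have hup : 0 < u x ^ p := Real.rpow_pos_of_pos (hpos x hx) p
    have hxp : 0 < x ^ p := Real.rpow_pos_of_pos hx p
    have h := hch x hx
    rw [Real.rpow_add hx, Real.rpow_two] at h
    rw [Real.div_rpow (hpos x hx).le hx.le, Real.rpow_add hx, le_div_iff₀ (by positivity),
      le_div_iff₀ (by positivity)]
    calc c * (x ^ σ * x ^ p) * (u x ^ p / x ^ p) * x ^ 2 = c * (x ^ σ * x ^ 2 * u x ^ p) := by
          field_simp
      _ ≤ _ := h
  have hbig : ∀ q x : ℝ, -1 ≤ q → 1 ≤ x → c / x ≤ c * x ^ q := by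
    intro q x hq hx
    rw [div_eq_mul_inv, ← Real.rpow_neg_one]
    exact mul_le_mul_of_nonneg_left (Real.rpow_le_rpow_of_exponent_le hx hq) hc.le
  have hsmall : ∀ q x : ℝ, q ≤ -1 → 0 < x → x ≤ 1 → c / x ≤ c * x ^ q := by
    intro q x hq hx hx1
    rw [div_eq_mul_inv, ← Real.rpow_neg_one]
    exact mul_le_mul_of_nonneg_left (Real.rpow_le_rpow_of_exponent_ge hx hx1 hq) hc.le
  have hgu := fun x hx => hasDerivAt_rpow_one_sub (p := p) (hu x hx) (hpos x hx)
  have hgw := fun x hx => hasDerivAt_rpow_one_sub (p := p) (hw x hx) (hwpos x hx)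
  have hgu0 : ∀ x, 0 < x → 0 < u x ^ (1 - p) := fun x hx => Real.rpow_pos_of_pos (hpos x hx) _
  have hgw0 : ∀ x, 0 < x → 0 < (u x / x) ^ (1 - p) :=
    fun x hx => Real.rpow_pos_of_pos (hwpos x hx) _
  rcases lt_trichotomy p 1 with hp | hp | hp
  · right
    have hk : 0 < (1 - p) * c := mul_pos (by linarith) hc
    constructor
    · by_contra! hσ
      refine not_const_div_le_deriv hk hgu hgu0 fun x hx hx1 => ?_
      have h1 := (hsmall (σ + 1) x (by linarith) hx hx1).trans (hB1 x hx)
      rw [mul_div_assoc]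
      exact mul_le_mul_of_nonneg_left h1 (by linarith)
    · by_contra! hσ
      refine not_deriv_le_neg_const_div hk hgw hgw0 fun x hx => ?_
      have h1 := (hbig (σ + p) x (by linarith) hx).trans (hB2 x (by linarith))
      rw [mul_div_assoc, neg_div, mul_neg]
      exact neg_le_neg (mul_le_mul_of_nonneg_left h1 (by linarith))
  · exfalso
    subst hp
    rcases eq_or_ne (σ + 2) 0 with hσ | hσ
    · obtain rfl : σ = -2 := by linarith
      have hle : ∀ x, 0 < x → u x ≤ x * v x := by
        intro x hx
        have hd : ∀ z ∈ Ici x, HasDerivAt (fun z => v z - u x * z⁻¹)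
            (-(z ^ (-2 : ℝ) * u z ^ (1 : ℝ)) - u x * -(z ^ 2)⁻¹) z := fun z hz =>
          (hv z (hx.trans_le hz)).sub ((hasDerivAt_inv (hx.trans_le hz).ne').const_mul (u x))
        have ha : AntitoneOn (fun z => v z - u x * z⁻¹) (Ici x) := by
          refine antitoneOn_of_hasDerivWithinAt_nonpos (convex_Ici x)
            (fun z hz => (hd z hz).continuousAt.continuousWithinAt)
            (fun z hz => (hd z (interior_subset hz)).hasDerivWithinAt) (fun z hz => ?_)
          have hxz : x ≤ z := mem_Ici.1 (interior_subset hz)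
          have hz0 : 0 < z := hx.trans_le hxz
          have h1 := le_tangent_of_antitoneOn hu hanti hz0 hx
          have h2 := hv0 z hz0
          have h3 : u x ≤ u z := by nlinarith
          rw [Real.rpow_one, Real.rpow_neg hz0.le, Real.rpow_two]
          have h4 := mul_le_mul_of_nonneg_right h3 (show 0 ≤ (z ^ 2)⁻¹ by positivity)
          linarith
        have hlim : Filter.Tendsto (fun z : ℝ => -(u x * z⁻¹)) Filter.atTop (nhds 0) := by
          simpa using (tendsto_inv_atTop_zero.const_mul (u x)).neg
        have h5 : 0 ≤ v x - u x * x⁻¹ := by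
          refine le_of_tendsto hlim ?_
          filter_upwards [Filter.eventually_ge_atTop x] with z hz
          have := ha (mem_Ici.2 le_rfl) (mem_Ici.2 hz) hz
          have := hv0 z (hx.trans_le hz)
          simp only at *
          linarith
        have h6 := mul_nonneg hx.le h5
        have h7 : x * (v x - u x * x⁻¹) = x * v x - u x := by field_simp
        linarith
      have h1 := hch 1 one_pos
      have h2 := hle 1 one_pos
      have h3 := hpos 1 one_pos
      simp only [Real.one_rpow, Real.rpow_one, one_mul] at h1 h2
      nlinarith
    · have hx : (0 : ℝ) < (2 / c) ^ (σ + 2)⁻¹ := by positivity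
      have h1 := hch _ hx
      have h2 := hv0 _ hx
      have h3 := hpos _ hx
      rw [← Real.rpow_mul (by positivity), inv_mul_cancel₀ hσ, Real.rpow_one, Real.rpow_one,
        ← mul_assoc, mul_div_cancel₀ _ hc.ne'] at h1
      nlinarith [mul_nonneg hx.le h2]
  · left
    have hk : 0 < (p - 1) * c := mul_pos (by linarith) hc
    constructor
    · by_contra! hσ
      refine not_deriv_le_neg_const_div hk hgu hgu0 fun x hx => ?_
      have h1 := (hbig (σ + 1) x (by linarith) hx).trans (hB1 x (by linarith))
      rw [mul_div_assoc, ← neg_sub p 1, neg_mul]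
      exact neg_le_neg (mul_le_mul_of_nonneg_left h1 (by linarith))
    · by_contra! hσ
      refine not_const_div_le_deriv hk hgw hgw0 fun x hx hx1 => ?_
      have h1 := (hsmall (σ + p) x (by linarith) hx hx1).trans (hB2 x hx)
      rw [mul_div_assoc, neg_div, ← neg_sub p 1, neg_mul_neg]
      exact mul_le_mul_of_nonneg_left h1 (by linarith)

/-- The explicit solution `A x ^ θ`. -/
lemma exists_power_solution {p σ θ : ℝ} (hp : p ≠ 1) (hθ0 : 0 < θ) (hθ1 : θ < 1)
    (hθ : θ - 2 = σ + θ * p) :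
    ∃ u : ℝ → ℝ,
      ContDiffOn ℝ 2 u (Set.Ioi 0) ∧
      (∀ x ∈ Set.Ioi (0 : ℝ), 0 ≤ u x) ∧
      (∀ x ∈ Set.Ioi (0 : ℝ), -(deriv (deriv u) x) = x ^ σ * u x ^ p) ∧
      (∃ x ∈ Set.Ioi (0 : ℝ), u x ≠ 0) := by
  have hb : 0 < θ * (1 - θ) := mul_pos hθ0 (by linarith)
  set A : ℝ := (θ * (1 - θ)) ^ (p - 1)⁻¹ with hA
  have hA0 : 0 < A := Real.rpow_pos_of_pos hb _
  have hAp : A ^ p = A * (θ * (1 - θ)) := by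
    have h : A ^ (p - 1) = θ * (1 - θ) := by
      rw [hA, ← Real.rpow_mul hb.le, inv_mul_cancel₀ (sub_ne_zero.2 hp), Real.rpow_one]
    rw [← h, show p = 1 + (p - 1) by ring, Real.rpow_add hA0, Real.rpow_one, add_sub_cancel_left]
  refine ⟨fun x => A * x ^ θ, fun x hx => ?_, fun x hx => ?_, fun x hx => ?_, 1, mem_Ioi.2 one_pos, ?_⟩
  · exact (contDiffAt_const.mul
      (Real.contDiffAt_rpow_const_of_ne (mem_Ioi.1 hx).ne')).contDiffWithinAt
  · exact mul_nonneg hA0.le (Real.rpow_nonneg (mem_Ioi.1 hx).le _)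
  · have hx0 : 0 < x := hx
    have hd : ∀ z, 0 < z → deriv (fun x : ℝ => A * x ^ θ) z = A * (θ * z ^ (θ - 1)) :=
      fun z hz => ((Real.hasDerivAt_rpow_const (Or.inl hz.ne')).const_mul A).deriv
    have he : deriv (fun x : ℝ => A * x ^ θ) =ᶠ[nhds x] fun z => A * (θ * z ^ (θ - 1)) := by
      filter_upwards [Ioi_mem_nhds hx0] with z hz using hd z hz
    rw [he.deriv_eq, (((Real.hasDerivAt_rpow_const (p := θ - 1)
      (Or.inl hx0.ne')).const_mul θ).const_mul A).deriv,
      Real.mul_rpow hA0.le (Real.rpow_nonneg hx0.le _), ← Real.rpow_mul hx0.le, hAp,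
      show θ - 1 - 1 = σ + θ * p by linarith, Real.rpow_add hx0]
    ring
  · simpa using hA0.ne'

/-- **Theorem 1.3.** The equation `-u'' = x^σ u^p` on `(0, +∞)` admits a non-trivial,
non-negative `C²` solution iff either (`σ < -2` and `p > -1-σ`) or (`σ > -2` and `p < -1-σ`). -/
theorem hardy_henon_half_line_existence_iff (p σ : ℝ) :
    (∃ u : ℝ → ℝ,
      ContDiffOn ℝ 2 u (Set.Ioi 0) ∧
      (∀ x ∈ Set.Ioi (0 : ℝ), 0 ≤ u x) ∧
      (∀ x ∈ Set.Ioi (0 : ℝ), -(deriv (deriv u) x) = x ^ σ * u x ^ p) ∧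
      (∃ x ∈ Set.Ioi (0 : ℝ), u x ≠ 0)) ↔
    ((σ < -2 ∧ -1 - σ < p) ∨ (-2 < σ ∧ p < -1 - σ)) := by
  constructor
  · rintro ⟨u, hC2, h0, hode, hne⟩
    have hC2' : ContDiffOn ℝ (1 + 1) u (Ioi 0) := by
      rwa [one_add_one_eq_two]
    obtain ⟨hd, -, hC1⟩ := (contDiffOn_succ_iff_deriv_of_isOpen isOpen_Ioi).1 hC2'
    have hu : ∀ x, 0 < x → HasDerivAt u (deriv u x) x := fun x hx =>
      (hd.differentiableAt (Ioi_mem_nhds hx)).hasDerivAt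
    have hv : ∀ x, 0 < x → HasDerivAt (deriv u) (-(x ^ σ * u x ^ p)) x := fun x hx =>
      ((hC1.differentiableOn one_ne_zero).differentiableAt (Ioi_mem_nhds hx)).hasDerivAt.congr_deriv
        (by rw [← hode x hx, neg_neg])
    have hanti : AntitoneOn (deriv u) (Ioi 0) := by
      refine antitoneOn_of_hasDerivWithinAt_nonpos (convex_Ioi 0)
        (fun x hx => (hv x hx).continuousAt.continuousWithinAt)
        (fun x hx => (hv x (interior_subset hx)).hasDerivWithinAt) (fun x hx => ?_)
      have hx0 : 0 < x := interior_subset hx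
      exact neg_nonpos.2 (mul_nonneg (Real.rpow_nonneg hx0.le _) (Real.rpow_nonneg (h0 x hx0) _))
    obtain ⟨hpos, hv0, hxv⟩ := concave_nonneg_properties hu hanti h0 hne
    exact hardy_henon_exponents_of_pos hu hv hanti hpos hv0 hxv
  · rintro (⟨hσ, hp⟩ | ⟨hσ, hp⟩)
    · have hp1 : 0 < p - 1 := by linarith
      refine exists_power_solution (θ := -(σ + 2) / (p - 1)) (by linarith)
        (div_pos (by linarith) hp1) ((div_lt_one hp1).2 (by linarith)) ?_
      field_simp
      ring
    · have hp1 : 0 < 1 - p := by linarith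
      refine exists_power_solution (θ := (σ + 2) / (1 - p)) (by linarith)
        (div_pos (by linarith) hp1) ((div_lt_one hp1).2 (by linarith)) ?_
      field_simp
      ring
end

section
/- Let p, σ ∈ ℝ be arbitrary and let u ≥ 0 be a non-trivial C² solution to -u''(r) = r^σ u(r)^p on (0,+∞) (not necessarily continuous up to 0). Then: (1) u is increasing and u' is decreasing on (0,+∞); (2) there exist positive constants c, C, and r₁ such that c ≤ u(r) ≤ C r for all r ≥ r₁. -/
open Set

/-- If the derivative of `u` is non-increasing on `(0,+∞)`, then `u` lies below its tangents. -/
lemma le_tangent_of_antitoneOn_deriv {u : ℝ → ℝ} (hd : DifferentiableOn ℝ u (Ioi 0))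
    (hanti : AntitoneOn (deriv u) (Ioi 0)) {a x : ℝ} (ha : 0 < a) (hax : a ≤ x) :
    u x ≤ u a + deriv u a * (x - a) := by
  have hsub : Ici a ⊆ Ioi (0 : ℝ) := fun y hy => lt_of_lt_of_le ha hy
  have h := Convex.image_sub_le_mul_sub_of_deriv_le (convex_Ici a) (hd.mono hsub).continuousOn
    (hd.mono (interior_subset.trans hsub))
    (fun y hy => hanti ha (hsub (interior_subset hy)) (interior_subset hy))
    a self_mem_Ici x hax hax
  linarith

/-- If `u ≥ 0` has non-increasing derivative on `(0,+∞)`, then its derivative is non-negative. -/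
lemma deriv_nonneg_of_antitoneOn_deriv {u : ℝ → ℝ} (hd : DifferentiableOn ℝ u (Ioi 0))
    (hanti : AntitoneOn (deriv u) (Ioi 0)) (hnonneg : ∀ r ∈ Ioi (0 : ℝ), 0 ≤ u r)
    {a : ℝ} (ha : 0 < a) : 0 ≤ deriv u a := by
  by_contra! hneg
  have hua : 0 ≤ u a := hnonneg a ha
  have ht : 0 < (u a + 1) / -deriv u a := div_pos (by linarith) (by linarith)
  have hle := le_tangent_of_antitoneOn_deriv hd hanti ha (le_add_of_nonneg_right ht.le)
  have hux := hnonneg (a + (u a + 1) / -deriv u a) (add_pos ha ht)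
  have hmul : deriv u a * (a + (u a + 1) / -deriv u a - a) = -(u a + 1) := by
    have := hneg.ne
    field_simp
    ring
  linarith

/-- **Lemma 2.3.** Any non-trivial non-negative `C²` solution of `-u'' = r^σ u^p` on `(0,+∞)`
is non-decreasing with non-increasing derivative, and satisfies `c ≤ u(r) ≤ C r` for large `r`. -/
theorem one_dim_solution_basic_properties (p σ : ℝ) (u : ℝ → ℝ)
    (hreg : ContDiffOn ℝ 2 u (Set.Ioi 0))
    (hnonneg : ∀ r ∈ Set.Ioi (0 : ℝ), 0 ≤ u r)
    (heq : ∀ r ∈ Set.Ioi (0 : ℝ), -(deriv (deriv u) r) = r ^ σ * u r ^ p)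
    (hnt : ∃ r ∈ Set.Ioi (0 : ℝ), u r ≠ 0) :
    MonotoneOn u (Set.Ioi 0) ∧
    AntitoneOn (deriv u) (Set.Ioi 0) ∧
    ∃ c > (0 : ℝ), ∃ C > (0 : ℝ), ∃ r₁ > (0 : ℝ), ∀ r ≥ r₁, c ≤ u r ∧ u r ≤ C * r := by
  have hd : DifferentiableOn ℝ u (Ioi 0) := hreg.differentiableOn (by norm_num)
  have hd' : DifferentiableOn ℝ (deriv u) (Ioi 0) :=
    (hreg.deriv_of_isOpen (m := 1) isOpen_Ioi (by norm_num)).differentiableOn (by norm_num)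
  have hanti : AntitoneOn (deriv u) (Ioi 0) := by
    refine antitoneOn_of_deriv_nonpos (convex_Ioi 0) hd'.continuousOn
      (by rwa [interior_Ioi]) fun x hx => ?_
    rw [interior_Ioi] at hx
    have := mul_nonneg (Real.rpow_nonneg (le_of_lt hx) σ) (Real.rpow_nonneg (hnonneg x hx) p)
    linarith [heq x hx]
  have hpos {a : ℝ} (ha : 0 < a) : 0 ≤ deriv u a :=
    deriv_nonneg_of_antitoneOn_deriv hd hanti hnonneg ha
  have hmono : MonotoneOn u (Ioi 0) := by
    refine monotoneOn_of_deriv_nonneg (convex_Ioi 0) hd.continuousOn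
      (by rwa [interior_Ioi]) fun x hx => ?_
    rw [interior_Ioi] at hx
    exact hpos hx
  obtain ⟨a, ha, hua⟩ := hnt
  rw [mem_Ioi] at ha
  have hua : 0 < u a := lt_of_le_of_ne (hnonneg a ha) hua.symm
  have hda := hpos ha
  refine ⟨hmono, hanti, u a, hua, u a + deriv u a, by linarith, max a 1,
    lt_max_of_lt_left ha, fun r hr => ?_⟩
  have har : a ≤ r := (le_max_left a 1).trans hr
  have h1r : 1 ≤ r := (le_max_right a 1).trans hr
  refine ⟨hmono ha (ha.trans_le har) har, ?_⟩
  have := le_tangent_of_antitoneOn_deriv hd hanti ha har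
  nlinarith [mul_nonneg hua.le (sub_nonneg.2 h1r), mul_nonneg hda ha.le]
end

section
/- There is no non-trivial, non-negative C² solution to the Cauchy–Euler-type equation -u''(x) = x^{-2} u(x) on (0,+∞); equivalently, the equation x² u''(x) + u(x) = 0 on (0,+∞) admits no non-negative solution other than the zero function. -/
open Set

/-- The Wronskian of `u` and the oscillating solution `√x * sin (ω * (log x - log a))`,
`ω = √3 / 2`, is locally constant. -/
lemma hasDerivAt_wronskian_cauchy_euler {u du : ℝ → ℝ} {a x ω : ℝ} (hx : 0 < x)
    (hω : ω ^ 2 = 3 / 4) (h1 : HasDerivAt u (du x) x)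
    (h2 : HasDerivAt du (-(u x / x ^ 2)) x) :
    HasDerivAt (fun y => du y * (√y * Real.sin (ω * (Real.log y - Real.log a))) -
      u y * ((Real.sin (ω * (Real.log y - Real.log a)) / 2 +
        ω * Real.cos (ω * (Real.log y - Real.log a))) / √y)) 0 x := by
  have hs : HasDerivAt (fun y => √y) (1 / (2 * √x)) x := Real.hasDerivAt_sqrt hx.ne'
  have hθ : HasDerivAt (fun y => ω * (Real.log y - Real.log a)) (ω * x⁻¹) x :=
    ((Real.hasDerivAt_log hx.ne').sub_const _).const_mul ω
  have hpos : 0 < √x := Real.sqrt_pos.2 hx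
  have hw := h2.mul (hs.mul hθ.sin)
  have hw' := h1.mul (((hθ.sin.div_const 2).add (hθ.cos.const_mul ω)).div hs hpos.ne')
  refine (hw.sub hw').congr_deriv ?_
  simp only [Pi.mul_apply, Pi.add_apply, Pi.div_apply]
  generalize Real.sin (ω * (Real.log x - Real.log a)) = S
  generalize Real.cos (ω * (Real.log x - Real.log a)) = C
  generalize du x = d
  generalize u x = v
  have hsq : x = √x ^ 2 := (Real.sq_sqrt hx.le).symm
  generalize √x = s at *
  subst hsq
  field_simp
  linear_combination (4 * v * S) * hω

/-- The Cauchy–Euler-type equation `-u'' = x^{-2} u` on `(0,+∞)` has no non-trivial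
non-negative `C²` solution. -/
theorem cauchy_euler_no_nonneg_solution (u : ℝ → ℝ)
    (hreg : ContDiffOn ℝ 2 u (Set.Ioi 0))
    (hnonneg : ∀ x ∈ Set.Ioi (0 : ℝ), 0 ≤ u x)
    (heq : ∀ x ∈ Set.Ioi (0 : ℝ), -(deriv (deriv u) x) = x ^ (-2 : ℝ) * u x) :
    ∀ x ∈ Set.Ioi (0 : ℝ), u x = 0 := by
  intro a ha
  have ha' : 0 < a := ha
  set ω : ℝ := √3 / 2 with hω_def
  have hω : 0 < ω := by positivity
  have hω2 : ω ^ 2 = 3 / 4 := by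
    rw [hω_def, div_pow, Real.sq_sqrt (by norm_num)]
    norm_num
  have h1 : ∀ x ∈ Ioi (0 : ℝ), HasDerivAt u (deriv u x) x := fun x hx =>
    ((hreg.differentiableOn (by norm_num)).differentiableAt (isOpen_Ioi.mem_nhds hx)).hasDerivAt
  have hreg' : ContDiffOn ℝ 1 (deriv u) (Ioi 0) :=
    hreg.deriv_of_isOpen isOpen_Ioi (by norm_num)
  have h2 : ∀ x ∈ Ioi (0 : ℝ), HasDerivAt (deriv u) (-(u x / x ^ 2)) x := fun x hx => by
    have h := ((hreg'.differentiableOn (by norm_num)).differentiableAt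
      (isOpen_Ioi.mem_nhds hx)).hasDerivAt
    refine h.congr_deriv ?_
    have hx2 : x ^ (-2 : ℝ) = (x ^ 2)⁻¹ := by
      rw [Real.rpow_neg (le_of_lt hx)]
      norm_cast
    have := heq x hx
    rw [hx2] at this
    rw [div_eq_inv_mul, ← this, neg_neg]
  set b := a * Real.exp (Real.pi / ω) with hb_def
  have hb : 0 < b := by positivity
  have hab : a ≤ b :=
    le_mul_of_one_le_right ha'.le (Real.one_le_exp (by positivity))
  have hθb : ω * (Real.log b - Real.log a) = Real.pi := by
    rw [hb_def, Real.log_mul ha'.ne' (Real.exp_pos _).ne', Real.log_exp]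
    field_simp
    ring
  have hW := fun x (hx : x ∈ Ioi (0 : ℝ)) =>
    hasDerivAt_wronskian_cauchy_euler (a := a) hx hω2 (h1 x hx) (h2 x hx)
  have hconst := constant_of_has_deriv_right_zero
    (fun x hx => (hW x (ha'.trans_le hx.1)).continuousAt.continuousWithinAt)
    (fun x hx => (hW x (ha'.trans_le hx.1)).hasDerivWithinAt) b (right_mem_Icc.2 hab)
  simp only [hθb, sub_self, mul_zero, Real.sin_pi, Real.cos_pi, Real.sin_zero, Real.cos_zero,
    zero_div, zero_add, zero_sub, mul_one] at hconst
  have hua := hnonneg a ha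
  have hub : 0 ≤ u b * (ω / √b) := mul_nonneg (hnonneg b hb) (by positivity)
  have hk : 0 < ω / √a := div_pos hω (Real.sqrt_pos.2 ha')
  have hle : u a * (ω / √a) ≤ 0 := by
    have : u b * (ω * -1 / √b) = -(u b * (ω / √b)) := by ring
    linarith
  exact le_antisymm (nonpos_of_mul_nonpos_left hle hk) hua
end

section
/- The function u : ℝ → ℝ defined by u(x) = |x|^{1/2} sin((√3/2) log|x|) for x ≠ 0 and u(0) = 0 is continuous on ℝ, is C² on ℝ∖{0}, and satisfies -u''(x) = |x|^{-2} u(x) for every x ≠ 0; in particular, the equation -u'' = |x|^{-2} u on ℝ admits a sign-changing classical solution even though it has no non-negative non-trivial classical solution. -/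
open Set

/-- The explicit sign-changing function `|x|^{1/2} sin((√3/2) log |x|)` (with value `0` at the
origin). -/
noncomputable def oscSol (x : ℝ) : ℝ :=
  |x| ^ ((1 : ℝ) / 2) * Real.sin (Real.sqrt 3 / 2 * Real.log |x|)

/-- The solution `x ↦ |x|^{1/2} sin((√3/2) (log|x| - c))` of `-u'' = |x|^{-2} u`, in exponential
form. -/
noncomputable def oscShift (c x : ℝ) : ℝ :=
  Real.exp (Real.log x / 2) * Real.sin (Real.sqrt 3 / 2 * (Real.log x - c))

/-- The derivative of `oscShift c`. -/
noncomputable def oscShiftDeriv (c x : ℝ) : ℝ :=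
  Real.exp (Real.log x / 2) * (Real.sin (Real.sqrt 3 / 2 * (Real.log x - c)) / 2 +
    Real.sqrt 3 / 2 * Real.cos (Real.sqrt 3 / 2 * (Real.log x - c))) / x

lemma hasDerivAt_oscShift (c : ℝ) {x : ℝ} (hx : x ≠ 0) :
    HasDerivAt (oscShift c) (oscShiftDeriv c x) x := by
  have hL := Real.hasDerivAt_log hx
  have hA := ((hL.sub_const c).const_mul (Real.sqrt 3 / 2)).sin
  refine ((hL.div_const 2).exp.mul hA).congr_deriv ?_
  rw [oscShiftDeriv]
  field_simp

lemma hasDerivAt_oscShiftDeriv (c : ℝ) {x : ℝ} (hx : x ≠ 0) :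
    HasDerivAt (oscShiftDeriv c) (-(oscShift c x / x ^ 2)) x := by
  have hL := Real.hasDerivAt_log hx
  have hA := (hL.sub_const c).const_mul (Real.sqrt 3 / 2)
  have h := ((hL.div_const 2).exp.mul
    ((hA.sin.div_const 2).add (hA.cos.const_mul (Real.sqrt 3 / 2)))).div (hasDerivAt_id x) hx
  have h3 : Real.sqrt 3 ^ 2 = 3 := Real.sq_sqrt (by norm_num)
  refine h.congr_deriv ?_
  simp only [oscShift, id, Pi.mul_apply, Pi.add_apply]
  field_simp
  ring_nf
  rw [h3]
  ring

lemma oscSol_eq_oscShift {x : ℝ} (hx : x ≠ 0) : oscSol x = oscShift 0 x := by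
  rw [oscSol, oscShift, Real.rpow_def_of_pos (abs_pos.mpr hx), Real.log_abs, sub_zero,
    mul_one_div]

/-- A function that is non-negative and solves `v'' = -v / x ^ 2` on `(0, ∞)` vanishes there. -/
lemma eq_zero_of_nonneg_solution {v v' : ℝ → ℝ} (hv : ∀ x, 0 < x → 0 ≤ v x)
    (h1 : ∀ x, 0 < x → HasDerivAt v (v' x) x)
    (h2 : ∀ x, 0 < x → HasDerivAt v' (-(v x / x ^ 2)) x) {a : ℝ} (ha : 0 < a) : v a = 0 := by
  have h3 : 0 < Real.sqrt 3 := by positivity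
  have hW : ∀ x ∈ Ioi (0 : ℝ), HasDerivAt
      (fun x => v' x * oscShift (Real.log a) x - v x * oscShiftDeriv (Real.log a) x) 0 x := by
    intro x hx
    have hx0 : x ≠ 0 := ne_of_gt hx
    refine (((h2 x hx).mul (hasDerivAt_oscShift _ hx0)).sub
      ((h1 x hx).mul (hasDerivAt_oscShiftDeriv _ hx0))).congr_deriv ?_
    ring
  obtain ⟨b, hb, hlog⟩ : ∃ b : ℝ, 0 < b ∧
      Real.sqrt 3 / 2 * (Real.log b - Real.log a) = Real.pi := by
    refine ⟨a * Real.exp (2 * Real.pi / Real.sqrt 3), by positivity, ?_⟩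
    rw [Real.log_mul ha.ne' (Real.exp_ne_zero _), Real.log_exp]
    field_simp
    ring
  have hconst := isOpen_Ioi.is_const_of_deriv_eq_zero (convex_Ioi (0 : ℝ)).isPreconnected
    (fun x hx => (hW x hx).differentiableAt.differentiableWithinAt)
    (fun x hx => (hW x hx).deriv) (mem_Ioi.mpr ha) (mem_Ioi.mpr hb)
  simp only [oscShift, oscShiftDeriv, hlog, sub_self, mul_zero, Real.sin_zero, Real.cos_zero,
    Real.sin_pi, Real.cos_pi] at hconst
  have hca : 0 < Real.exp (Real.log a / 2) * (Real.sqrt 3 / 2) / a := by positivity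
  have hcb : 0 < Real.exp (Real.log b / 2) * (Real.sqrt 3 / 2) / b := by positivity
  have hsum : v a * (Real.exp (Real.log a / 2) * (Real.sqrt 3 / 2) / a) +
      v b * (Real.exp (Real.log b / 2) * (Real.sqrt 3 / 2) / b) = 0 := by
    linear_combination -hconst
  have hvb := mul_nonneg (hv b hb) hcb.le
  have hva := hv a ha
  by_contra hne
  have := mul_pos (lt_of_le_of_ne hva (Ne.symm hne)) hca
  linarith

lemma abs_rpow_neg_two_mul (x y : ℝ) : |x| ^ (-2 : ℝ) * y = y / x ^ 2 := by
  rw [Real.rpow_neg (abs_nonneg x), Real.rpow_two, sq_abs]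
  ring

lemma continuous_oscSol : Continuous oscSol := by
  rw [continuous_iff_continuousAt]
  intro x
  by_cases hx : x = 0
  · subst hx
    have h0 : oscSol 0 = 0 := by simp [oscSol]
    rw [ContinuousAt, h0]
    refine squeeze_zero_norm (a := fun x : ℝ => |x| ^ ((1 : ℝ) / 2)) (fun y => ?_) ?_
    · rw [oscSol, norm_mul, Real.norm_of_nonneg (by positivity : 0 ≤ |y| ^ ((1 : ℝ) / 2))]
      exact mul_le_of_le_one_right (by positivity) (Real.abs_sin_le_one _)
    · have : Continuous fun x : ℝ => |x| ^ ((1 : ℝ) / 2) :=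
        continuous_abs.rpow_const fun _ => Or.inr (by norm_num)
      simpa using this.tendsto 0
  · refine (hasDerivAt_oscShift 0 hx).continuousAt.congr ?_
    filter_upwards [isOpen_ne.mem_nhds hx] with y hy using (oscSol_eq_oscShift hy).symm

lemma contDiffOn_oscSol : ContDiffOn ℝ 2 oscSol {(0 : ℝ)}ᶜ := by
  refine ContDiffOn.congr (f := oscShift 0) ?_ fun x hx => oscSol_eq_oscShift hx
  have hL : ContDiffOn ℝ 2 Real.log {(0 : ℝ)}ᶜ := Real.contDiffOn_log.of_le le_top
  exact (hL.div_const 2).exp.mul (contDiffOn_const.mul (hL.sub contDiffOn_const)).sin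

lemma deriv_deriv_oscSol {x : ℝ} (hx : x ≠ 0) :
    deriv (deriv oscSol) x = -(oscSol x / x ^ 2) := by
  have h : ∀ y : ℝ, y ≠ 0 → deriv oscSol y = oscShiftDeriv 0 y := fun y hy =>
    ((hasDerivAt_oscShift 0 hy).congr_of_eventuallyEq (by
      filter_upwards [isOpen_ne.mem_nhds hy] with z hz using oscSol_eq_oscShift hz)).deriv
  rw [oscSol_eq_oscShift hx]
  refine ((hasDerivAt_oscShiftDeriv 0 hx).congr_of_eventuallyEq ?_).deriv
  filter_upwards [isOpen_ne.mem_nhds hx] with z hz using h z hz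

lemma sin_sqrt_three_div_two_pos : 0 < Real.sin (Real.sqrt 3 / 2) := by
  have h : Real.sqrt 3 < 2 := by
    rw [Real.sqrt_lt' (by norm_num)]
    norm_num
  exact Real.sin_pos_of_pos_of_lt_pi (by positivity) (by linarith [Real.pi_gt_three])

/-- The function `u(x) = |x|^{1/2} sin((√3/2) log|x|)`, `u(0) = 0`, is a sign-changing classical
solution of `-u'' = |x|^{-2} u` on `ℝ`, even though this equation admits no non-trivial
non-negative classical solution. -/
theorem sign_changing_solution_cauchy_euler :
    oscSol 0 = 0 ∧
    Continuous oscSol ∧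
    ContDiffOn ℝ 2 oscSol {(0 : ℝ)}ᶜ ∧
    (∀ x : ℝ, x ≠ 0 → -(deriv (deriv oscSol) x) = |x| ^ (-2 : ℝ) * oscSol x) ∧
    (∃ x : ℝ, oscSol x < 0) ∧ (∃ x : ℝ, 0 < oscSol x) ∧
    ¬ ∃ v : ℝ → ℝ,
      (∀ x, 0 ≤ v x) ∧ Continuous v ∧ ContDiffOn ℝ 2 v {(0 : ℝ)}ᶜ ∧
      (∀ x : ℝ, x ≠ 0 → -(deriv (deriv v) x) = |x| ^ (-2 : ℝ) * v x) ∧ v ≠ 0 := by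
  refine ⟨by simp [oscSol], continuous_oscSol, contDiffOn_oscSol, fun x hx => ?_, ?_, ?_, ?_⟩
  · rw [deriv_deriv_oscSol hx, abs_rpow_neg_two_mul, neg_neg]
  · refine ⟨Real.exp (-1), ?_⟩
    rw [oscSol_eq_oscShift (Real.exp_ne_zero _), oscShift, Real.log_exp, sub_zero, mul_neg_one,
      Real.sin_neg, mul_neg, neg_lt_zero]
    exact mul_pos (Real.exp_pos _) sin_sqrt_three_div_two_pos
  · refine ⟨Real.exp 1, ?_⟩
    rw [oscSol_eq_oscShift (Real.exp_ne_zero _), oscShift, Real.log_exp, sub_zero, mul_one]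
    exact mul_pos (Real.exp_pos _) sin_sqrt_three_div_two_pos
  · rintro ⟨v, hv, hcont, hdiff, heq, hne⟩
    have h1 : ∀ x : ℝ, x ≠ 0 → HasDerivAt v (deriv v x) x := fun x hx =>
      ((hdiff.contDiffAt (isOpen_compl_singleton.mem_nhds hx)).differentiableAt
        (by norm_num)).hasDerivAt
    have h2 : ∀ x : ℝ, x ≠ 0 → HasDerivAt (deriv v) (-(v x / x ^ 2)) x := by
      intro x hx
      have hd : ContDiffOn ℝ 1 (deriv v) {(0 : ℝ)}ᶜ :=
        hdiff.deriv_of_isOpen isOpen_compl_singleton (by norm_num)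
      refine ((hd.contDiffAt (isOpen_compl_singleton.mem_nhds hx)).differentiableAt
        (by norm_num)).hasDerivAt.congr_deriv ?_
      rw [← abs_rpow_neg_two_mul, ← heq x hx, neg_neg]
    have hpos : ∀ x, 0 < x → v x = 0 := fun x hx =>
      eq_zero_of_nonneg_solution (fun y _ => hv y) (fun y hy => h1 y hy.ne')
        (fun y hy => h2 y hy.ne') hx
    have hneg : ∀ x, 0 < x → v (-x) = 0 := fun x hx =>
      eq_zero_of_nonneg_solution (v := fun y => v (-y)) (v' := fun y => -deriv v (-y))
        (fun y _ => hv (-y))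
        (fun y hy => ((h1 (-y) (by linarith)).scomp y (hasDerivAt_neg y)).congr_deriv (by simp))
        (fun y hy => ((h2 (-y) (by linarith)).scomp y (hasDerivAt_neg y)).neg.congr_deriv
          (by simp)) hx
    refine hne (hcont.ext_on (dense_compl_singleton (0 : ℝ)) continuous_const fun x hx => ?_)
    rcases lt_or_gt_of_ne hx with h | h
    · simpa using hneg (-x) (neg_pos.mpr h)
    · exact hpos x h
end

section
/- Assume σ > -2 and p < -1-σ, and set a = (2+σ)/(1-p) ∈ (0,1). Then there exists a one-parameter family {u^α}_{α>0} of positive C² solutions to -u''(x) = x^σ u(x)^p on (0,+∞) such that lim_{x→0⁺} u^α(x)/u_a(x) = 1 for every α > 0, and such that whenever α₁ > α₂ > 0 one has u^{α₁}(x) > u^{α₂}(x) > u_a(x) for every x > 0. In particular, positive solutions are not unique. -/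
open Set Filter

/-- The explicit solution `u_a(x) = c_a x^a` with `a = (2+σ)/(1-p)` and
`c_a = (a(1-a))^{1/(p-1)}`. -/
noncomputable def uExplicit (p σ : ℝ) (x : ℝ) : ℝ :=
  ((2 + σ) / (1 - p) * (1 - (2 + σ) / (1 - p))) ^ (1 / (p - 1)) * x ^ ((2 + σ) / (1 - p))

/-- `u` is a positive `C²` solution of `-u'' = x^σ u^p` on `(0,+∞)`. -/
def IsPosSol (p σ : ℝ) (u : ℝ → ℝ) : Prop :=
  (∀ x ∈ Set.Ioi (0 : ℝ), 0 < u x) ∧ ContDiffOn ℝ 2 u (Set.Ioi 0) ∧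
  ∀ x ∈ Set.Ioi (0 : ℝ), -(deriv (deriv u) x) = x ^ σ * u x ^ p

open MeasureTheory Topology

/-- The one-sided fundamental theorem of calculus from `-∞`, as a lower bound on the lower
integral of the positive part of the derivative. -/
lemma ofReal_le_lintegral_Iic_of_hasDerivAt {F F' : ℝ → ℝ} (hF : ∀ t, HasDerivAt F (F' t) t)
    (hF' : Continuous F') (hlim : Tendsto F atBot (𝓝 0)) (t : ℝ) :
    ENNReal.ofReal (F t) ≤ ∫⁻ s in Iic t, ENNReal.ofReal (F' s) := by
  have hbound : ∀ r ≤ t, ENNReal.ofReal (F t - F r) ≤ ∫⁻ s in Iic t, ENNReal.ofReal (F' s) := by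
    intro r hr
    rw [← intervalIntegral.integral_eq_sub_of_hasDerivAt (fun s _ => hF s)
      (hF'.intervalIntegrable r t), intervalIntegral.integral_of_le hr,
      integral_eq_lintegral_pos_part_sub_lintegral_neg_part
        (hF'.integrableOn_Icc.mono_set Ioc_subset_Icc_self)]
    calc ENNReal.ofReal _ ≤ ENNReal.ofReal (∫⁻ s in Ioc r t, ENNReal.ofReal (F' s)).toReal :=
          ENNReal.ofReal_le_ofReal (sub_le_self _ ENNReal.toReal_nonneg)
      _ ≤ ∫⁻ s in Ioc r t, ENNReal.ofReal (F' s) := ENNReal.ofReal_toReal_le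
      _ ≤ _ := lintegral_mono_set Ioc_subset_Iic_self
  have hlim' : Tendsto (fun r => ENNReal.ofReal (F t - F r)) atBot (𝓝 (ENNReal.ofReal (F t))) := by
    simpa using ENNReal.tendsto_ofReal (hlim.const_sub (F t))
  exact le_of_tendsto hlim' ((eventually_le_atBot t).mono hbound)

lemma lintegral_Iic_of_hasDerivAt_of_nonneg {F F' : ℝ → ℝ} (hF : ∀ t, HasDerivAt F (F' t) t)
    (hF' : Continuous F') (hnonneg : ∀ t, 0 ≤ F' t) (hlim : Tendsto F atBot (𝓝 0)) (t : ℝ) :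
    ∫⁻ s in Iic t, ENNReal.ofReal (F' s) = ENNReal.ofReal (F t) := by
  have hmono : Monotone F := monotone_of_hasDerivAt_nonneg hF hnonneg
  have hint : IntegrableOn F' (Iic t) := by
    refine integrableOn_Iic_of_intervalIntegral_norm_bounded (F t) t (l := atBot) (a := id)
      (fun r => hF'.integrableOn_Ioc) tendsto_id (Eventually.of_forall fun r => ?_)
    simp only [Real.norm_of_nonneg (hnonneg _), id]
    rw [intervalIntegral.integral_eq_sub_of_hasDerivAt (fun s _ => hF s)
      (hF'.intervalIntegrable r t)]
    linarith [hmono.le_of_tendsto hlim r]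
  rw [← ofReal_integral_eq_lintegral_ofReal hint (Eventually.of_forall hnonneg),
    integral_Iic_of_hasDerivAt_of_tendsto' (fun s _ => hF s) hint hlim, sub_zero]

lemma integral_Iic_eq_add_intervalIntegral {f : ℝ → ℝ} (hf : ∀ t, IntegrableOn f (Iic t)) (t : ℝ) :
    ∫ s in Iic t, f s = (∫ s in Iic 0, f s) + ∫ s in (0 : ℝ)..t, f s := by
  rw [← intervalIntegral.integral_Iic_sub_Iic (hf 0) (hf t)]
  ring

lemma continuous_integral_Iic {f : ℝ → ℝ} (hf : ∀ t, IntegrableOn f (Iic t)) :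
    Continuous fun t => ∫ s in Iic t, f s := by
  rw [funext (integral_Iic_eq_add_intervalIntegral hf)]
  refine continuous_const.add (intervalIntegral.continuous_primitive (fun a b => ?_) 0)
  exact ⟨(hf b).mono_set Ioc_subset_Iic_self, (hf a).mono_set Ioc_subset_Iic_self⟩

lemma hasDerivAt_integral_Iic {f : ℝ → ℝ} (hf : ∀ t, IntegrableOn f (Iic t)) (hc : Continuous f)
    (t : ℝ) : HasDerivAt (fun t => ∫ s in Iic t, f s) (f t) t := by
  rw [funext (integral_Iic_eq_add_intervalIntegral hf)]
  exact (hc.integral_hasStrictDerivAt 0 t).hasDerivAt.const_add _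

/-- The integral operator on functions with values in `[0, ∞]` whose fixed points below `S` solve
`z'' + b z' = G z`; its argument is truncated at the barrier `S`. -/
noncomputable def truncatedIntegralOperator (b : ℝ) (G S : ℝ → ℝ) (hG : MonotoneOn G (Ici 0)) :
    (ℝ → ENNReal) →o (ℝ → ENNReal) where
  toFun z t := ∫⁻ s in Iic t, ENNReal.ofReal (Real.exp (-b * s)) *
    ∫⁻ r in Iic s, ENNReal.ofReal (Real.exp (b * r) * G (min (z r) (ENNReal.ofReal (S r))).toReal)
  monotone' z₁ z₂ h t := by
    refine lintegral_mono fun s => mul_le_mul_right (lintegral_mono fun r => ?_) _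
    refine ENNReal.ofReal_le_ofReal (mul_le_mul_of_nonneg_left ?_ (Real.exp_pos _).le)
    exact hG ENNReal.toReal_nonneg ENNReal.toReal_nonneg
      (ENNReal.toReal_mono (by simp) (min_le_min_right _ (h r)))

lemma truncatedIntegralOperator_apply (b : ℝ) (G S : ℝ → ℝ) (hG : MonotoneOn G (Ici 0))
    (z : ℝ → ENNReal) (t : ℝ) :
    truncatedIntegralOperator b G S hG z t =
      ∫⁻ s in Iic t, ENNReal.ofReal (Real.exp (-b * s)) * ∫⁻ r in Iic s, ENNReal.ofReal
        (Real.exp (b * r) * G (min (z r) (ENNReal.ofReal (S r))).toReal) :=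
  rfl

/-- Method of ordered barriers for `z'' + b z' = G z` on the line, with the boundary condition
`z → 0` at `-∞` built into the barriers `w ≤ S`. -/
lemma exists_solution_between_barriers {b : ℝ} {G : ℝ → ℝ} (hGmono : MonotoneOn G (Ici 0))
    (hGcont : ContinuousOn G (Ici 0)) (hG : ∀ z, 0 ≤ z → 0 ≤ G z)
    {w w' w'' S S' S'' : ℝ → ℝ}
    (hw : ∀ t, HasDerivAt w (w' t) t) (hw' : ∀ t, HasDerivAt w' (w'' t) t)
    (hw'c : Continuous w'') (hS : ∀ t, HasDerivAt S (S' t) t)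
    (hS' : ∀ t, HasDerivAt S' (S'' t) t) (hS'c : Continuous S'')
    (hw0 : ∀ t, 0 ≤ w t) (hwS : ∀ t, w t ≤ S t) (hS'0 : ∀ t, 0 ≤ S' t)
    (hsub : ∀ t, w'' t + b * w' t ≤ G (w t)) (hsuper : ∀ t, G (S t) ≤ S'' t + b * S' t)
    (hwlim : Tendsto w atBot (𝓝 0)) (hSlim : Tendsto S atBot (𝓝 0))
    (hw'lim : Tendsto (fun t => Real.exp (b * t) * w' t) atBot (𝓝 0))
    (hS'lim : Tendsto (fun t => Real.exp (b * t) * S' t) atBot (𝓝 0)) :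
    ∃ Z Y : ℝ → ℝ, (∀ t, HasDerivAt Z (Y t) t) ∧
      (∀ t, HasDerivAt Y (G (Z t) - b * Y t) t) ∧ (∀ t, 0 ≤ Y t) ∧
      (∀ t, w t ≤ Z t) ∧ ∀ t, Z t ≤ S t := by
  have hS0 : ∀ t, 0 ≤ S t := fun t => (hw0 t).trans (hwS t)
  have hexp : ∀ t, HasDerivAt (fun t => Real.exp (b * t)) (b * Real.exp (b * t)) t := fun t => by
    simpa [mul_comm] using ((hasDerivAt_id t).const_mul b).exp
  have hexp' : ∀ t, HasDerivAt (fun t => Real.exp (-b * t)) (-b * Real.exp (-b * t)) t := fun t => by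
    simpa [mul_comm] using ((hasDerivAt_id t).const_mul (-b)).exp
  have hcancel : ∀ t, Real.exp (-b * t) * Real.exp (b * t) = 1 := fun t => by
    rw [← Real.exp_add]; simp
  have hflux : ∀ {f f' : ℝ → ℝ}, (∀ t, HasDerivAt f (f' t) t) → ∀ t,
      HasDerivAt (fun t => Real.exp (b * t) * f t) (Real.exp (b * t) * (f' t + b * f t)) t := by
    intro f f' hf t
    exact ((hexp t).mul (hf t)).congr_deriv (by ring)
  have hw'c' : Continuous w' := continuous_iff_continuousAt.2 fun t => (hw' t).continuousAt
  have hSc' : Continuous S' := continuous_iff_continuousAt.2 fun t => (hS' t).continuousAt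
  set T := truncatedIntegralOperator b G S hGmono
  have hinner_le : ∀ (z : ℝ → ENNReal) s,
      ∫⁻ r in Iic s, ENNReal.ofReal
        (Real.exp (b * r) * G (min (z r) (ENNReal.ofReal (S r))).toReal) ≤
      ENNReal.ofReal (Real.exp (b * s) * S' s) := by
    intro z s
    rw [← lintegral_Iic_of_hasDerivAt_of_nonneg (hflux hS') (by fun_prop)
      (fun t => mul_nonneg (Real.exp_pos _).le ((hG _ (hS0 t)).trans (hsuper t))) hS'lim]
    refine lintegral_mono fun r => ENNReal.ofReal_le_ofReal
      (mul_le_mul_of_nonneg_left (le_trans ?_ (hsuper r)) (Real.exp_pos _).le)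
    refine hGmono ENNReal.toReal_nonneg (hS0 r) ?_
    exact (ENNReal.toReal_mono (by simp) (min_le_right _ _)).trans_eq (ENNReal.toReal_ofReal (hS0 r))
  have hT_le : ∀ z t, T z t ≤ ENNReal.ofReal (S t) := by
    intro z t
    rw [← lintegral_Iic_of_hasDerivAt_of_nonneg hS hSc' hS'0 hSlim]
    refine lintegral_mono fun s => (mul_le_mul_right (hinner_le z s) _).trans_eq ?_
    rw [← ENNReal.ofReal_mul (Real.exp_pos _).le, ← mul_assoc, hcancel, one_mul]
  have hle_T : (fun t => ENNReal.ofReal (w t)) ≤ T fun t => ENNReal.ofReal (w t) := by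
    intro t
    refine (ofReal_le_lintegral_Iic_of_hasDerivAt hw hw'c' hwlim t).trans
      (lintegral_mono fun s => ?_)
    calc ENNReal.ofReal (w' s)
        = ENNReal.ofReal (Real.exp (-b * s)) * ENNReal.ofReal (Real.exp (b * s) * w' s) := by
          rw [← ENNReal.ofReal_mul (Real.exp_pos _).le, ← mul_assoc, hcancel, one_mul]
      _ ≤ _ := by
          refine mul_le_mul_right ((ofReal_le_lintegral_Iic_of_hasDerivAt (hflux hw')
            (by fun_prop) hw'lim s).trans (lintegral_mono fun r => ?_)) _
          refine ENNReal.ofReal_le_ofReal (mul_le_mul_of_nonneg_left ?_ (Real.exp_pos _).le)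
          rw [min_eq_left (ENNReal.ofReal_le_ofReal (hwS r)), ENNReal.toReal_ofReal (hw0 r)]
          exact hsub r
  set z := T.gfp
  have hfix : T z = z := T.map_gfp
  have hzS : ∀ t, z t ≤ ENNReal.ofReal (S t) := fun t => by
    rw [← hfix]; exact hT_le z t
  have hwz : ∀ t, ENNReal.ofReal (w t) ≤ z t := T.le_gfp hle_T
  have hztop : ∀ t, z t ≠ ⊤ := fun t => ((hzS t).trans_lt ENNReal.ofReal_lt_top).ne
  have hzmono : Monotone z := fun t₁ t₂ h => by
    rw [← hfix]; exact lintegral_mono_set (Iic_subset_Iic.2 h)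
  set Z : ℝ → ℝ := fun t => (z t).toReal
  have hZ0 : ∀ t, 0 ≤ Z t := fun t => ENNReal.toReal_nonneg
  have hZmono : Monotone Z := fun t₁ t₂ h => ENNReal.toReal_mono (hztop t₂) (hzmono h)
  set Q : ℝ → ℝ := fun r => Real.exp (b * r) * G (Z r) with hQ
  have hQ0 : ∀ r, 0 ≤ Q r := fun r => mul_nonneg (Real.exp_pos _).le (hG _ (hZ0 r))
  have hQmeas : Measurable Q := by
    have : Monotone fun r => G (Z r) := fun r₁ r₂ h => hGmono (hZ0 _) (hZ0 _) (hZmono h)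
    have := this.measurable
    exact (by fun_prop : Measurable fun r => Real.exp (b * r)).mul this
  have hz_eq : ∀ t, z t = ∫⁻ s in Iic t, ENNReal.ofReal (Real.exp (-b * s)) *
      ∫⁻ r in Iic s, ENNReal.ofReal (Q r) := fun t => by
    conv_lhs => rw [← hfix, truncatedIntegralOperator_apply]
    simp only [min_eq_left (hzS _), hQ, Z]
  have hQint : ∀ s, IntegrableOn Q (Iic s) := fun s => by
    rw [IntegrableOn, ← lintegral_ofReal_ne_top_iff_integrable hQmeas.aestronglyMeasurable
      (Eventually.of_forall hQ0)]
    have := hinner_le z s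
    simp only [min_eq_left (hzS _)] at this
    exact (this.trans_lt ENNReal.ofReal_lt_top).ne
  set Y : ℝ → ℝ := fun s => Real.exp (-b * s) * ∫ r in Iic s, Q r with hY
  have hY0 : ∀ s, 0 ≤ Y s := fun s =>
    mul_nonneg (Real.exp_pos _).le (setIntegral_nonneg measurableSet_Iic fun r _ => hQ0 r)
  have hYc : Continuous Y := by
    have := continuous_integral_Iic hQint
    fun_prop
  have hz_eq' : ∀ t, z t = ∫⁻ s in Iic t, ENNReal.ofReal (Y s) := fun t => by
    rw [hz_eq]
    refine lintegral_congr fun s => ?_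
    rw [hY, ENNReal.ofReal_mul (Real.exp_pos _).le,
      ofReal_integral_eq_lintegral_ofReal (hQint s) (Eventually.of_forall hQ0)]
  have hYint : ∀ t, IntegrableOn Y (Iic t) := fun t => by
    rw [IntegrableOn, ← lintegral_ofReal_ne_top_iff_integrable hYc.aestronglyMeasurable
      (Eventually.of_forall hY0), ← hz_eq']
    exact hztop t
  have hZ_eq : Z = fun t => ∫ s in Iic t, Y s := funext fun t => by
    rw [integral_eq_lintegral_of_nonneg_ae (Eventually.of_forall hY0) hYc.aestronglyMeasurable,
      ← hz_eq']
  have hZd : ∀ t, HasDerivAt Z (Y t) t := fun t => by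
    rw [hZ_eq]; exact hasDerivAt_integral_Iic hYint hYc t
  have hZc : Continuous Z := continuous_iff_continuousAt.2 fun t => (hZd t).continuousAt
  have hQc : Continuous Q := by
    have := hGcont.comp_continuous hZc hZ0
    exact (by fun_prop : Continuous fun r => Real.exp (b * r)).mul this
  refine ⟨Z, Y, hZd, fun t => ?_, hY0, fun t => ?_, fun t => ?_⟩
  · refine ((hexp' t).mul (hasDerivAt_integral_Iic hQint hQc t)).congr_deriv ?_
    simp only [hQ, hY]
    linear_combination G (Z t) * hcancel t
  · rw [← ENNReal.toReal_ofReal (hw0 t)]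
    exact ENNReal.toReal_mono (hztop t) (hwz t)
  · rw [← ENNReal.toReal_ofReal (hS0 t)]
    exact ENNReal.toReal_mono ENNReal.ofReal_ne_top (hzS t)

/-- A semilinear perturbation `z'' + b z' = G z` of a linear equation with positive characteristic
root `l` has a positive increasing solution on the whole line emanating from `0` at `-∞`. -/
lemma exists_pos_strictMono_solution {b l κ K : ℝ} {G : ℝ → ℝ} (hGmono : MonotoneOn G (Ici 0))
    (hGcont : ContinuousOn G (Ici 0)) (hG0 : G 0 = 0) (hGpos : ∀ z, 0 < z → 0 < G z)
    (hl : 0 < l) (hκ : 0 < κ) (hK : 0 < K) (hchar : l * (l + b) = κ)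
    (hlower : ∀ z, 0 ≤ z → κ * z - K * z ^ 2 ≤ G z)
    (hupper : ∀ z, 0 ≤ z → G z ≤ κ * z + K * z)
    (hupper_sq : ∀ z, 0 ≤ z → G z ≤ κ * z + K * z ^ 2) :
    ∃ Z Y : ℝ → ℝ, (∀ t, HasDerivAt Z (Y t) t) ∧
      (∀ t, HasDerivAt Y (G (Z t) - b * Y t) t) ∧ (∀ t, 0 < Y t) ∧
      (∀ t, 0 < Z t) ∧ Tendsto Z atBot (𝓝 0) := by
  have hlb : 0 < l + b := by
    by_contra! h
    nlinarith [mul_nonneg hl.le (neg_nonneg.2 h)]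
  set D := K / κ * Real.exp (K / κ) with hD
  have hKκ : 0 < K / κ := by positivity
  have hD0 : 0 < D := by positivity
  have hDK : K / κ ≤ D := le_mul_of_one_le_right hKκ.le (Real.one_le_exp hKκ.le)
  have hDK' : K ≤ D * κ := (div_le_iff₀ hκ).1 hDK
  set s : ℝ → ℝ := fun t => Real.exp (l * t) with hs
  have hs0 : ∀ t, 0 < s t := fun t => Real.exp_pos _
  have hsd : ∀ t, HasDerivAt s (l * s t) t := fun t => by
    simpa [mul_comm] using ((hasDerivAt_id t).const_mul l).exp
  have hsc : Continuous s := by fun_prop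
  have hslim : Tendsto s atBot (𝓝 0) :=
    Real.tendsto_exp_atBot.comp (tendsto_id.const_mul_atBot hl)
  have hblim : Tendsto (fun t => Real.exp (b * t) * s t) atBot (𝓝 0) := by
    refine (Real.tendsto_exp_atBot.comp (tendsto_id.const_mul_atBot hlb)).congr fun t => ?_
    simp only [hs, Function.comp, id, ← Real.exp_add]
    congr 1; ring
  have h1 : ∀ t, 0 < 1 + D * s t := fun t => by have := hs0 t; positivity
  have hden : ∀ t, HasDerivAt (fun t => 1 + D * s t) (D * (l * s t)) t := fun t =>
    ((hsd t).const_mul D).const_add 1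
  have hEd : ∀ t, HasDerivAt (fun t => Real.exp (D * s t))
      (Real.exp (D * s t) * (D * (l * s t))) t := fun t => ((hsd t).const_mul D).exp
  have hSd : ∀ t, HasDerivAt (fun t => s t * Real.exp (D * s t))
      (l * (s t * Real.exp (D * s t)) * (1 + D * s t)) t := fun t =>
    ((hsd t).mul (hEd t)).congr_deriv (by ring)
  have hSlim : Tendsto (fun t => s t * Real.exp (D * s t)) atBot (𝓝 0) := by
    have : Continuous fun x : ℝ => x * Real.exp (D * x) := by fun_prop
    simpa [Function.comp_def] using (this.tendsto 0).comp hslim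
  obtain ⟨Z, Y, hZ, hY, hY0, hwZ, hZS⟩ := exists_solution_between_barriers (b := b) hGmono hGcont
    (fun z hz => hz.eq_or_lt.elim (fun h => by rw [← h, hG0]) fun h => (hGpos z h).le)
    (w := fun t => s t / (1 + D * s t)) (w' := fun t => l * s t / (1 + D * s t) ^ 2)
    (w'' := fun t => l ^ 2 * s t * (1 - D * s t) / (1 + D * s t) ^ 3)
    (S := fun t => s t * Real.exp (D * s t))
    (S' := fun t => l * (s t * Real.exp (D * s t)) * (1 + D * s t))
    (S'' := fun t => l ^ 2 * (s t * Real.exp (D * s t)) * ((1 + D * s t) ^ 2 + D * s t))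
    (fun t => ((hsd t).div (hden t) (h1 t).ne').congr_deriv (by
      have := (h1 t).ne'
      field_simp
      ring))
    (fun t => (((hsd t).const_mul l).div ((hden t).fun_pow 2) (pow_pos (h1 t) 2).ne').congr_deriv (by
      have := hs0 t
      rw [div_eq_div_iff (by positivity) (by positivity)]
      push_cast
      ring))
    (by
      refine Continuous.div (by fun_prop) (by fun_prop) fun t => (pow_pos (h1 t) 3).ne')
    hSd
    (fun t => (((hSd t).const_mul l).mul (hden t)).congr_deriv (by ring))
    (by fun_prop)
    (fun t => by have := hs0 t; positivity)
    (fun t => by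
      have := hs0 t
      refine (div_le_self this.le (by nlinarith [mul_pos hD0 this])).trans ?_
      exact le_mul_of_one_le_right this.le (Real.one_le_exp (by positivity)))
    (fun t => by have := hs0 t; positivity)
    (fun t => by
      have hst := hs0 t
      refine le_trans ?_ (hlower _ (by positivity))
      rw [← sub_nonneg]
      have h1t := h1 t
      generalize s t = x at *
      have : κ * (x / (1 + D * x)) - K * (x / (1 + D * x)) ^ 2 -
          (l ^ 2 * x * (1 - D * x) / (1 + D * x) ^ 3 + b * (l * x / (1 + D * x) ^ 2)) =
          x ^ 2 * ((D * κ - K) * (1 + D * x) + 2 * D * l ^ 2) / (1 + D * x) ^ 3 := by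
        rw [← hchar]
        field_simp
        ring
      rw [this]
      have : 0 ≤ D * κ - K := by linarith
      positivity)
    (fun t => by
      have hst := hs0 t
      have key : G (s t * Real.exp (D * s t)) ≤
          (s t * Real.exp (D * s t)) * (κ + κ * (D * s t)) := by
        rcases le_total (K / κ) (D * s t) with h | h
        · refine (hupper _ (by positivity)).trans ?_
          have : K ≤ κ * (D * s t) := by rwa [div_le_iff₀' hκ] at h
          nlinarith [mul_pos hst (Real.exp_pos (D * s t))]
        · refine (hupper_sq _ (by positivity)).trans ?_
          have h2 : K * (s t * Real.exp (D * s t)) ≤ κ * (D * s t) := by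
            have : κ * D = K * Real.exp (K / κ) := by rw [hD]; field_simp
            calc K * (s t * Real.exp (D * s t)) ≤ K * (s t * Real.exp (K / κ)) := by gcongr
              _ = κ * (D * s t) := by linear_combination (-s t) * this
          nlinarith [mul_pos hst (Real.exp_pos (D * s t))]
      refine key.trans ?_
      rw [← sub_nonneg, ← hchar]
      have : 0 ≤ (s t * Real.exp (D * s t)) * (2 * l ^ 2 * (D * s t) + l ^ 2 * (D * s t) ^ 2) := by
        positivity
      linarith)
    (by
      have : ContinuousAt (fun x : ℝ => x / (1 + D * x)) 0 :=
        ContinuousAt.div (by fun_prop) (by fun_prop) (by simp)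
      simpa [Function.comp_def] using this.tendsto.comp hslim)
    hSlim
    (by
      have : ContinuousAt (fun x : ℝ => l / (1 + D * x) ^ 2) 0 :=
        ContinuousAt.div (by fun_prop) (by fun_prop) (by simp)
      have := hblim.mul (this.tendsto.comp hslim)
      rw [zero_mul] at this
      refine this.congr fun t => ?_
      simp only [Function.comp]
      ring)
    (by
      have : Continuous fun x : ℝ => l * Real.exp (D * x) * (1 + D * x) := by fun_prop
      have := hblim.mul ((this.tendsto 0).comp hslim)
      rw [zero_mul] at this
      refine this.congr fun t => ?_
      simp only [Function.comp]
      ring)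
  have hZpos : ∀ t, 0 < Z t := fun t => lt_of_lt_of_le (div_pos (hs0 t) (h1 t)) (hwZ t)
  have hflux : StrictMono fun t => Real.exp (b * t) * Y t := by
    refine strictMono_of_hasDerivAt_pos (f' := fun t => Real.exp (b * t) * G (Z t)) (fun t => ?_)
      fun t => mul_pos (Real.exp_pos _) (hGpos _ (hZpos t))
    exact ((((hasDerivAt_id t).const_mul b).exp).mul (hY t)).congr_deriv (by simp; ring)
  refine ⟨Z, Y, hZ, hY, fun t => ?_, hZpos, ?_⟩
  · have := (mul_nonneg (Real.exp_pos (b * (t - 1))).le (hY0 (t - 1))).trans_lt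
      (hflux (sub_one_lt t))
    exact (mul_pos_iff_of_pos_left (Real.exp_pos _)).1 this
  · exact squeeze_zero (fun t => (hZpos t).le) hZS hSlim

lemma one_add_sub_rpow_eq {p z : ℝ} (hz : 0 ≤ z) :
    (1 + z) - (1 + z) ^ p = (1 + z) * (1 - (1 + z) ^ (p - 1)) := by
  have : (1 + z) ^ p = (1 + z) * (1 + z) ^ (p - 1) := by
    rw [Real.rpow_sub_one (by positivity)]
    field_simp
  rw [this]
  ring

lemma rpow_one_add_le_one {q z : ℝ} (hq : q ≤ 0) (hz : 0 ≤ z) : (1 + z) ^ q ≤ 1 :=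
  Real.rpow_le_one_of_one_le_of_nonpos (by linarith) hq

lemma monotoneOn_one_add_sub_rpow {p : ℝ} (hp : p ≤ 1) :
    MonotoneOn (fun z : ℝ => (1 + z) - (1 + z) ^ p) (Ici 0) := by
  intro x hx y hy hxy
  simp only [mem_Ici] at hx hy
  simp only [one_add_sub_rpow_eq hx, one_add_sub_rpow_eq hy]
  have hle : (1 + y) ^ (p - 1) ≤ (1 + x) ^ (p - 1) :=
    Real.rpow_le_rpow_of_nonpos (by positivity) (by linarith) (by linarith)
  exact mul_le_mul (by linarith) (by linarith)
    (by linarith [rpow_one_add_le_one (q := p - 1) (by linarith) hx]) (by linarith)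

lemma one_add_sub_rpow_pos {p z : ℝ} (hp : p < 1) (hz : 0 < z) : 0 < (1 + z) - (1 + z) ^ p :=
  sub_pos.2 (Real.rpow_lt_self_of_one_lt (by linarith) hp)

/-- Bernoulli's inequality for nonpositive exponents. -/
lemma one_add_mul_self_le_rpow_one_add_of_nonpos {q z : ℝ} (hq : q ≤ 0) (hz : 0 ≤ z) :
    1 + q * z ≤ (1 + z) ^ q := by
  have h1 : 0 < 1 + z := by linarith
  rw [Real.rpow_def_of_pos h1]
  have := Real.log_le_sub_one_of_pos h1
  nlinarith [Real.add_one_le_exp (Real.log (1 + z) * q)]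

lemma one_add_sub_rpow_le_sq {p z : ℝ} (hp : p < 1) (hz : 0 ≤ z) :
    (1 + z) - (1 + z) ^ p ≤ (1 - p) * z + (1 - p) * z ^ 2 := by
  rw [one_add_sub_rpow_eq hz]
  have := one_add_mul_self_le_rpow_one_add_of_nonpos (q := p - 1) (by linarith) hz
  nlinarith

lemma one_add_sub_rpow_le {p z : ℝ} (hp : p < 1) (hz : 0 ≤ z) :
    (1 + z) - (1 + z) ^ p ≤ (1 - p) * z + (3 - p) * z := by
  rcases le_total z 1 with h | h
  · nlinarith [one_add_sub_rpow_le_sq hp hz, mul_nonneg hz (sub_nonneg.2 h)]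
  · have : 0 ≤ (1 + z) ^ p := by positivity
    nlinarith

lemma le_one_add_sub_rpow {p z : ℝ} (hp : p < 1) (hz : 0 ≤ z) :
    (1 - p) * z - |p| * (1 - p) * z ^ 2 ≤ (1 + z) - (1 + z) ^ p := by
  rcases le_total 0 p with h | h
  · have h1 := rpow_one_add_le_one_add_mul_self (s := z) (by linarith) h hp.le
    have : 0 ≤ |p| * (1 - p) * z ^ 2 :=
      mul_nonneg (mul_nonneg (abs_nonneg p) (by linarith)) (sq_nonneg z)
    linarith
  · rw [abs_of_nonpos h]
    have h1 := one_add_mul_self_le_rpow_one_add (s := z) (p := 1 - p) (by linarith) (by linarith)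
    have h2 : (1 + z) ^ p * (1 + z) ^ (1 - p) = 1 + z := by
      rw [← Real.rpow_add (by linarith)]
      simp
    have h3 : 0 < 1 + (1 - p) * z := by nlinarith
    have h4 : (1 + z) ^ p * (1 + (1 - p) * z) ≤ 1 + z :=
      (mul_le_mul_of_nonneg_left h1 (by positivity)).trans_eq h2
    have h5 : (1 + z) ^ p ≤ 1 + p * z + -p * (1 - p) * z ^ 2 := by
      refine le_of_mul_le_mul_right (h4.trans ?_) h3
      have : 0 ≤ -p * (1 - p) * (1 - p) * z ^ 3 :=
        mul_nonneg (mul_nonneg (mul_nonneg (by linarith) (by linarith)) (by linarith))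
          (pow_nonneg hz 3)
      nlinarith
    linarith

/-- For `p < 1` the equation `z'' + b z' = m ((1 + z) - (1 + z)^p)` has a positive increasing
solution on the whole line emanating from `0` at `-∞`. -/
lemma exists_emdenFowler_connection {b m p : ℝ} (hm : 0 < m) (hp : p < 1) :
    ∃ Z Y : ℝ → ℝ, (∀ t, HasDerivAt Z (Y t) t) ∧
      (∀ t, HasDerivAt Y (m * ((1 + Z t) - (1 + Z t) ^ p) - b * Y t) t) ∧ (∀ t, 0 < Y t) ∧
      (∀ t, 0 < Z t) ∧ Tendsto Z atBot (𝓝 0) := by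
  have hp' : 0 < 1 - p := by linarith
  have hκ : 0 < m * (1 - p) := by positivity
  have hsq := Real.sq_sqrt (show 0 ≤ b ^ 2 + 4 * (m * (1 - p)) by positivity)
  have hsqrt : b < √(b ^ 2 + 4 * (m * (1 - p))) := Real.lt_sqrt_of_sq_lt (by linarith)
  have habs : 0 ≤ |p| * (1 - p) := by positivity
  refine exists_pos_strictMono_solution (b := b) (G := fun z => m * ((1 + z) - (1 + z) ^ p))
    (l := (√(b ^ 2 + 4 * (m * (1 - p))) - b) / 2) (κ := m * (1 - p))
    (K := m * ((3 - p) + |p| * (1 - p)))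
    ?_ ?_ ?_ ?_ (by linarith) hκ (mul_pos hm (by linarith)) ?_ ?_ ?_ ?_
  · exact fun x hx y hy h =>
      mul_le_mul_of_nonneg_left (monotoneOn_one_add_sub_rpow hp.le hx hy h) hm.le
  · refine ContinuousOn.mul continuousOn_const (ContinuousOn.sub (by fun_prop) ?_)
    refine ContinuousOn.rpow_const (by fun_prop) fun z hz => Or.inl ?_
    simp only [mem_Ici] at hz
    positivity
  · simp
  · exact fun z hz => mul_pos hm (one_add_sub_rpow_pos hp hz)
  · linear_combination hsq / 4
  · intro z hz
    have h := mul_le_mul_of_nonneg_left (le_one_add_sub_rpow hp hz) hm.le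
    have : 0 ≤ m * (3 - p) * z ^ 2 := mul_nonneg (mul_nonneg hm.le (by linarith)) (sq_nonneg z)
    linarith
  · intro z hz
    have h := mul_le_mul_of_nonneg_left (one_add_sub_rpow_le hp hz) hm.le
    have : 0 ≤ m * (|p| * (1 - p)) * z := by positivity
    linarith
  · intro z hz
    have h := mul_le_mul_of_nonneg_left (one_add_sub_rpow_le_sq hp hz) hm.le
    have : 0 ≤ m * (2 + |p| * (1 - p)) * z ^ 2 := by positivity
    linarith

/-- The Emden–Fowler change of variables `u(x) = c x^a (1 + z(log x + τ))`. -/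
lemma isPosSol_of_emdenFowler {p σ a c : ℝ} {Z Y : ℝ → ℝ} (hc : 0 < c)
    (ha : a * (1 - p) = 2 + σ) (hcp : c ^ p = c * (a * (1 - a)))
    (hZ : ∀ t, HasDerivAt Z (Y t) t)
    (hY : ∀ t, HasDerivAt Y
      (a * (1 - a) * ((1 + Z t) - (1 + Z t) ^ p) - (2 * a - 1) * Y t) t)
    (hZ0 : ∀ t, 0 < Z t) (τ : ℝ) :
    IsPosSol p σ fun x => c * x ^ a * (1 + Z (Real.log x + τ)) := by
  have hlog : ∀ x : ℝ, 0 < x → HasDerivAt (fun x => Real.log x + τ) x⁻¹ x := fun x hx =>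
    (Real.hasDerivAt_log hx.ne').add_const τ
  have hpow : ∀ q x : ℝ, 0 < x → HasDerivAt (fun x : ℝ => x ^ q) (q * x ^ (q - 1)) x :=
    fun q x hx => Real.hasDerivAt_rpow_const (Or.inl hx.ne')
  have hpow_succ : ∀ q x : ℝ, 0 < x → x ^ q * x⁻¹ = x ^ (q - 1) := fun q x hx => by
    rw [Real.rpow_sub_one hx.ne', div_eq_mul_inv]
  have hu : ∀ x : ℝ, 0 < x → HasDerivAt (fun x => c * x ^ a * (1 + Z (Real.log x + τ)))
      (c * x ^ (a - 1) * (a * (1 + Z (Real.log x + τ)) + Y (Real.log x + τ))) x := by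
    intro x hx
    refine (((hpow a x hx).const_mul c).mul
      (((hZ _).comp x (hlog x hx)).const_add 1)).congr_deriv ?_
    rw [← hpow_succ a x hx]
    simp only [Function.comp]
    ring
  have hu' : ∀ x : ℝ, 0 < x → HasDerivAt
      (fun x => c * x ^ (a - 1) * (a * (1 + Z (Real.log x + τ)) + Y (Real.log x + τ)))
      (-(c * (a * (1 - a)) * x ^ (a - 2) * (1 + Z (Real.log x + τ)) ^ p)) x := by
    intro x hx
    refine (((hpow (a - 1) x hx).const_mul c).mul
      (((((hZ _).comp x (hlog x hx)).const_add 1).const_mul a).fun_add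
        ((hY _).comp x (hlog x hx)))).congr_deriv ?_
    have h2 : x ^ (a - 1) * x⁻¹ = x ^ (a - 2) := by rw [hpow_succ _ x hx]; ring_nf
    rw [show a - 1 - 1 = a - 2 by ring, ← h2]
    simp only [Function.comp]
    ring
  have hderiv : ∀ x : ℝ, 0 < x → deriv (fun x => c * x ^ a * (1 + Z (Real.log x + τ))) x =
      c * x ^ (a - 1) * (a * (1 + Z (Real.log x + τ)) + Y (Real.log x + τ)) :=
    fun x hx => (hu x hx).deriv
  have hZc : Continuous Z := continuous_iff_continuousAt.2 fun t => (hZ t).continuousAt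
  have hYc : Continuous Y := continuous_iff_continuousAt.2 fun t => (hY t).continuousAt
  have hcontDiff : ContDiff ℝ 2 Z := by
    have hZ' : deriv Z = Y := funext fun t => (hZ t).deriv
    have hY' : deriv Y = fun t =>
        a * (1 - a) * ((1 + Z t) - (1 + Z t) ^ p) - (2 * a - 1) * Y t :=
      funext fun t => (hY t).deriv
    have hZp : Continuous fun t => (1 + Z t) ^ p :=
      (by fun_prop : Continuous fun t => 1 + Z t).rpow_const fun t => Or.inl (by linarith [hZ0 t])
    rw [show (2 : WithTop ℕ∞) = 1 + 1 from one_add_one_eq_two.symm, contDiff_succ_iff_deriv, hZ',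
      contDiff_one_iff_deriv, hY']
    exact ⟨fun t => (hZ t).differentiableAt, by simp, fun t => (hY t).differentiableAt,
      by fun_prop⟩
  refine ⟨fun x hx => ?_, ?_, fun x hx => ?_⟩
  · have := hZ0 (Real.log x + τ)
    exact mul_pos (mul_pos hc (Real.rpow_pos_of_pos hx _)) (by linarith)
  · have hlogC : ContDiffOn ℝ 2 (fun x => Real.log x + τ) (Ioi 0) :=
      (contDiffOn_id.log fun x hx => (ne_of_gt hx)).add contDiffOn_const
    have hpowC : ContDiffOn ℝ 2 (fun x : ℝ => x ^ a) (Ioi 0) :=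
      contDiffOn_id.rpow_const_of_ne fun x hx => (ne_of_gt hx)
    exact (contDiffOn_const.mul hpowC).mul
      (contDiffOn_const.add (hcontDiff.comp_contDiffOn hlogC))
  · rw [mem_Ioi] at hx
    have heq : deriv (fun x => c * x ^ a * (1 + Z (Real.log x + τ))) =ᶠ[𝓝 x]
        fun x => c * x ^ (a - 1) * (a * (1 + Z (Real.log x + τ)) + Y (Real.log x + τ)) :=
      (eventually_gt_nhds hx).mono hderiv
    have h1Z : 0 ≤ 1 + Z (Real.log x + τ) := by linarith [hZ0 (Real.log x + τ)]
    rw [heq.deriv_eq, (hu' x hx).deriv, neg_neg, Real.mul_rpow (by positivity) h1Z,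
      Real.mul_rpow hc.le (by positivity), hcp, ← Real.rpow_mul hx.le,
      show a - 2 = σ + a * p by linarith, Real.rpow_add hx]
    ring

/-- **Theorem 5.1.** For `σ > -2` and `p < -1-σ`, there is a one-parameter family
`{u^α}_{α>0}` of positive solutions of `-u'' = x^σ u^p` on `(0,+∞)` with
`u^α/u_a → 1` at `0⁺` which is strictly ordered above `u_a`; in particular uniqueness fails. -/
theorem one_parameter_family_above_explicit (p σ : ℝ) (hσ : -2 < σ) (hp : p < -1 - σ) :
    ∃ U : ℝ → ℝ → ℝ,
      (∀ α : ℝ, 0 < α →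
        IsPosSol p σ (U α) ∧
        Tendsto (fun x => U α x / uExplicit p σ x) (nhdsWithin 0 (Set.Ioi 0)) (nhds 1)) ∧
      (∀ α₁ α₂ : ℝ, 0 < α₂ → α₂ < α₁ → ∀ x ∈ Set.Ioi (0 : ℝ),
        uExplicit p σ x < U α₂ x ∧ U α₂ x < U α₁ x) := by
  have hp1 : 0 < 1 - p := by linarith
  set a := (2 + σ) / (1 - p) with ha_def
  have ha : a * (1 - p) = 2 + σ := div_mul_cancel₀ _ hp1.ne'
  have ha0 : 0 < a := div_pos (by linarith) hp1
  have ha1 : a < 1 := (div_lt_one hp1).2 (by linarith)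
  have hm : 0 < a * (1 - a) := mul_pos ha0 (by linarith)
  set c := (a * (1 - a)) ^ (1 / (p - 1)) with hc_def
  have hc : 0 < c := Real.rpow_pos_of_pos hm _
  have hcp : c ^ p = c * (a * (1 - a)) := by
    have h : c ^ (p - 1) = a * (1 - a) := by
      rw [hc_def, ← Real.rpow_mul hm.le, one_div_mul_cancel (by linarith), Real.rpow_one]
    rw [← h, Real.rpow_sub_one hc.ne', mul_div_cancel₀ _ hc.ne']
  have hexplicit : uExplicit p σ = fun x => c * x ^ a := rfl
  have hexplicit_pos : ∀ x : ℝ, 0 < x → 0 < c * x ^ a := fun x hx =>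
    mul_pos hc (Real.rpow_pos_of_pos hx _)
  obtain ⟨Z, Y, hZ, hY, hY0, hZ0, hZlim⟩ :=
    exists_emdenFowler_connection (b := 2 * a - 1) hm (show p < 1 by linarith)
  have hZmono : StrictMono Z := strictMono_of_hasDerivAt_pos hZ hY0
  refine ⟨fun α x => c * x ^ a * (1 + Z (Real.log x + Real.log α)), fun α _ =>
    ⟨isPosSol_of_emdenFowler hc ha hcp hZ hY hZ0 _, ?_⟩, fun α₁ α₂ hα₂ hα x hx => ⟨?_, ?_⟩⟩
  · have hlim : Tendsto (fun x => 1 + Z (Real.log x + Real.log α)) (𝓝[>] 0) (𝓝 1) := by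
      simpa using (hZlim.comp (tendsto_atBot_add_const_right _ (Real.log α)
        Real.tendsto_log_nhdsGT_zero)).const_add 1
    refine hlim.congr' (eventually_mem_nhdsWithin.mono fun x hx => ?_)
    change _ = c * x ^ a * (1 + Z (Real.log x + Real.log α)) / (c * x ^ a)
    rw [mul_div_cancel_left₀ _ (hexplicit_pos x hx).ne']
  · rw [hexplicit]
    exact lt_mul_of_one_lt_right (hexplicit_pos x hx) (by linarith [hZ0 (Real.log x + Real.log α₂)])
  · refine mul_lt_mul_of_pos_left ?_ (hexplicit_pos x hx)
    linarith [hZmono (add_lt_add_right (Real.log_lt_log hα₂ hα) (Real.log x))]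
end

section
/- Assume σ < -2 and p > -1-σ, and set a = (2+σ)/(1-p) ∈ (0,1). Then: (1) if a > 1/2, there is a positive C² solution u of -u''(x) = x^σ u(x)^p on (0,+∞) with lim_{x→0⁺} u(x)/u_a(x) = 0 and lim_{x→+∞} u(x)/u_a(x) = 1; (2) if a = 1/2, there is a positive solution u with lim_{x→0⁺} u(x)/u_a(x) = 0 and lim_{x→+∞} u(x)/u_a(x) = 0; (3) if a < 1/2, there is a positive solution u with lim_{x→0⁺} u(x)/u_a(x) = 1 and lim_{x→+∞} u(x)/u_a(x) = 0. Moreover, in each case the solution is unique up to the scaling transformation u ↦ u_λ with u_λ(x) = λ^{-a} u(λx), λ > 0. -/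
open Set Filter

/-- `u/u_a` tends to `L0` at `0⁺` and to `Linf` at `+∞`. -/
def HasRatioLimits (p σ : ℝ) (u : ℝ → ℝ) (L0 Linf : ℝ) : Prop :=
  Tendsto (fun x => u x / uExplicit p σ x) (nhdsWithin 0 (Set.Ioi 0)) (nhds L0) ∧
  Tendsto (fun x => u x / uExplicit p σ x) atTop (nhds Linf)

/-- The inner primitive of the Volterra operator. -/
noncomputable def volterraPrim (β : ℝ) (φ g : ℝ → ℝ) (y : ℝ) : ℝ :=
  ∫ s in (0 : ℝ)..y, s ^ (β - 1) * φ (g s)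

/-- The averaged Volterra operator; its fixed points `g` yield solutions `u = x g` of
`u'' = - x ^ (β - 1) φ (u / x)` with `u 0 = 0` and `u' 0 = 1`. -/
noncomputable def volterraOp (β : ℝ) (φ g : ℝ → ℝ) (x : ℝ) : ℝ :=
  if 0 < x then (∫ y in (0 : ℝ)..x, (1 - volterraPrim β φ g y)) / x else 1

section Volterra

variable {β K : ℝ} {φ : ℝ → ℝ}

lemma volterra_intervalIntegrable (hβ : 0 < β) (hφc : Continuous φ) (h0 : ∀ z, 0 ≤ φ z)
    (h1 : ∀ z, φ z ≤ 1) {g : ℝ → ℝ} (hg : Measurable g) (b c : ℝ) :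
    IntervalIntegrable (fun s : ℝ => s ^ (β - 1) * φ (g s)) MeasureTheory.volume b c := by
  refine (intervalIntegral.intervalIntegrable_rpow' (r := β - 1) (by linarith)).mono_fun ?_ ?_
  · exact (Measurable.mul (by fun_prop) (hφc.measurable.comp hg)).aestronglyMeasurable
  · refine Eventually.of_forall fun s => ?_
    simp only [norm_mul, Real.norm_eq_abs]
    rw [abs_of_nonneg (h0 (g s))]
    exact mul_le_of_le_one_right (abs_nonneg _) (h1 _)

lemma volterraPrim_continuous (hβ : 0 < β) (hφc : Continuous φ) (h0 : ∀ z, 0 ≤ φ z)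
    (h1 : ∀ z, φ z ≤ 1) {g : ℝ → ℝ} (hg : Measurable g) : Continuous (volterraPrim β φ g) :=
  intervalIntegral.continuous_primitive (volterra_intervalIntegrable hβ hφc h0 h1 hg) 0

lemma volterraOp_measurable (hβ : 0 < β) (hφc : Continuous φ) (h0 : ∀ z, 0 ≤ φ z)
    (h1 : ∀ z, φ z ≤ 1) {g : ℝ → ℝ} (hg : Measurable g) : Measurable (volterraOp β φ g) := by
  have hc : Continuous fun y => 1 - volterraPrim β φ g y :=
    continuous_const.sub (volterraPrim_continuous hβ hφc h0 h1 hg)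
  refine Measurable.ite measurableSet_Ioi ?_ measurable_const
  exact (intervalIntegral.continuous_primitive (fun b c => hc.intervalIntegrable b c) 0).measurable.div
    measurable_id

lemma integral_rpow_zero {r : ℝ} (hr : -1 < r) (y : ℝ) :
    ∫ s in (0 : ℝ)..y, s ^ r = y ^ (r + 1) / (r + 1) := by
  rw [integral_rpow (Or.inl hr), Real.zero_rpow (by linarith), sub_zero]

lemma volterraPrim_nonneg (h0 : ∀ z, 0 ≤ φ z) {g : ℝ → ℝ} {y : ℝ} (hy : 0 ≤ y) :
    0 ≤ volterraPrim β φ g y :=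
  intervalIntegral.integral_nonneg hy fun _ hs => mul_nonneg (Real.rpow_nonneg hs.1 _) (h0 _)

/-- A bound `|φ ∘ g₁ - φ ∘ g₂| ≤ C x ^ r` improves to a bound of order `x ^ (r + β)`. -/
lemma volterraPrim_sub_le (hβ : 0 < β) (hφc : Continuous φ) (h0 : ∀ z, 0 ≤ φ z)
    (h1 : ∀ z, φ z ≤ 1) {g₁ g₂ : ℝ → ℝ} (hg₁ : Measurable g₁) (hg₂ : Measurable g₂)
    {C r : ℝ} (hr : 0 ≤ r) (h : ∀ x > 0, |φ (g₁ x) - φ (g₂ x)| ≤ C * x ^ r) {y : ℝ} (hy : 0 < y) :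
    |volterraPrim β φ g₁ y - volterraPrim β φ g₂ y| ≤ C * (y ^ (r + β) / (r + β)) := by
  unfold volterraPrim
  rw [← intervalIntegral.integral_sub (volterra_intervalIntegrable hβ hφc h0 h1 hg₁ _ _)
    (volterra_intervalIntegrable hβ hφc h0 h1 hg₂ _ _)]
  have hi : ∫ s in (0 : ℝ)..y, C * s ^ (r + β - 1) = C * (y ^ (r + β) / (r + β)) := by
    rw [intervalIntegral.integral_const_mul, integral_rpow_zero (by linarith), sub_add_cancel]
  rw [← hi, ← Real.norm_eq_abs]
  refine intervalIntegral.norm_integral_le_of_norm_le hy.le ?_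
    ((intervalIntegral.intervalIntegrable_rpow' (by linarith)).const_mul C)
  refine Eventually.of_forall fun s hs => ?_
  have hs0 : 0 < s := hs.1
  rw [← mul_sub, Real.norm_eq_abs, abs_mul, abs_of_nonneg (Real.rpow_nonneg hs0.le _),
    show r + β - 1 = (β - 1) + r by ring, Real.rpow_add hs0]
  have := mul_le_mul_of_nonneg_left (h s hs0) (Real.rpow_nonneg hs0.le (β - 1))
  linarith

lemma abs_average_sub_le {f₁ f₂ : ℝ → ℝ} (h₁ : Continuous f₁) (h₂ : Continuous f₂) {B x : ℝ}
    (hx : 0 < x) (h : ∀ y, 0 < y → y ≤ x → |f₁ y - f₂ y| ≤ B) :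
    |(∫ y in (0 : ℝ)..x, f₁ y) / x - (∫ y in (0 : ℝ)..x, f₂ y) / x| ≤ B := by
  rw [← sub_div, ← intervalIntegral.integral_sub (h₁.intervalIntegrable _ _)
    (h₂.intervalIntegrable _ _), abs_div, abs_of_pos hx, div_le_iff₀ hx]
  have := intervalIntegral.norm_integral_le_of_norm_le_const (a := 0) (b := x) (C := B)
    (f := fun y => f₁ y - f₂ y) (fun y hy => by
      rw [uIoc_of_le hx.le] at hy
      exact h y hy.1 hy.2)
  rwa [sub_zero, abs_of_pos hx] at this

lemma volterraOp_sub_le (hβ : 0 < β) (hφc : Continuous φ) (h0 : ∀ z, 0 ≤ φ z)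
    (h1 : ∀ z, φ z ≤ 1) {g₁ g₂ : ℝ → ℝ} (hg₁ : Measurable g₁) (hg₂ : Measurable g₂)
    {C r : ℝ} (hC : 0 ≤ C) (hr : 0 ≤ r) (h : ∀ x > 0, |φ (g₁ x) - φ (g₂ x)| ≤ C * x ^ r)
    {x : ℝ} (hx : 0 < x) :
    |volterraOp β φ g₁ x - volterraOp β φ g₂ x| ≤ C * (x ^ (r + β) / (r + β)) := by
  unfold volterraOp
  rw [if_pos hx, if_pos hx]
  refine abs_average_sub_le (continuous_const.sub (volterraPrim_continuous hβ hφc h0 h1 hg₁))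
    (continuous_const.sub (volterraPrim_continuous hβ hφc h0 h1 hg₂)) hx fun y hy hyx => ?_
  simp only [Pi.sub_apply]
  rw [sub_sub_sub_cancel_left, abs_sub_comm]
  refine (volterraPrim_sub_le hβ hφc h0 h1 hg₁ hg₂ hr h hy).trans ?_
  gcongr

/-- Fixed point of the Volterra operator, obtained by Picard iteration. -/
lemma exists_volterraOp_fixed (hβ : 0 < β) (hφc : Continuous φ) (h0 : ∀ z, 0 ≤ φ z)
    (h1 : ∀ z, φ z ≤ 1) (hK : 1 ≤ K) (hL : ∀ y z, |φ y - φ z| ≤ K * |y - z|) :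
    ∃ g : ℝ → ℝ, Measurable g ∧ ∀ x, g x = volterraOp β φ g x := by
  let G : ℕ → ℝ → ℝ := fun n => (volterraOp β φ)^[n] fun _ => 1
  have hGs : ∀ n, G (n + 1) = volterraOp β φ (G n) := fun n =>
    Function.iterate_succ_apply' _ _ _
  have hGm : ∀ n, Measurable (G n) := by
    intro n
    induction n with
    | zero => exact measurable_const
    | succ n ih => rw [hGs]; exact volterraOp_measurable hβ hφc h0 h1 ih
  have hKβ : 0 ≤ K / β := by positivity
  have hbound : ∀ n : ℕ, ∀ x > 0, |G (n + 1) x - G n x| ≤ (K / β * x ^ β) ^ (n + 1) / (n + 1).factorial := by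
    intro n
    induction n with
    | zero =>
      intro x hx
      have hT0 : volterraOp β (fun _ => 0) (G 0) x = 1 := by
        unfold volterraOp volterraPrim
        rw [if_pos hx]
        simp [hx.ne']
      have hc : |G 1 x - 1| ≤ x ^ β / β := by
        rw [hGs 0, ← hT0]
        unfold volterraOp
        rw [if_pos hx, if_pos hx]
        refine abs_average_sub_le
          (continuous_const.sub (volterraPrim_continuous hβ hφc h0 h1 (hGm 0)))
          (continuous_const.sub (volterraPrim_continuous hβ continuous_const (fun _ => le_rfl)
            (fun _ => zero_le_one) (hGm 0))) hx fun y hy hyx => ?_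
        have hz : volterraPrim β (fun _ => 0) (G 0) y = 0 := by simp [volterraPrim]
        simp only [Pi.sub_apply]
        rw [sub_sub_sub_cancel_left, hz, zero_sub, abs_neg]
        unfold volterraPrim
        have hi : ∫ s in (0 : ℝ)..y, s ^ (β - 1) = y ^ β / β := by
          rw [integral_rpow_zero (by linarith), sub_add_cancel]
        refine (?_ : _ ≤ y ^ β / β).trans (by gcongr)
        rw [← hi, ← Real.norm_eq_abs]
        refine intervalIntegral.norm_integral_le_of_norm_le hy.le ?_
          (intervalIntegral.intervalIntegrable_rpow' (by linarith))
        refine Eventually.of_forall fun s hs => ?_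
        have hs0 := Real.rpow_nonneg hs.1.le (β - 1)
        rw [Real.norm_eq_abs, abs_of_nonneg (mul_nonneg hs0 (h0 _))]
        exact mul_le_of_le_one_right hs0 (h1 _)
      have hx' := Real.rpow_nonneg hx.le β
      calc |G 1 x - G 0 x| ≤ x ^ β / β := hc
        _ ≤ K * (x ^ β / β) := le_mul_of_one_le_left (by positivity) hK
        _ = _ := by simp; ring
    | succ n ih =>
      intro x hx
      rw [hGs (n + 1), hGs n]
      have hpow : ∀ y : ℝ, 0 < y → (K / β * y ^ β) ^ (n + 1) =
          (K / β) ^ (n + 1) * y ^ (β * (n + 1 : ℕ)) := fun y hy => by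
        rw [mul_pow, Real.rpow_mul hy.le, Real.rpow_natCast]
      have key := volterraOp_sub_le (C := K * ((K / β) ^ (n + 1) / (n + 1).factorial))
        (r := β * (n + 1 : ℕ)) hβ hφc h0 h1
        (volterraOp_measurable hβ hφc h0 h1 (hGm n)) (hGm n) (by positivity) (by positivity)
        (fun y hy => by
          have := ih y hy
          rw [hGs n, hpow y hy] at this
          calc _ ≤ K * |volterraOp β φ (G n) y - G n y| := hL _ _
            _ ≤ K * ((K / β) ^ (n + 1) * y ^ (β * (n + 1 : ℕ)) / (n + 1).factorial) := by gcongr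
            _ = _ := by ring) hx
      refine key.trans (le_of_eq ?_)
      have e : β * (n + 1 : ℕ) + β = β * (n + 1 + 1 : ℕ) := by push_cast; ring
      rw [e, mul_pow, ← Real.rpow_natCast (x ^ β), ← Real.rpow_mul hx.le, Nat.factorial_succ (n + 1)]
      push_cast
      have : (n : ℝ) + 1 + 1 ≠ 0 := by positivity
      rw [pow_succ (K / β) (n + 1)]
      field_simp
  have hcauchy : ∀ x, ∃ l, Tendsto (fun n => G n x) atTop (nhds l) := by
    intro x
    by_cases hx : 0 < x
    · refine cauchySeq_tendsto_of_complete (cauchySeq_of_summable_dist ?_)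
      refine Summable.of_nonneg_of_le (fun _ => dist_nonneg) (fun n => ?_)
        ((summable_nat_add_iff 1).2 (Real.summable_pow_div_factorial (K / β * x ^ β)))
      rw [dist_comm, Real.dist_eq]
      exact hbound n x hx
    · refine ⟨1, tendsto_const_nhds.congr' (Eventually.of_forall fun n => ?_)⟩
      cases n with
      | zero => rfl
      | succ n => simp [hGs, volterraOp, hx]
  choose g hg using hcauchy
  have hgm : Measurable g := measurable_of_tendsto_metrizable hGm (tendsto_pi_nhds.2 hg)
  refine ⟨g, hgm, fun x => ?_⟩
  have hprim : ∀ y : ℝ, 0 < y →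
      Tendsto (fun n => volterraPrim β φ (G n) y) atTop (nhds (volterraPrim β φ g y)) := by
    intro y hy
    refine intervalIntegral.tendsto_integral_filter_of_dominated_convergence
      (fun s => s ^ (β - 1)) ?_ ?_ (intervalIntegral.intervalIntegrable_rpow' (by linarith)) ?_
    · refine Eventually.of_forall fun n => Measurable.aestronglyMeasurable ?_
      exact Measurable.mul (by fun_prop) (hφc.measurable.comp (hGm n))
    · refine Eventually.of_forall fun n => Eventually.of_forall fun s hs => ?_
      rw [uIoc_of_le hy.le] at hs
      have hs0 := Real.rpow_nonneg hs.1.le (β - 1)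
      rw [Real.norm_eq_abs, abs_of_nonneg (mul_nonneg hs0 (h0 _))]
      exact mul_le_of_le_one_right hs0 (h1 _)
    · exact Eventually.of_forall fun s _ =>
        ((hφc.tendsto (g s)).comp (hg s)).const_mul _
  by_cases hx : 0 < x
  · refine tendsto_nhds_unique ((tendsto_add_atTop_iff_nat 1).2 (hg x)) ?_
    simp only [hGs, volterraOp, if_pos hx]
    refine Tendsto.div_const ?_ x
    refine intervalIntegral.tendsto_integral_filter_of_dominated_convergence
      (fun _ => 1 + x ^ β / β) ?_ ?_ intervalIntegrable_const ?_
    · exact Eventually.of_forall fun n => (continuous_const.sub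
        (volterraPrim_continuous hβ hφc h0 h1 (hGm n))).measurable.aestronglyMeasurable
    · refine Eventually.of_forall fun n => Eventually.of_forall fun y hy => ?_
      rw [uIoc_of_le hx.le] at hy
      have hpos : 0 ≤ volterraPrim β φ (G n) y := volterraPrim_nonneg h0 hy.1.le
      have hle : volterraPrim β φ (G n) y ≤ x ^ β / β := by
        have hi : ∫ s in (0 : ℝ)..y, s ^ (β - 1) = y ^ β / β := by
          rw [integral_rpow_zero (by linarith), sub_add_cancel]
        have hy0 := hy.1
        have hy1 := hy.2
        refine (?_ : _ ≤ y ^ β / β).trans (by gcongr)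
        rw [← hi]
        refine intervalIntegral.integral_mono_on hy.1.le
          (volterra_intervalIntegrable hβ hφc h0 h1 (hGm n) _ _)
          (intervalIntegral.intervalIntegrable_rpow' (by linarith)) fun s hs => ?_
        exact mul_le_of_le_one_right (Real.rpow_nonneg hs.1 _) (h1 _)
      rw [Real.norm_eq_abs, abs_le]
      constructor <;> linarith
    · refine Eventually.of_forall fun y hy => ?_
      rw [uIoc_of_le hx.le] at hy
      exact (hprim y hy.1).const_sub 1
  · refine tendsto_nhds_unique ((tendsto_add_atTop_iff_nat 1).2 (hg x)) ?_
    simp [hGs, volterraOp, hx]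

/-- Regular solution of `u'' = - x ^ (β - 1) φ (u / x)` with `u 0 = 0` and `u' 0 = 1`. -/
lemma exists_regular_solution (hβ : 0 < β) (hφc : Continuous φ) (h0 : ∀ z, 0 ≤ φ z)
    (h1 : ∀ z, φ z ≤ 1) (hK : 1 ≤ K) (hL : ∀ y z, |φ y - φ z| ≤ K * |y - z|) :
    ∃ u d : ℝ → ℝ, (∀ x > 0, HasDerivAt u (d x) x) ∧
      (∀ x > 0, HasDerivAt d (-(x ^ (β - 1) * φ (u x / x))) x) ∧
      Tendsto d (nhdsWithin 0 (Ioi 0)) (nhds 1) ∧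
      Tendsto (fun x => u x / x) (nhdsWithin 0 (Ioi 0)) (nhds 1) ∧ ∀ x > 0, u x / x ≤ 1 := by
  obtain ⟨g, hgm, hfix⟩ := exists_volterraOp_fixed hβ hφc h0 h1 hK hL
  have hAc := volterraPrim_continuous hβ hφc h0 h1 hgm
  have hdc : Continuous fun y => 1 - volterraPrim β φ g y := continuous_const.sub hAc
  let u : ℝ → ℝ := fun x => ∫ y in (0 : ℝ)..x, (1 - volterraPrim β φ g y)
  have hu : ∀ x, HasDerivAt u (1 - volterraPrim β φ g x) x := fun x =>
    hdc.integral_hasStrictDerivAt 0 x |>.hasDerivAt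
  have hug : ∀ x > 0, g x = u x / x := fun x hx => by
    rw [hfix x]; simp only [volterraOp, if_pos hx, u]
  have hA0 : volterraPrim β φ g 0 = 0 := by simp [volterraPrim]
  refine ⟨u, fun y => 1 - volterraPrim β φ g y, fun x _ => hu x, fun x hx => ?_, ?_, ?_, ?_⟩
  · refine HasDerivAt.const_sub 1 ?_
    rw [← hug x hx]
    refine intervalIntegral.integral_hasDerivAt_right
      (volterra_intervalIntegrable hβ hφc h0 h1 hgm _ _) ?_ ?_
    · exact (Measurable.mul (by fun_prop) (hφc.measurable.comp hgm)).stronglyMeasurable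
        |>.stronglyMeasurableAtFilter
    · have hgc : ContinuousAt g x := by
        have : ContinuousAt (fun x => u x / x) x :=
          (hu x).continuousAt.div continuousAt_id hx.ne'
        refine this.congr ?_
        filter_upwards [lt_mem_nhds hx] with y hy using (hug y hy).symm
      exact (Real.continuousAt_rpow_const _ _ (Or.inl hx.ne')).mul
        (hφc.continuousAt.comp hgc)
  · have := hdc.tendsto 0
    simp only [hA0, sub_zero] at this
    exact this.mono_left nhdsWithin_le_nhds
  · have := (hu 0).tendsto_slope_zero_right
    simp only [hA0, sub_zero, zero_add] at this
    refine this.congr fun x => ?_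
    simp [u, div_eq_inv_mul]
  · intro x hx
    rw [div_le_one hx]
    have : u x ≤ ∫ y in (0 : ℝ)..x, (1 : ℝ) :=
      intervalIntegral.integral_mono_on hx.le (hdc.intervalIntegrable _ _)
        intervalIntegrable_const fun y hy => by
          have := volterraPrim_nonneg (β := β) h0 (g := g) hy.1
          linarith
    simpa using this

end Volterra

lemma hasDerivAt_max_zero_rpow {q : ℝ} (hq : 1 < q) (x : ℝ) :
    HasDerivAt (fun x : ℝ => max x 0 ^ q) (q * max x 0 ^ (q - 1)) x := by
  rcases lt_trichotomy x 0 with hx | rfl | hx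
  · rw [max_eq_right hx.le, Real.zero_rpow (by linarith), mul_zero]
    refine (hasDerivAt_const x (0 : ℝ)).congr_of_eventuallyEq ?_
    filter_upwards [gt_mem_nhds hx] with y hy
    rw [max_eq_right hy.le, Real.zero_rpow (by linarith)]
  · rw [max_self, Real.zero_rpow (by linarith), mul_zero]
    have h := hasDerivAt_abs_rpow 0 hq
    rw [mul_zero, hasDerivAt_iff_isLittleO] at h
    rw [hasDerivAt_iff_isLittleO]
    refine Asymptotics.IsBigO.trans_isLittleO (Asymptotics.IsBigO.of_bound 1 ?_) h
    refine Eventually.of_forall fun y => ?_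
    have h0 : (0 : ℝ) ^ q = 0 := Real.zero_rpow (by linarith)
    simp only [max_self, abs_zero, h0, sub_zero, smul_zero, one_mul, Real.norm_eq_abs]
    rw [abs_of_nonneg (by positivity), abs_of_nonneg (by positivity)]
    exact Real.rpow_le_rpow (le_max_right _ _) (max_le (le_abs_self y) (abs_nonneg y)) (by linarith)
  · rw [max_eq_left hx.le]
    refine (Real.hasDerivAt_rpow_const (Or.inl hx.ne')).congr_of_eventuallyEq ?_
    filter_upwards [lt_mem_nhds hx] with y hy
    rw [max_eq_left hy.le]

/-- Barbalat type lemma: a nonnegative function with bounded derivative which is dissipated by a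
function bounded below tends to zero. -/
lemma tendsto_zero_of_dissipation {L L' F F' : ℝ → ℝ} {κ B m : ℝ} (hκ : 0 < κ)
    (hL : ∀ t, HasDerivAt L (L' t) t) (hF : ∀ t, HasDerivAt F (F' t) t)
    (hLF : ∀ t ≥ 0, L' t ≤ -(κ * F t)) (hF0 : ∀ t, 0 ≤ F t) (hFB : ∀ t ≥ 0, |F' t| ≤ B)
    (hm : ∀ t ≥ 0, m ≤ L t) : Tendsto F atTop (nhds 0) := by
  have hB : 0 ≤ B := (abs_nonneg _).trans (hFB 0 le_rfl)
  have hanti : AntitoneOn L (Ici 0) := by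
    refine antitoneOn_of_deriv_nonpos (convex_Ici 0) (fun t _ => (hL t).continuousAt.continuousWithinAt)
      (fun t _ => (hL t).differentiableAt.differentiableWithinAt) fun t ht => ?_
    rw [interior_Ici] at ht
    rw [(hL t).deriv]
    have := hLF t (le_of_lt ht)
    have := mul_nonneg hκ.le (hF0 t)
    linarith
  obtain ⟨l, hl⟩ : ∃ l, Tendsto L atTop (nhds l) := by
    have ha : Antitone fun t => L (max t 0) := fun s t hst =>
      hanti (mem_Ici.2 (le_max_right s 0)) (mem_Ici.2 (le_max_right t 0)) (max_le_max_right 0 hst)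
    have hb : BddBelow (range fun t => L (max t 0)) := by
      refine ⟨m, ?_⟩
      rintro _ ⟨t, rfl⟩
      exact hm _ (le_max_right _ _)
    refine ⟨_, (tendsto_atTop_ciInf ha hb).congr' ?_⟩
    filter_upwards [eventually_ge_atTop (0 : ℝ)] with t ht
    rw [max_eq_left ht]
  have key : ∀ d > 0, ∀ t ≥ 0, F t ≤ (L t - L (t + d)) / (κ * d) + B * d := by
    intro d hd t ht
    obtain ⟨ξ, hξ, hξe⟩ := exists_hasDerivAt_eq_slope L L' (show t < t + d by linarith)
      (fun s _ => (hL s).continuousAt.continuousWithinAt) (fun s _ => hL s)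
    have hξ0 : 0 ≤ ξ := ht.trans hξ.1.le
    have h1 : F t - F ξ ≤ B * d := by
      have := Convex.norm_image_sub_le_of_norm_hasDerivWithin_le (f := F) (f' := F') (s := Ici 0)
        (C := B) (fun s _ => (hF s).hasDerivWithinAt) (fun s hs => hFB s hs) (convex_Ici 0)
        (show t ∈ Ici 0 from ht) (show ξ ∈ Ici 0 from hξ0)
      rw [Real.norm_eq_abs, Real.norm_eq_abs, abs_of_pos (sub_pos.2 hξ.1)] at this
      have h2 := neg_abs_le (F ξ - F t)
      have h3 : B * (ξ - t) ≤ B * d := by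
        apply mul_le_mul_of_nonneg_left _ hB
        linarith [hξ.2]
      linarith
    have h2 := hLF ξ hξ0
    rw [hξe, add_sub_cancel_left, div_le_iff₀ hd] at h2
    have h3 : F ξ ≤ (L t - L (t + d)) / (κ * d) := by
      rw [le_div_iff₀ (by positivity)]
      nlinarith
    linarith
  rw [Metric.tendsto_atTop]
  intro ε hε
  obtain ⟨d, hd, hdB⟩ : ∃ d > 0, B * d < ε / 2 := by
    refine ⟨ε / (2 * (B + 1)), by positivity, ?_⟩
    rw [← mul_div_assoc, div_lt_div_iff₀ (by positivity) (by positivity)]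
    nlinarith
  have hlim : Tendsto (fun t => (L t - L (t + d)) / (κ * d)) atTop (nhds 0) := by
    have := (hl.sub (hl.comp (tendsto_atTop_add_const_right atTop d tendsto_id))).div_const (κ * d)
    simpa using this
  obtain ⟨N, hN⟩ := ((hlim.eventually (gt_mem_nhds (half_pos hε))).and
    (eventually_ge_atTop 0)).exists_forall_of_atTop
  refine ⟨N, fun t ht => ?_⟩
  have h1 := key d hd t (hN t ht).2
  have h2 := (hN t ht).1
  rw [Real.dist_eq, sub_zero, abs_of_nonneg (hF0 t)]
  linarith

section Dissipative

variable {p c k : ℝ} {w v : ℝ → ℝ}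

/-- The energy of the truncated damped equation. -/
noncomputable def efEnergy (p k : ℝ) (w v : ℝ → ℝ) (t : ℝ) : ℝ :=
  v t ^ 2 / 2 - k * w t ^ 2 / 2 + max (w t) 0 ^ (p + 1) / (p + 1)

lemma efEnergy_hasDerivAt (hp : 1 < p) (hw : ∀ t, HasDerivAt w (v t) t)
    (hv : ∀ t, HasDerivAt v (-(c * v t) + k * w t - max (w t) 0 ^ p) t) (t : ℝ) :
    HasDerivAt (efEnergy p k w v) (-(c * v t ^ 2)) t := by
  have h1 := ((hv t).pow 2).div_const 2
  have h2 := (((hw t).pow 2).const_mul k).div_const 2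
  have h3 := ((hasDerivAt_max_zero_rpow (q := p + 1) (by linarith) (w t)).comp t (hw t)).div_const
    (p + 1)
  refine ((h1.sub h2).add h3).congr_deriv ?_
  have : p + 1 ≠ 0 := by linarith
  rw [add_sub_cancel_right]
  field_simp
  push_cast
  ring

lemma efEnergy_neg (hp : 1 < p) (hc : 0 < c) (hw : ∀ t, HasDerivAt w (v t) t)
    (hv : ∀ t, HasDerivAt v (-(c * v t) + k * w t - max (w t) 0 ^ p) t)
    (hw0 : Tendsto w atBot (nhds 0)) (hv0 : Tendsto v atBot (nhds 0))
    (hpos : ∀ᶠ t in atBot, 0 < w t) (t : ℝ) : efEnergy p k w v t < 0 := by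
  have hE := efEnergy_hasDerivAt hp hw hv
  have hanti : Antitone (efEnergy p k w v) := antitone_of_hasDerivAt_nonpos hE fun t => by
    simp only [Pi.zero_apply, Left.neg_nonpos_iff]; positivity
  have hlim : Tendsto (efEnergy p k w v) atBot (nhds 0) := by
    have h1 := (hv0.pow 2).div_const 2
    have h2 := ((hw0.pow 2).const_mul k).div_const 2
    have h3 := (((hasDerivAt_max_zero_rpow (q := p + 1) (by linarith)
      0).continuousAt.tendsto).comp hw0).div_const (p + 1)
    have := (h1.sub h2).add h3
    simp only [max_self, Real.zero_rpow (show p + 1 ≠ 0 by linarith)] at this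
    have e : efEnergy p k w v = fun t => v t ^ 2 / 2 - k * w t ^ 2 / 2 +
      max (w t) 0 ^ (p + 1) / (p + 1) := rfl
    rw [e]
    simpa using this
  have hle : ∀ s, efEnergy p k w v s ≤ 0 := fun s => hanti.ge_of_tendsto hlim s
  refine lt_of_le_of_ne (hle t) fun h0 => ?_
  have hzero : ∀ s ≤ t, efEnergy p k w v s = 0 := fun s hs =>
    le_antisymm (hle s) (h0 ▸ hanti hs)
  have hv' : ∀ s < t, v s = 0 := fun s hs => by
    have h1 : HasDerivAt (efEnergy p k w v) 0 s := by
      refine (hasDerivAt_const s (0 : ℝ)).congr_of_eventuallyEq ?_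
      filter_upwards [gt_mem_nhds hs] with r hr using hzero r hr.le
    have h2 := (hE s).unique h1
    have h3 : v s ^ 2 = 0 := by
      rcases mul_eq_zero.1 (neg_eq_zero.1 h2) with h | h
      · exact absurd h hc.ne'
      · exact h
    exact pow_eq_zero_iff (two_ne_zero) |>.1 h3
  obtain ⟨s, hs, hst⟩ := (hpos.and (eventually_lt_atBot t)).exists
  have hconst : ∀ r ≤ s, w r = w s := fun r hr => by
    have := Convex.norm_image_sub_le_of_norm_hasDerivWithin_le (f := w) (f' := v) (s := Iic s)
        (C := 0) (fun r _ => (hw r).hasDerivWithinAt)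
        (fun r hr => by rw [hv' r (lt_of_le_of_lt hr hst), norm_zero]) (convex_Iic s)
        self_mem_Iic (show r ∈ Iic s from hr)
    rw [zero_mul] at this
    exact sub_eq_zero.1 (norm_le_zero_iff.1 this)
  have : Tendsto w atBot (nhds (w s)) := tendsto_const_nhds.congr' (by
    filter_upwards [eventually_le_atBot s] with r hr using (hconst r hr).symm)
  exact hs.ne' (tendsto_nhds_unique this hw0)

lemma pos_of_regular_at_bot (hp : 1 < p) (hc : 0 < c) (hw : ∀ t, HasDerivAt w (v t) t)
    (hv : ∀ t, HasDerivAt v (-(c * v t) + k * w t - max (w t) 0 ^ p) t)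
    (hw0 : Tendsto w atBot (nhds 0)) (hv0 : Tendsto v atBot (nhds 0))
    (hpos : ∀ᶠ t in atBot, 0 < w t) (t : ℝ) : 0 < w t := by
  by_contra! ht
  obtain ⟨s, hs⟩ := hpos.exists
  obtain ⟨r, hr⟩ := mem_range_of_exists_le_of_exists_ge
    (continuous_iff_continuousAt.2 fun t => (hw t).continuousAt) ⟨t, ht⟩ ⟨s, hs.le⟩
  have := efEnergy_neg hp hc hw hv hw0 hv0 hpos r
  rw [efEnergy, hr, max_self, Real.zero_rpow (by linarith)] at this
  have h := sq_nonneg (v r)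
  norm_num at this
  linarith

lemma tendsto_equilibrium (hp : 1 < p) (hc : 0 < c) (hk : 0 < k)
    (hw : ∀ t, HasDerivAt w (v t) t)
    (hv : ∀ t, HasDerivAt v (-(c * v t) + k * w t - max (w t) 0 ^ p) t)
    (hw0 : Tendsto w atBot (nhds 0)) (hv0 : Tendsto v atBot (nhds 0))
    (hpos : ∀ᶠ t in atBot, 0 < w t) : Tendsto w atTop (nhds (k ^ (1 / (p - 1)))) := by
  have hE := efEnergy_hasDerivAt hp hw hv
  have hanti : Antitone (efEnergy p k w v) := antitone_of_hasDerivAt_nonpos hE fun t => by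
    simp only [Pi.zero_apply, Left.neg_nonpos_iff]; positivity
  have hEneg := efEnergy_neg hp hc hw hv hw0 hv0 hpos
  have hwpos := pos_of_regular_at_bot hp hc hw hv hw0 hv0 hpos
  have hpow : ∀ t, w t ^ (p + 1) = w t ^ (p - 1) * w t ^ 2 := fun t => by
    rw [← Real.rpow_natCast (w t) 2, ← Real.rpow_add (hwpos t)]; congr 1; push_cast; ring
  have hpow1 : ∀ t, w t ^ p = w t ^ (p - 1) * w t := fun t => by
    rw [← Real.rpow_add_one (hwpos t).ne']; congr 1; ring
  have hEeq : ∀ t, efEnergy p k w v t =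
      v t ^ 2 / 2 - k * w t ^ 2 / 2 + w t ^ (p - 1) * w t ^ 2 / (p + 1) := fun t => by
    rw [efEnergy, max_eq_left (hwpos t).le, hpow]
  have hq0 : ∀ t, 0 ≤ w t ^ (p - 1) := fun t => Real.rpow_nonneg (hwpos t).le _
  -- a priori bounds
  have hqle : ∀ t, w t ^ (p - 1) ≤ k * (p + 1) / 2 := fun t => by
    have h := hEneg t
    rw [hEeq] at h
    have h2 : 0 < w t ^ 2 := pow_pos (hwpos t) 2
    have h3 : w t ^ (p - 1) * w t ^ 2 / (p + 1) < k / 2 * w t ^ 2 := by nlinarith [sq_nonneg (v t)]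
    rw [mul_div_right_comm] at h3
    have h4 := lt_of_mul_lt_mul_right h3 h2.le
    rw [div_lt_iff₀ (by linarith)] at h4
    linarith
  set Q := k * (p + 1) / 2 with hQ
  have hQ0 : 0 < Q := by positivity
  set M := Q ^ (1 / (p - 1)) with hM
  have hM0 : 0 < M := Real.rpow_pos_of_pos hQ0 _
  have hroot : ∀ t, (w t ^ (p - 1)) ^ (1 / (p - 1)) = w t := fun t => by
    rw [← Real.rpow_mul (hwpos t).le, mul_one_div_cancel (by linarith), Real.rpow_one]
  have hwM : ∀ t, w t ≤ M := fun t => by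
    rw [← hroot t]
    exact Real.rpow_le_rpow (hq0 t) (hqle t) (by
      have : 0 < p - 1 := by linarith
      positivity)
  have hv2 : ∀ t, v t ^ 2 ≤ k * M ^ 2 := fun t => by
    have h := hEneg t
    rw [hEeq] at h
    have h2 : 0 ≤ w t ^ (p - 1) * w t ^ 2 / (p + 1) := by
      have := hq0 t
      have : 0 < p + 1 := by linarith
      positivity
    have h3 : w t ^ 2 ≤ M ^ 2 := pow_le_pow_left₀ (hwpos t).le (hwM t) 2
    nlinarith
  obtain ⟨m, hm0, hm⟩ : ∃ m > 0, ∀ t ≥ 0, m ≤ w t := by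
    have hE0 := hEneg 0
    refine ⟨Real.sqrt (-2 * efEnergy p k w v 0 / k), Real.sqrt_pos.2 (by
      apply div_pos _ hk; linarith), fun t ht => ?_⟩
    rw [Real.sqrt_le_left (hwpos t).le, div_le_iff₀ hk]
    have h := hanti ht
    rw [hEeq t] at h
    have h2 : 0 ≤ w t ^ (p - 1) * w t ^ 2 / (p + 1) := by
      have := hq0 t
      have : 0 < p + 1 := by linarith
      positivity
    nlinarith [sq_nonneg (v t)]
  -- the strict Lyapunov function
  let f : ℝ → ℝ := fun t => w t ^ p - k * w t
  let f' : ℝ → ℝ := fun t => (p * w t ^ (p - 1) - k) * v t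
  have hf : ∀ t, HasDerivAt f (f' t) t := fun t => by
    refine ((Real.hasDerivAt_rpow_const (p := p) (Or.inl (hwpos t).ne')).comp t (hw t)
      |>.sub ((hw t).const_mul k)).congr_deriv ?_
    simp only [f']; ring
  have hvf : ∀ t, HasDerivAt v (-(c * v t) - f t) t := fun t => (hv t).congr_deriv (by
    rw [max_eq_left (hwpos t).le]; simp only [f]; ring)
  set B := p * Q + k with hB
  have hB0 : 0 < B := by positivity
  have hslope : ∀ t, |p * w t ^ (p - 1) - k| ≤ B := fun t => by
    have h1 := hq0 t
    have h2 := mul_le_mul_of_nonneg_left (hqle t) (show 0 ≤ p by linarith)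
    have h3 := mul_nonneg (show 0 ≤ p by linarith) h1
    rw [abs_le]; constructor <;> linarith
  have hfM : ∀ t, |f t| ≤ (Q + k) * M := fun t => by
    have h1 : f t = (w t ^ (p - 1) - k) * w t := by simp only [f, hpow1]; ring
    rw [h1, abs_mul, abs_of_pos (hwpos t)]
    refine mul_le_mul ?_ (hwM t) (hwpos t).le (by positivity)
    have h2 := hqle t
    have h3 := hq0 t
    rw [abs_le]; constructor <;> linarith
  set D := c ^ 2 / 2 + B with hD
  have hD0 : 0 < D := by positivity
  set ε := c / (2 * D) with hε
  have hε0 : 0 < ε := by positivity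
  have hεD : ε * D = c / 2 := by rw [hε]; field_simp
  let L : ℝ → ℝ := fun t => efEnergy p k w v t + ε * (v t * f t)
  have hL : ∀ t, HasDerivAt L (-(c * v t ^ 2) + ε * ((-(c * v t) - f t) * f t + v t * f' t)) t :=
    fun t => (hE t).add (((hvf t).mul (hf t)).const_mul ε)
  have hF : ∀ t, HasDerivAt (fun t => v t ^ 2 + f t ^ 2)
      (2 * v t * (-(c * v t) - f t) + 2 * f t * f' t) t := fun t => by
    refine (((hvf t).pow 2).add ((hf t).pow 2)).congr_deriv ?_
    push_cast; ring
  set V := k * M ^ 2 + 1 with hV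
  have hV1 : ∀ t, |v t| ≤ V := fun t => by
    have := hv2 t
    rw [← sq_abs] at this
    nlinarith [sq_nonneg (|v t| - 1)]
  set Φ := (Q + k) * M with hΦ
  have hlim : Tendsto (fun t => v t ^ 2 + f t ^ 2) atTop (nhds 0) := by
    refine tendsto_zero_of_dissipation (κ := min (c / 2) (ε / 2))
      (B := 2 * V * (c * V + Φ) + 2 * Φ * (B * V))
      (m := -(k * M ^ 2 / 2) - ε * (V * Φ))
      (lt_min (by positivity) (by positivity)) hL hF (fun t _ => ?_) (fun t => by positivity)
      (fun t _ => ?_) fun t _ => ?_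
    · have h1 : min (c / 2) (ε / 2) * (v t ^ 2 + f t ^ 2) ≤ c / 2 * v t ^ 2 + ε / 2 * f t ^ 2 := by
        rw [mul_add]
        gcongr
        · exact min_le_left _ _
        · exact min_le_right _ _
      have h2 : v t * f' t ≤ B * v t ^ 2 := by
        simp only [f']
        have := (le_abs_self _).trans (hslope t)
        nlinarith [sq_nonneg (v t)]
      have h3 : (-(c * v t) - f t) * f t ≤ c ^ 2 / 2 * v t ^ 2 - f t ^ 2 / 2 := by
        nlinarith [sq_nonneg (c * v t + f t)]
      have h4 : ε * ((-(c * v t) - f t) * f t + v t * f' t) ≤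
          ε * (D * v t ^ 2 - f t ^ 2 / 2) := by
        apply mul_le_mul_of_nonneg_left _ hε0.le
        rw [hD]; linarith
      have h5 : ε * (D * v t ^ 2 - f t ^ 2 / 2) = c / 2 * v t ^ 2 - ε / 2 * f t ^ 2 := by
        rw [← hεD]; ring
      linarith
    · have hf' : |f' t| ≤ B * V := by
        simp only [f', abs_mul]
        exact mul_le_mul (hslope t) (hV1 t) (abs_nonneg _) hB0.le
      have hvv : |-(c * v t) - f t| ≤ c * V + Φ := by
        refine (abs_sub _ _).trans (add_le_add ?_ (hfM t))
        rw [abs_neg, abs_mul, abs_of_pos hc]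
        exact mul_le_mul_of_nonneg_left (hV1 t) hc.le
      refine (abs_add_le _ _).trans (add_le_add ?_ ?_)
      · rw [abs_mul, abs_mul, abs_two]
        have := hV1 t
        gcongr
      · rw [abs_mul, abs_mul, abs_two]
        have := hfM t
        gcongr
    · have h1 : -(k * M ^ 2 / 2) ≤ efEnergy p k w v t := by
        rw [hEeq]
        have h2 : 0 ≤ w t ^ (p - 1) * w t ^ 2 / (p + 1) := by
          have := hq0 t
          have : 0 < p + 1 := by linarith
          positivity
        have h3 : w t ^ 2 ≤ M ^ 2 := pow_le_pow_left₀ (hwpos t).le (hwM t) 2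
        nlinarith [sq_nonneg (v t)]
      have h4 : -(V * Φ) ≤ v t * f t := by
        have := neg_abs_le (v t * f t)
        rw [abs_mul] at this
        have := mul_le_mul (hV1 t) (hfM t) (abs_nonneg _) ((abs_nonneg _).trans (hV1 t))
        linarith
      have := mul_le_mul_of_nonneg_left h4 hε0.le
      simp only [L]
      linarith
  have hf0 : Tendsto f atTop (nhds 0) := by
    have h1 : Tendsto (fun t => f t ^ 2) atTop (nhds 0) :=
      squeeze_zero (fun t => sq_nonneg _) (fun t => by nlinarith [sq_nonneg (v t)]) hlim
    have h2 := h1.sqrt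
    rw [Real.sqrt_zero] at h2
    simp only [Real.sqrt_sq_eq_abs] at h2
    exact (tendsto_zero_iff_abs_tendsto_zero f).2 h2
  have hq : Tendsto (fun t => w t ^ (p - 1)) atTop (nhds k) := by
    rw [← tendsto_sub_nhds_zero_iff]
    refine squeeze_zero_norm' ?_ (by simpa using hf0.norm.div_const m)
    filter_upwards [eventually_ge_atTop (0 : ℝ)] with t ht
    have h1 : f t = (w t ^ (p - 1) - k) * w t := by simp only [f, hpow1]; ring
    rw [le_div_iff₀ hm0, h1, Real.norm_eq_abs, abs_mul, abs_of_pos (hwpos t)]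
    exact mul_le_mul_of_nonneg_left (hm t ht) (abs_nonneg _)
  have := hq.rpow_const (p := 1 / (p - 1)) (Or.inl hk.ne')
  simpa only [hroot] using this

end Dissipative

lemma abs_rpow_sub_rpow_le {p M x y : ℝ} (hp : 1 ≤ p) (hx : x ∈ Icc 0 M) (hy : y ∈ Icc 0 M) :
    |x ^ p - y ^ p| ≤ p * M ^ (p - 1) * |x - y| := by
  refine Convex.norm_image_sub_le_of_norm_hasDerivWithin_le (f := fun x : ℝ => x ^ p)
    (f' := fun x => p * x ^ (p - 1)) (s := Icc 0 M)
    (fun z _ => (Real.hasDerivAt_rpow_const (Or.inr hp)).hasDerivWithinAt)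
    (fun z hz => ?_) (convex_Icc 0 M) hy hx
  rw [Real.norm_eq_abs, abs_of_nonneg (mul_nonneg (by linarith) (Real.rpow_nonneg hz.1 _))]
  exact mul_le_mul_of_nonneg_left (Real.rpow_le_rpow hz.1 hz.2 (by linarith)) (by linarith)

/-- Positive global solutions of the autonomous system `w' = v`, `v' = - c v + k w - w ^ p`
(the Emden-Fowler equation in logarithmic coordinates). -/
structure EFSol (p c k : ℝ) (w v : ℝ → ℝ) : Prop where
  pos : ∀ t, 0 < w t
  hw : ∀ t, HasDerivAt w (v t) t
  hv : ∀ t, HasDerivAt v (-(c * v t) + k * w t - w t ^ p) t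

namespace EFSol

variable {p c k : ℝ} {w v w₁ v₁ w₂ v₂ : ℝ → ℝ}

lemma shift (h : EFSol p c k w v) (τ : ℝ) :
    EFSol p c k (fun t => w (t + τ)) (fun t => v (t + τ)) where
  pos _ := h.pos _
  hw t := (h.hw (t + τ)).comp_add_const t τ
  hv t := (h.hv (t + τ)).comp_add_const t τ

lemma reflect (h : EFSol p c k w v) :
    EFSol p (-c) k (fun t => w (-t)) (fun t => -v (-t)) where
  pos _ := h.pos _
  hw t := ((h.hw (-t)).comp t (hasDerivAt_neg t)).congr_deriv (by ring)
  hv t := ((h.hv (-t)).comp t (hasDerivAt_neg t)).neg.congr_deriv (by ring)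

lemma rpow_eq (h : EFSol p c k w v) (t : ℝ) : w t ^ p = w t ^ (p - 1) * w t := by
  rw [← Real.rpow_add_one (h.pos t).ne']; congr 1; ring

lemma exists_deriv_pos (h : EFSol p c k w v) (hp : 1 < p) (hk : 0 < k)
    (h0 : Tendsto w atBot (nhds 0)) :
    ∃ T, ∀ t ≤ T, 0 < v t ∧ w t ^ (p - 1) < k := by
  have hq : Tendsto (fun t => w t ^ (p - 1)) atBot (nhds 0) := by
    have := h0.rpow_const (p := p - 1) (Or.inr (by linarith))
    rwa [Real.zero_rpow (by linarith)] at this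
  obtain ⟨T, hT⟩ := (hq.eventually (gt_mem_nhds hk)).exists_forall_of_atBot
  refine ⟨T, fun t ht => ⟨?_, hT t ht⟩⟩
  by_contra! hneg
  have hderiv : ∀ s, HasDerivAt (fun s => Real.exp (c * s) * v s)
      (Real.exp (c * s) * (w s * (k - w s ^ (p - 1)))) s := fun s => by
    have h1 : HasDerivAt (fun s => Real.exp (c * s)) (Real.exp (c * s) * (c * 1)) s :=
      ((hasDerivAt_id s).const_mul c).exp
    refine (h1.mul (h.hv s)).congr_deriv ?_
    rw [h.rpow_eq s]; ring
  have hmono : MonotoneOn (fun s => Real.exp (c * s) * v s) (Iic t) := by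
    refine monotoneOn_of_deriv_nonneg (convex_Iic t)
      (fun s _ => (hderiv s).continuousAt.continuousWithinAt)
      (fun s _ => (hderiv s).differentiableAt.differentiableWithinAt) fun s hs => ?_
    rw [interior_Iic] at hs
    rw [(hderiv s).deriv]
    have h1 := hT s ((le_of_lt hs).trans ht)
    have h2 := h.pos s
    have h3 := sub_pos.2 h1
    positivity
  have hvneg : ∀ s ≤ t, v s ≤ 0 := fun s hs => by
    have h1 := hmono hs self_mem_Iic hs
    have h2 : Real.exp (c * t) * v t ≤ 0 := mul_nonpos_of_nonneg_of_nonpos (Real.exp_pos _).le hneg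
    exact nonpos_of_mul_nonpos_right (h1.trans h2) (Real.exp_pos _)
  have hanti : AntitoneOn w (Iic t) := by
    refine antitoneOn_of_deriv_nonpos (convex_Iic t)
      (fun s _ => (h.hw s).continuousAt.continuousWithinAt)
      (fun s _ => (h.hw s).differentiableAt.differentiableWithinAt) fun s hs => ?_
    rw [interior_Iic] at hs
    rw [(h.hw s).deriv]
    exact hvneg s (le_of_lt hs)
  have : w t ≤ 0 := ge_of_tendsto h0 (by
    filter_upwards [eventually_le_atBot t] with s hs using hanti hs self_mem_Iic hs)
  exact absurd (h.pos t) (not_lt.2 this)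

lemma tendsto_deriv_atBot (h : EFSol p c k w v) (hp : 1 < p) (hk : 0 < k)
    (h0 : Tendsto w atBot (nhds 0)) : Tendsto v atBot (nhds 0) := by
  obtain ⟨T, hT⟩ := h.exists_deriv_pos hp hk h0
  have hwm : MonotoneOn w (Iic T) := by
    refine monotoneOn_of_deriv_nonneg (convex_Iic T)
      (fun s _ => (h.hw s).continuousAt.continuousWithinAt)
      (fun s _ => (h.hw s).differentiableAt.differentiableWithinAt) fun s hs => ?_
    rw [interior_Iic] at hs
    rw [(h.hw s).deriv]
    exact (hT s (le_of_lt hs)).1.le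
  have hd : ∀ s, HasDerivAt (fun s => v s + c * w s) (w s * (k - w s ^ (p - 1))) s := fun s =>
    ((h.hv s).add ((h.hw s).const_mul c)).congr_deriv (by rw [h.rpow_eq s]; ring)
  have hm : MonotoneOn (fun s => v s + c * w s) (Iic T) := by
    refine monotoneOn_of_deriv_nonneg (convex_Iic T)
      (fun s _ => (hd s).continuousAt.continuousWithinAt)
      (fun s _ => (hd s).differentiableAt.differentiableWithinAt) fun s hs => ?_
    rw [interior_Iic] at hs
    rw [(hd s).deriv]
    exact mul_nonneg (h.pos s).le (sub_nonneg.2 (hT s (le_of_lt hs)).2.le)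
  have hlim : Tendsto (fun t => (1 + 2 * |c|) * w (t + 1)) atBot (nhds 0) := by
    have := (h0.comp (tendsto_atBot_add_const_right atBot (1 : ℝ) tendsto_id)).const_mul
      (1 + 2 * |c|)
    simpa using this
  refine tendsto_of_tendsto_of_tendsto_of_le_of_le' tendsto_const_nhds hlim ?_ ?_
  · filter_upwards [eventually_le_atBot T] with t ht using (hT t ht).1.le
  · filter_upwards [eventually_le_atBot (T - 1)] with t ht
    have htT : t + 1 ≤ T := by linarith
    obtain ⟨ξ, hξ, hξe⟩ := exists_hasDerivAt_eq_slope w v (show t < t + 1 by linarith)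
      (fun s _ => (h.hw s).continuousAt.continuousWithinAt) (fun s _ => h.hw s)
    rw [add_sub_cancel_left, div_one] at hξe
    have hξT : ξ ≤ T := hξ.2.le.trans htT
    have h1 := hm (show t ∈ Iic T from by simp only [mem_Iic]; linarith) hξT hξ.1.le
    simp only at h1
    have h2 := hwm hξT htT hξ.2.le
    have h3 := hwm (show t ∈ Iic T from by simp only [mem_Iic]; linarith) hξT hξ.1.le
    have h4 : c * (w ξ - w t) ≤ |c| * (w (t + 1)) := by
      have := h.pos t
      calc c * (w ξ - w t) ≤ |c| * (w ξ - w t) :=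
            mul_le_mul_of_nonneg_right (le_abs_self c) (by linarith)
        _ ≤ _ := mul_le_mul_of_nonneg_left (by linarith) (abs_nonneg c)
    have h5 := mul_nonneg (abs_nonneg c) (h.pos (t + 1)).le
    have h6 := h.pos t
    linarith

end EFSol

/-- Inverse of a function which increases from `0` at `-∞` with positive derivative. -/
lemma exists_inverse_atBot {w v : ℝ → ℝ} {T : ℝ} (hw : ∀ t, HasDerivAt w (v t) t)
    (hpos : ∀ t, 0 < w t) (hv : ∀ t ≤ T, 0 < v t) (h0 : Tendsto w atBot (nhds 0)) :
    ∃ ρ : ℝ → ℝ, (∀ y ∈ Ioo 0 (w T), w (ρ y) = y ∧ ρ y ≤ T ∧ HasDerivAt ρ (v (ρ y))⁻¹ y) ∧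
      Tendsto ρ (nhdsWithin 0 (Ioi 0)) atBot := by
  have hsm : StrictMonoOn w (Iic T) := by
    refine strictMonoOn_of_deriv_pos (convex_Iic T)
      (fun s _ => (hw s).continuousAt.continuousWithinAt) fun s hs => ?_
    rw [interior_Iic] at hs
    rw [(hw s).deriv]
    exact hv s (le_of_lt hs)
  have hex : ∀ y, ∃ s, y ∈ Ioo 0 (w T) → w s = y ∧ s < T := by
    intro y
    by_cases hy : y ∈ Ioo 0 (w T)
    · obtain ⟨s, hs, hsT⟩ := ((h0.eventually (gt_mem_nhds hy.1)).and
        (eventually_lt_atBot T)).exists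
      obtain ⟨r, hr, hry⟩ := intermediate_value_Ioo hsT.le
        (fun s _ => (hw s).continuousAt.continuousWithinAt) (show y ∈ Ioo (w s) (w T) from ⟨hs, hy.2⟩)
      exact ⟨r, fun _ => ⟨hry, hr.2⟩⟩
    · exact ⟨0, fun h => absurd h hy⟩
  choose ρ hρ using hex
  have hsm' : StrictMonoOn ρ (Ioo 0 (w T)) := fun y hy z hz hyz => by
    rw [← hsm.lt_iff_lt (hρ y hy).2.le (hρ z hz).2.le, (hρ y hy).1, (hρ z hz).1]
    exact hyz
  have hmem : ∀ t < T, w t ∈ Ioo 0 (w T) := fun t ht =>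
    ⟨hpos t, hsm (le_of_lt ht) self_mem_Iic ht⟩
  have hleft : ∀ t < T, ρ (w t) = t := fun t ht =>
    hsm.injOn (hρ _ (hmem t ht)).2.le (le_of_lt ht) (hρ _ (hmem t ht)).1
  refine ⟨ρ, fun y hy => ⟨(hρ y hy).1, (hρ y hy).2.le, ?_⟩, ?_⟩
  · have hnhds : Ioo 0 (w T) ∈ nhds y := Ioo_mem_nhds hy.1 hy.2
    have hcont : ContinuousAt ρ y := by
      refine hsm'.continuousAt_of_image_mem_nhds hnhds ?_
      filter_upwards [gt_mem_nhds (hρ y hy).2] with t ht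
      exact ⟨w t, hmem t ht, hleft t ht⟩
    refine HasDerivAt.of_local_left_inverse hcont (hw _) (hv _ (hρ y hy).2.le).ne' ?_
    filter_upwards [hnhds] with z hz using (hρ z hz).1
  · rw [tendsto_atBot]
    intro b
    have hb : 0 < w (min b (T - 1)) := hpos _
    have hbT : min b (T - 1) < T := (min_le_right _ _).trans_lt (by linarith)
    filter_upwards [Ioo_mem_nhdsGT hb] with y hy
    have hy' : y ∈ Ioo 0 (w T) := ⟨hy.1, hy.2.trans (hmem _ hbT).2⟩
    have := hsm' hy' (hmem _ hbT) hy.2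
    rw [hleft _ hbT] at this
    exact this.le.trans (min_le_left _ _)

namespace EFSol

variable {p c k : ℝ} {w v w₁ v₁ w₂ v₂ : ℝ → ℝ}

/-- Two solutions emanating from the origin pass through a common point of the phase plane. -/
lemma exists_common_point (h₁ : EFSol p c k w₁ v₁) (h₂ : EFSol p c k w₂ v₂) (hp : 1 < p)
    (hk : 0 < k) (h₁0 : Tendsto w₁ atBot (nhds 0)) (h₂0 : Tendsto w₂ atBot (nhds 0)) :
    ∃ t₁ t₂, w₁ t₁ = w₂ t₂ ∧ v₁ t₁ = v₂ t₂ := by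
  obtain ⟨T₁, hT₁⟩ := h₁.exists_deriv_pos hp hk h₁0
  obtain ⟨T₂, hT₂⟩ := h₂.exists_deriv_pos hp hk h₂0
  obtain ⟨ρ₁, hρ₁, hρ₁b⟩ := exists_inverse_atBot h₁.hw h₁.pos (fun t ht => (hT₁ t ht).1) h₁0
  obtain ⟨ρ₂, hρ₂, hρ₂b⟩ := exists_inverse_atBot h₂.hw h₂.pos (fun t ht => (hT₂ t ht).1) h₂0
  set y₀ := min (w₁ T₁) (w₂ T₂) with hy₀
  have hy₀pos : 0 < y₀ := lt_min (h₁.pos _) (h₂.pos _)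
  have hm₁ : ∀ y ∈ Ioo 0 y₀, y ∈ Ioo 0 (w₁ T₁) := fun y hy =>
    ⟨hy.1, hy.2.trans_le (min_le_left _ _)⟩
  have hm₂ : ∀ y ∈ Ioo 0 y₀, y ∈ Ioo 0 (w₂ T₂) := fun y hy =>
    ⟨hy.1, hy.2.trans_le (min_le_right _ _)⟩
  let F : ℝ → ℝ := fun y => (v₁ (ρ₁ y) - v₂ (ρ₂ y)) ^ 2
  let F' : ℝ → ℝ := fun y => -(2 * (k * y - y ^ p) * (v₁ (ρ₁ y) - v₂ (ρ₂ y)) ^ 2 *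
    ((v₁ (ρ₁ y))⁻¹ * (v₂ (ρ₂ y))⁻¹))
  have hF : ∀ y ∈ Ioo 0 y₀, HasDerivAt F (F' y) y := fun y hy => by
    obtain ⟨a1, a2, a3⟩ := hρ₁ y (hm₁ y hy)
    obtain ⟨b1, b2, b3⟩ := hρ₂ y (hm₂ y hy)
    have ha := (hT₁ _ a2).1.ne'
    have hb := (hT₂ _ b2).1.ne'
    refine ((((h₁.hv (ρ₁ y)).comp y a3).sub ((h₂.hv (ρ₂ y)).comp y b3)).pow 2).congr_deriv ?_
    simp only [F', a1, b1, Pi.sub_apply, Function.comp_apply]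
    push_cast
    field_simp
    ring
  have hanti : AntitoneOn F (Ioo 0 y₀) := by
    refine antitoneOn_of_deriv_nonpos (convex_Ioo _ _)
      (fun y hy => (hF y hy).continuousAt.continuousWithinAt)
      (fun y hy => (hF y (interior_subset hy)).differentiableAt.differentiableWithinAt)
      fun y hy => ?_
    have hy := interior_subset hy
    rw [(hF y hy).deriv]
    obtain ⟨a1, a2, -⟩ := hρ₁ y (hm₁ y hy)
    obtain ⟨-, b2, -⟩ := hρ₂ y (hm₂ y hy)
    have ha := (hT₁ _ a2).1
    have hb := (hT₂ _ b2).1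
    have hq := h₁.rpow_eq (ρ₁ y)
    have hq' := (hT₁ _ a2).2
    rw [a1] at hq hq'
    have : 0 ≤ k * y - y ^ p := by
      rw [hq, ← sub_mul]
      exact mul_nonneg (by linarith) hy.1.le
    simp only [F', Left.neg_nonpos_iff]
    positivity
  have hlim : Tendsto F (nhdsWithin 0 (Ioi 0)) (nhds 0) := by
    have := (((h₁.tendsto_deriv_atBot hp hk h₁0).comp hρ₁b).sub
      ((h₂.tendsto_deriv_atBot hp hk h₂0).comp hρ₂b)).pow 2
    simpa using this
  have hy : y₀ / 2 ∈ Ioo 0 y₀ := ⟨by linarith, by linarith⟩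
  have hle : F (y₀ / 2) ≤ 0 := ge_of_tendsto hlim (by
    filter_upwards [Ioo_mem_nhdsGT (show 0 < y₀ / 2 by linarith)] with z hz
    exact hanti ⟨hz.1, by linarith [hz.2]⟩ hy hz.2.le)
  refine ⟨ρ₁ (y₀ / 2), ρ₂ (y₀ / 2), ?_, ?_⟩
  · rw [(hρ₁ _ (hm₁ _ hy)).1, (hρ₂ _ (hm₂ _ hy)).1]
  · exact sub_eq_zero.1 (pow_eq_zero_iff two_ne_zero |>.1 (le_antisymm hle (sq_nonneg _)))

lemma eq_of_eq_at (h₁ : EFSol p c k w₁ v₁) (h₂ : EFSol p c k w₂ v₂) (hp : 1 < p)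
    {t₀ : ℝ} (hw : w₁ t₀ = w₂ t₀) (hv : v₁ t₀ = v₂ t₀) (t : ℝ) : w₁ t = w₂ t := by
  set a := min t t₀ - 1
  set b := max t t₀ + 1
  have hat : a < t := by linarith [min_le_left t t₀]
  have hat₀ : a < t₀ := by linarith [min_le_right t t₀]
  have hbt : t < b := by linarith [le_max_left t t₀]
  have hbt₀ : t₀ < b := by linarith [le_max_right t t₀]
  obtain ⟨M₁, hM₁⟩ := (isCompact_Icc (a := a) (b := b)).bddAbove_image
    (fun s _ => (h₁.hw s).continuousAt.continuousWithinAt)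
  obtain ⟨M₂, hM₂⟩ := (isCompact_Icc (a := a) (b := b)).bddAbove_image
    (fun s _ => (h₂.hw s).continuousAt.continuousWithinAt)
  set M := max M₁ M₂
  have hb₁ : ∀ s ∈ Ioo a b, w₁ s ≤ M := fun s hs =>
    (hM₁ ⟨s, Ioo_subset_Icc_self hs, rfl⟩).trans (le_max_left _ _)
  have hb₂ : ∀ s ∈ Ioo a b, w₂ s ≤ M := fun s hs =>
    (hM₂ ⟨s, Ioo_subset_Icc_self hs, rfl⟩).trans (le_max_right _ _)
  have hM0 : 0 ≤ M := (h₁.pos t).le.trans (hb₁ t ⟨hat, hbt⟩)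
  let X : ℝ × ℝ → ℝ × ℝ := fun x => (x.2, -(c * x.2) + k * x.1 - x.1 ^ p)
  let S : Set (ℝ × ℝ) := {x | x.1 ∈ Icc 0 M}
  have hΛ : 0 ≤ p * M ^ (p - 1) := mul_nonneg (by linarith) (Real.rpow_nonneg hM0 _)
  have hΛ' : 0 ≤ 1 + |c| + |k| + p * M ^ (p - 1) := by positivity
  have hLip : LipschitzOnWith (Real.toNNReal (1 + |c| + |k| + p * M ^ (p - 1))) X S := by
    refine LipschitzOnWith.of_dist_le_mul fun x hx y hy => ?_
    have d1 : |x.1 - y.1| ≤ dist x y := by rw [← Real.dist_eq]; exact le_max_left _ _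
    have d2 : |x.2 - y.2| ≤ dist x y := by rw [← Real.dist_eq]; exact le_max_right _ _
    have d0 : 0 ≤ dist x y := dist_nonneg
    rw [Real.coe_toNNReal _ hΛ', Prod.dist_eq (x := X x)]
    refine max_le ?_ ?_
    · simp only [X, Real.dist_eq]
      nlinarith [mul_nonneg (show 0 ≤ |c| + |k| + p * M ^ (p - 1) by positivity) d0]
    · simp only [X, Real.dist_eq]
      have e : -(c * x.2) + k * x.1 - x.1 ^ p - (-(c * y.2) + k * y.1 - y.1 ^ p) =
          -(c * (x.2 - y.2)) + k * (x.1 - y.1) + -(x.1 ^ p - y.1 ^ p) := by ring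
      rw [e]
      refine (abs_add_three _ _ _).trans ?_
      rw [abs_neg, abs_neg, abs_mul, abs_mul]
      have e1 := mul_le_mul_of_nonneg_left d2 (abs_nonneg c)
      have e2 := mul_le_mul_of_nonneg_left d1 (abs_nonneg k)
      have e3 := (abs_rpow_sub_rpow_le hp.le hx hy).trans (mul_le_mul_of_nonneg_left d1 hΛ)
      linarith
  have key := ODE_solution_unique_of_mem_Ioo (v := fun _ => X) (s := fun _ => S)
    (f := fun s => (w₁ s, v₁ s)) (g := fun s => (w₂ s, v₂ s)) (a := a) (b := b) (t₀ := t₀)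
    (fun _ _ => hLip) ⟨hat₀, hbt₀⟩
    (fun s hs => ⟨(h₁.hw s).prodMk (h₁.hv s), (h₁.pos s).le, hb₁ s hs⟩)
    (fun s hs => ⟨(h₂.hw s).prodMk (h₂.hv s), (h₂.pos s).le, hb₂ s hs⟩)
    (by simp only [hw, hv])
  exact congrArg Prod.fst (key ⟨hat, hbt⟩)

/-- Positive solutions vanishing at `-∞` are unique up to translation. -/
lemma unique_up_to_shift (h₁ : EFSol p c k w₁ v₁) (h₂ : EFSol p c k w₂ v₂) (hp : 1 < p)
    (hk : 0 < k) (h₁0 : Tendsto w₁ atBot (nhds 0)) (h₂0 : Tendsto w₂ atBot (nhds 0)) :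
    ∃ τ, ∀ t, w₂ t = w₁ (t + τ) := by
  obtain ⟨t₁, t₂, hw, hv⟩ := exists_common_point h₁ h₂ hp hk h₁0 h₂0
  refine ⟨t₁ - t₂, fun t => ?_⟩
  exact h₂.eq_of_eq_at (h₁.shift (t₁ - t₂)) hp (t₀ := t₂)
    (by simp only [add_sub_cancel, hw]) (by simp only [add_sub_cancel, hv]) t

end EFSol

/-- Differentiation rules for the logarithmic coordinates `w t = exp (-a t) u (exp t)`. -/
lemma hasDerivAt_logCoord {a r t : ℝ} {u d : ℝ → ℝ}
    (hu : HasDerivAt u (d (Real.exp t)) (Real.exp t)) (hd : HasDerivAt d r (Real.exp t)) :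
    HasDerivAt (fun t => Real.exp (-a * t) * u (Real.exp t))
      (Real.exp ((1 - a) * t) * d (Real.exp t) - a * (Real.exp (-a * t) * u (Real.exp t))) t ∧
    HasDerivAt (fun t => Real.exp ((1 - a) * t) * d (Real.exp t) -
        a * (Real.exp (-a * t) * u (Real.exp t)))
      (-((2 * a - 1) * (Real.exp ((1 - a) * t) * d (Real.exp t) -
        a * (Real.exp (-a * t) * u (Real.exp t)))) +
        a * (1 - a) * (Real.exp (-a * t) * u (Real.exp t)) + Real.exp ((2 - a) * t) * r) t := by
  have hexp : ∀ b : ℝ, HasDerivAt (fun t => Real.exp (b * t)) (Real.exp (b * t) * b) t := fun b => by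
    simpa using ((hasDerivAt_id t).const_mul b).exp
  have e1 : Real.exp ((1 - a) * t) = Real.exp (-a * t) * Real.exp t := by
    rw [← Real.exp_add]; congr 1; ring
  have e2 : Real.exp ((2 - a) * t) = Real.exp ((1 - a) * t) * Real.exp t := by
    rw [← Real.exp_add]; congr 1; ring
  have h1 : HasDerivAt (fun t => Real.exp (-a * t) * u (Real.exp t))
      (Real.exp ((1 - a) * t) * d (Real.exp t) - a * (Real.exp (-a * t) * u (Real.exp t))) t := by
    refine ((hexp (-a)).mul (hu.comp t (Real.hasDerivAt_exp t))).congr_deriv ?_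
    simp only [Function.comp_apply]
    rw [e1]; ring
  refine ⟨h1, ?_⟩
  refine (((hexp (1 - a)).mul (hd.comp t (Real.hasDerivAt_exp t))).sub
    (h1.const_mul a)).congr_deriv ?_
  simp only [Function.comp_apply]
  rw [e2]; ring

lemma exists_heteroclinic {p a : ℝ} (hp : 1 < p) (ha : 1 / 2 < a) (ha1 : a < 1) :
    ∃ w v : ℝ → ℝ, EFSol p (2 * a - 1) (a * (1 - a)) w v ∧ Tendsto w atBot (nhds 0) ∧
      Tendsto w atTop (nhds ((a * (1 - a)) ^ (1 / (p - 1)))) := by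
  have hβ : 0 < (1 - a) * (p - 1) := mul_pos (by linarith) (by linarith)
  have hmem : ∀ z : ℝ, max (min z 1) 0 ∈ Icc (0 : ℝ) 1 := fun z =>
    ⟨le_max_right _ _, max_le (min_le_right _ _) zero_le_one⟩
  obtain ⟨u, d, hu, hd, hd0, hu0, hu1⟩ := exists_regular_solution (K := p)
    (φ := fun z => max (min z 1) 0 ^ p) hβ
    (Continuous.rpow_const (by fun_prop) fun _ => Or.inr (by linarith))
    (fun z => Real.rpow_nonneg (hmem z).1 _)
    (fun z => Real.rpow_le_one (hmem z).1 (hmem z).2 (by linarith)) hp.le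
    (fun y z => by
      have h1 := abs_rpow_sub_rpow_le hp.le (hmem y) (hmem z)
      rw [Real.one_rpow, mul_one] at h1
      refine h1.trans (mul_le_mul_of_nonneg_left ?_ (by linarith))
      exact (abs_max_sub_max_le_abs _ _ _).trans (by
        have := abs_min_sub_min_le_max y 1 z 1
        simpa using this))
  set w : ℝ → ℝ := fun t => Real.exp (-a * t) * u (Real.exp t) with hwdef
  set v : ℝ → ℝ := fun t => Real.exp ((1 - a) * t) * d (Real.exp t) - a * w t with hvdef
  have hD := fun t => hasDerivAt_logCoord (a := a) (hu _ (Real.exp_pos t)) (hd _ (Real.exp_pos t))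
  have hw : ∀ t, HasDerivAt w (v t) t := fun t => (hD t).1
  have hue : ∀ t, u (Real.exp t) / Real.exp t = Real.exp (-(1 - a) * t) * w t := fun t => by
    rw [hwdef, div_eq_mul_inv, ← Real.exp_neg]
    simp only
    rw [← mul_assoc, ← Real.exp_add, mul_comm]
    congr 2; ring
  have hwe : ∀ t, w t = Real.exp ((1 - a) * t) * (u (Real.exp t) / Real.exp t) := fun t => by
    rw [hue, ← mul_assoc, ← Real.exp_add]; ring_nf; simp
  have hv : ∀ t, HasDerivAt v (-((2 * a - 1) * v t) + a * (1 - a) * w t - max (w t) 0 ^ p) t :=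
    fun t => by
    refine (hD t).2.congr_deriv ?_
    rw [min_eq_left (hu1 _ (Real.exp_pos t)), hue]
    have e : max (Real.exp (-(1 - a) * t) * w t) 0 = Real.exp (-(1 - a) * t) * max (w t) 0 := by
      rw [mul_max_of_nonneg _ _ (Real.exp_pos _).le, mul_zero]
    have e2 : (2 - a) * t + t * ((1 - a) * (p - 1) - 1) + -(1 - a) * t * p = 0 := by ring
    have key : Real.exp ((2 - a) * t) * (Real.exp (t * ((1 - a) * (p - 1) - 1)) *
        (Real.exp (-(1 - a) * t * p) * max (w t) 0 ^ p)) = max (w t) 0 ^ p := by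
      rw [← mul_assoc, ← mul_assoc, ← Real.exp_add, ← Real.exp_add, e2, Real.exp_zero, one_mul]
    rw [e, Real.mul_rpow (Real.exp_pos _).le (le_max_right _ _), ← Real.exp_mul, ← Real.exp_mul,
      mul_neg, key, ← sub_eq_add_neg]
  have hexp0 : Tendsto (fun t => Real.exp ((1 - a) * t)) atBot (nhds 0) :=
    Real.tendsto_exp_atBot.comp (tendsto_id.const_mul_atBot (by linarith))
  have hu0' := hu0.comp Real.tendsto_exp_atBot_nhdsGT
  have hw0 : Tendsto w atBot (nhds 0) := by
    have := hexp0.mul hu0'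
    rw [zero_mul] at this
    exact this.congr fun t => (hwe t).symm
  have hv0 : Tendsto v atBot (nhds 0) := by
    have := (hexp0.mul (hd0.comp Real.tendsto_exp_atBot_nhdsGT)).sub (hw0.const_mul a)
    rw [zero_mul, mul_zero, sub_zero] at this
    exact this
  have hpos : ∀ᶠ t in atBot, 0 < w t := by
    filter_upwards [hu0'.eventually (lt_mem_nhds zero_lt_one)] with t ht
    rw [hwe]
    exact mul_pos (Real.exp_pos _) ht
  have hc : 0 < 2 * a - 1 := by linarith
  have hwpos := pos_of_regular_at_bot hp hc hw hv hw0 hv0 hpos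
  refine ⟨w, v, ⟨hwpos, hw, fun t => (hv t).congr_deriv ?_⟩, hw0,
    tendsto_equilibrium hp hc (mul_pos (by linarith) (by linarith)) hw hv hw0 hv0 hpos⟩
  rw [max_eq_left (hwpos t).le]

lemma exists_homoclinic {p : ℝ} (hp : 1 < p) :
    ∃ w v : ℝ → ℝ, EFSol p 0 (1 / 4) w v ∧ Tendsto w atBot (nhds 0) ∧
      Tendsto w atTop (nhds 0) := by
  have hp1 : 0 < p - 1 := by linarith
  set B := (p - 1) / 4 with hB
  set q := 2 / (p - 1) with hq
  have hqB : q * B = 1 / 2 := by rw [hq, hB]; field_simp; norm_num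
  have hq0 : 0 < q := by positivity
  have hB0 : 0 < B := by positivity
  set A := ((p + 1) / 8) ^ (1 / (p - 1)) with hA
  have hA0 : 0 < A := Real.rpow_pos_of_pos (by linarith) _
  have hAp : A ^ p = A * ((p + 1) / 8) := by
    have : A ^ (p - 1) = (p + 1) / 8 := by
      rw [hA, ← Real.rpow_mul (by linarith), one_div_mul_cancel hp1.ne', Real.rpow_one]
    rw [← this, mul_comm, ← Real.rpow_add_one hA0.ne', sub_add_cancel]
  have hC := fun t => Real.cosh_pos (B * t)
  have hlin : ∀ t, HasDerivAt (fun t => B * t) B t := fun t => by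
    simpa using (hasDerivAt_id t).const_mul B
  have hcosh : ∀ t, HasDerivAt (fun t => Real.cosh (B * t)) (Real.sinh (B * t) * B) t := fun t =>
    (hlin t).cosh
  have hsinh : ∀ t, HasDerivAt (fun t => Real.sinh (B * t)) (Real.cosh (B * t) * B) t := fun t =>
    (hlin t).sinh
  have hpowd : ∀ r t, HasDerivAt (fun t => Real.cosh (B * t) ^ r)
      (Real.sinh (B * t) * B * r * Real.cosh (B * t) ^ (r - 1)) t := fun r t =>
    (hcosh t).rpow_const (Or.inl (hC t).ne')
  have htop : Tendsto (fun t => A * Real.cosh (B * t) ^ (-q)) atTop (nhds 0) := by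
    have h1 : Tendsto (fun t => Real.cosh (B * t)) atTop atTop := by
      refine tendsto_atTop_mono (f := fun t => Real.exp (B * t) / 2) (fun t => ?_) ?_
      · rw [Real.cosh_eq]
        have := Real.exp_pos (-(B * t))
        linarith
      · exact (Real.tendsto_exp_atTop.comp (tendsto_id.const_mul_atTop hB0)).atTop_div_const
          two_pos
    simpa using ((tendsto_rpow_neg_atTop hq0).comp h1).const_mul A
  refine ⟨fun t => A * Real.cosh (B * t) ^ (-q),
    fun t => -(A / 2) * (Real.sinh (B * t) * Real.cosh (B * t) ^ (-q - 1)),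
    ⟨fun t => mul_pos hA0 (Real.rpow_pos_of_pos (hC t) _), fun t => ?_, fun t => ?_⟩, ?_, htop⟩
  · refine ((hpowd (-q) t).const_mul A).congr_deriv ?_
    linear_combination (-A * Real.sinh (B * t) * Real.cosh (B * t) ^ (-q - 1)) * hqB
  · refine (((hsinh t).mul (hpowd (-q - 1) t)).const_mul (-(A / 2))).congr_deriv ?_
    have hs : Real.sinh (B * t) ^ 2 = Real.cosh (B * t) ^ 2 - 1 := by
      have := Real.cosh_sq (B * t); linarith
    have r1 : Real.cosh (B * t) ^ (-q - 1) =
        Real.cosh (B * t) ^ (-q - 1 - 1) * Real.cosh (B * t) := by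
      rw [← Real.rpow_add_one (hC t).ne', sub_add_cancel]
    have r0 : Real.cosh (B * t) ^ (-q) =
        Real.cosh (B * t) ^ (-q - 1 - 1) * Real.cosh (B * t) ^ 2 := by
      rw [pow_two, ← mul_assoc, ← r1, ← Real.rpow_add_one (hC t).ne', sub_add_cancel]
    have rp : (Real.cosh (B * t) ^ (-q)) ^ p = Real.cosh (B * t) ^ (-q - 1 - 1) := by
      rw [← Real.rpow_mul (hC t).le]
      congr 1
      rw [hq]; field_simp; ring
    rw [Real.mul_rpow hA0.le (Real.rpow_nonneg (hC t).le _), rp, hAp, r0, r1]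
    have hBp : (p + 1) / 8 = 1 / 4 + B / 2 := by rw [hB]; ring
    rw [hBp]
    set Z := Real.cosh (B * t) ^ (-q - 1 - 1)
    set X := Real.cosh (B * t)
    linear_combination (A / 2 * Z * (1 / 2 + B)) * hs +
      (A / 2 * Z * Real.sinh (B * t) ^ 2) * hqB
  · refine (htop.comp tendsto_neg_atBot_atTop).congr fun t => ?_
    simp only [Function.comp_apply, mul_neg, Real.cosh_neg]

lemma EFSol.contDiff {p c k : ℝ} {w v : ℝ → ℝ} (h : EFSol p c k w v) : ContDiff ℝ 2 w := by
  have hw : deriv w = v := funext fun t => (h.hw t).deriv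
  have hv : deriv v = fun t => -(c * v t) + k * w t - w t ^ p := funext fun t => (h.hv t).deriv
  have hwd : Differentiable ℝ w := fun t => (h.hw t).differentiableAt
  have hvd : Differentiable ℝ v := fun t => (h.hv t).differentiableAt
  have h1 : ContDiff ℝ 1 v := by
    rw [contDiff_one_iff_deriv, hv]
    refine ⟨hvd, ?_⟩
    have := hwd.continuous
    have := hvd.continuous
    have : Continuous fun t => w t ^ p :=
      hwd.continuous.rpow_const fun t => Or.inl (h.pos t).ne'
    fun_prop
  rw [show (2 : WithTop ℕ∞) = 1 + 1 by norm_num, contDiff_succ_iff_deriv, hw]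
  exact ⟨hwd, by simp, h1⟩

lemma EFSol.isPosSol {p σ a : ℝ} {w v : ℝ → ℝ} (haσ : 2 + σ = a * (1 - p))
    (h : EFSol p (2 * a - 1) (a * (1 - a)) w v) :
    IsPosSol p σ (fun x => x ^ a * w (Real.log x)) := by
  have hu : ∀ x > 0, HasDerivAt (fun x => x ^ a * w (Real.log x))
      (x ^ (a - 1) * (a * w (Real.log x) + v (Real.log x))) x := fun x hx => by
    refine ((Real.hasDerivAt_rpow_const (p := a) (Or.inl hx.ne')).mul
      ((h.hw (Real.log x)).comp x (Real.hasDerivAt_log hx.ne'))).congr_deriv ?_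
    simp only [Function.comp_apply]
    rw [Real.rpow_sub_one hx.ne']
    field_simp
  have hd : ∀ x > 0, HasDerivAt (fun x => x ^ (a - 1) * (a * w (Real.log x) + v (Real.log x)))
      (-(x ^ (a - 1 - 1) * w (Real.log x) ^ p)) x := fun x hx => by
    refine ((Real.hasDerivAt_rpow_const (p := a - 1) (Or.inl hx.ne')).mul
      ((((h.hw (Real.log x)).comp x (Real.hasDerivAt_log hx.ne')).const_mul a).add
      ((h.hv (Real.log x)).comp x (Real.hasDerivAt_log hx.ne')))).congr_deriv ?_
    simp only [Function.comp_apply, Pi.add_apply]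
    rw [Real.rpow_sub_one hx.ne' (a - 1)]
    field_simp
    ring
  refine ⟨fun x hx => mul_pos (Real.rpow_pos_of_pos hx _) (h.pos _), ?_, fun x hx => ?_⟩
  · refine ContDiffOn.mul (fun x hx => ?_) (h.contDiff.comp_contDiffOn ?_)
    · exact (Real.contDiffAt_rpow_const_of_ne (ne_of_gt hx)).contDiffWithinAt
    · exact Real.contDiffOn_log.mono fun x hx => ne_of_gt hx
  · have hx0 : 0 < x := hx
    have hev : deriv (fun x => x ^ a * w (Real.log x)) =ᶠ[nhds x]
        fun x => x ^ (a - 1) * (a * w (Real.log x) + v (Real.log x)) := by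
      filter_upwards [lt_mem_nhds hx0] with y hy using (hu y hy).deriv
    rw [hev.deriv_eq, (hd x hx0).deriv, neg_neg,
      Real.mul_rpow (Real.rpow_nonneg hx0.le _) (h.pos _).le, ← Real.rpow_mul hx0.le, ← mul_assoc,
      ← Real.rpow_add hx0]
    congr 2
    linarith

lemma IsPosSol.exists_efSol {p σ a : ℝ} {u : ℝ → ℝ} (haσ : 2 + σ = a * (1 - p))
    (h : IsPosSol p σ u) :
    ∃ v, EFSol p (2 * a - 1) (a * (1 - a)) (fun t => Real.exp (-a * t) * u (Real.exp t)) v := by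
  obtain ⟨hpos, hC, heq⟩ := h
  have hu : ∀ x > 0, HasDerivAt u (deriv u x) x := fun x hx =>
    ((hC.differentiableOn (by norm_num)).differentiableAt (Ioi_mem_nhds hx)).hasDerivAt
  have hC1 : ContDiffOn ℝ 1 (deriv u) (Ioi 0) :=
    hC.deriv_of_isOpen isOpen_Ioi (by norm_num)
  have hd : ∀ x > 0, HasDerivAt (deriv u) (-(x ^ σ * u x ^ p)) x := fun x hx => by
    have := ((hC1.differentiableOn (by norm_num)).differentiableAt (Ioi_mem_nhds hx)).hasDerivAt
    rwa [← heq x hx, neg_neg]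
  have hD := fun t => hasDerivAt_logCoord (a := a) (hu _ (Real.exp_pos t)) (hd _ (Real.exp_pos t))
  refine ⟨_, fun t => mul_pos (Real.exp_pos _) (hpos _ (Real.exp_pos t)), fun t => (hD t).1,
    fun t => (hD t).2.congr_deriv ?_⟩
  have key : Real.exp ((2 - a) * t) * (Real.exp (t * σ) * u (Real.exp t) ^ p) =
      Real.exp (-a * t * p) * u (Real.exp t) ^ p := by
    rw [← mul_assoc, ← Real.exp_add]
    congr 2
    linear_combination t * haσ
  rw [Real.mul_rpow (Real.exp_pos _).le (hpos _ (Real.exp_pos t)).le, ← Real.exp_mul,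
    ← Real.exp_mul, mul_neg, key, ← sub_eq_add_neg]

lemma HasRatioLimits.logCoord {p σ a L0 Linf : ℝ} {u : ℝ → ℝ} (ha : a = (2 + σ) / (1 - p))
    (hk : 0 < a * (1 - a)) (h : HasRatioLimits p σ u L0 Linf) :
    Tendsto (fun t => Real.exp (-a * t) * u (Real.exp t)) atBot
      (nhds ((a * (1 - a)) ^ (1 / (p - 1)) * L0)) ∧
    Tendsto (fun t => Real.exp (-a * t) * u (Real.exp t)) atTop
      (nhds ((a * (1 - a)) ^ (1 / (p - 1)) * Linf)) := by
  have hC := Real.rpow_pos_of_pos hk (1 / (p - 1))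
  have e : ∀ t, (a * (1 - a)) ^ (1 / (p - 1)) * (u (Real.exp t) / uExplicit p σ (Real.exp t)) =
      Real.exp (-a * t) * u (Real.exp t) := fun t => by
    rw [uExplicit, ← ha, ← Real.exp_mul, neg_mul, Real.exp_neg, mul_comm t a]
    have := Real.exp_pos (a * t)
    field_simp
  exact ⟨((h.1.comp Real.tendsto_exp_atBot_nhdsGT).const_mul _).congr e,
    ((h.2.comp Real.tendsto_exp_atTop).const_mul _).congr e⟩

lemma hasRatioLimits_of_logCoord {p σ a L0 Linf : ℝ} {w : ℝ → ℝ} (ha : a = (2 + σ) / (1 - p))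
    (hk : 0 < a * (1 - a))
    (h0 : Tendsto w atBot (nhds ((a * (1 - a)) ^ (1 / (p - 1)) * L0)))
    (h1 : Tendsto w atTop (nhds ((a * (1 - a)) ^ (1 / (p - 1)) * Linf))) :
    HasRatioLimits p σ (fun x => x ^ a * w (Real.log x)) L0 Linf := by
  have hC := Real.rpow_pos_of_pos hk (1 / (p - 1))
  have e : ∀ x > 0, w (Real.log x) / (a * (1 - a)) ^ (1 / (p - 1)) =
      x ^ a * w (Real.log x) / uExplicit p σ x := fun x hx => by
    rw [uExplicit, ← ha]
    have := Real.rpow_pos_of_pos hx a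
    field_simp
  have h0' := (h0.comp Real.tendsto_log_nhdsGT_zero).div_const ((a * (1 - a)) ^ (1 / (p - 1)))
  have h1' := (h1.comp Real.tendsto_log_atTop).div_const ((a * (1 - a)) ^ (1 / (p - 1)))
  rw [mul_div_cancel_left₀ _ hC.ne'] at h0' h1'
  refine ⟨h0'.congr' ?_, h1'.congr' ?_⟩
  · filter_upwards [self_mem_nhdsWithin] with x hx using e x hx
  · filter_upwards [eventually_gt_atTop 0] with x hx using e x hx

lemma scaling_of_shift {a τ : ℝ} {u v : ℝ → ℝ}
    (h : ∀ t, Real.exp (-a * t) * v (Real.exp t) =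
      Real.exp (-a * (t + τ)) * u (Real.exp (t + τ))) :
    ∃ lam > (0 : ℝ), ∀ x ∈ Ioi (0 : ℝ), v x = lam ^ (-a) * u (lam * x) := by
  refine ⟨Real.exp τ, Real.exp_pos τ, fun x hx => ?_⟩
  have := h (Real.log x)
  rw [Real.exp_add, Real.exp_log hx, mul_add, Real.exp_add, mul_assoc, mul_comm x] at this
  rw [mul_left_cancel₀ (Real.exp_pos _).ne' this, ← Real.exp_mul, mul_comm τ]

/-- **Theorem 5.2.** For `σ < -2` and `p > -1-σ`, with `a = (2+σ)/(1-p) ∈ (0,1)`: according to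
`a > 1/2`, `a = 1/2` or `a < 1/2` there is a positive solution whose ratio with `u_a` tends to
`(0,1)`, `(0,0)` or `(1,0)` at `0⁺` and `+∞` respectively, and in each case the solution is
unique up to the scaling `u ↦ λ^{-a} u(λ·)`. -/
theorem heteroclinic_homoclinic_solutions (p σ a : ℝ) (hσ : σ < -2) (hp : -1 - σ < p)
    (ha : a = (2 + σ) / (1 - p)) :
    ((1 / 2 < a → ∃ u : ℝ → ℝ, IsPosSol p σ u ∧ HasRatioLimits p σ u 0 1) ∧
     (a = 1 / 2 → ∃ u : ℝ → ℝ, IsPosSol p σ u ∧ HasRatioLimits p σ u 0 0) ∧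
     (a < 1 / 2 → ∃ u : ℝ → ℝ, IsPosSol p σ u ∧ HasRatioLimits p σ u 1 0)) ∧
    (∀ L0 Linf : ℝ,
      ((1 / 2 < a ∧ L0 = 0 ∧ Linf = 1) ∨ (a = 1 / 2 ∧ L0 = 0 ∧ Linf = 0) ∨
        (a < 1 / 2 ∧ L0 = 1 ∧ Linf = 0)) →
      ∀ u v : ℝ → ℝ,
        IsPosSol p σ u → HasRatioLimits p σ u L0 Linf →
        IsPosSol p σ v → HasRatioLimits p σ v L0 Linf →
        ∃ lam > (0 : ℝ), ∀ x ∈ Set.Ioi (0 : ℝ), v x = lam ^ (-a) * u (lam * x)) := by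
  have hp1 : 1 < p := by linarith
  have haσ : 2 + σ = a * (1 - p) := by
    rw [ha, div_mul_cancel₀]; linarith
  have ha0 : 0 < a := by rw [ha]; exact div_pos_of_neg_of_neg (by linarith) (by linarith)
  have ha1 : a < 1 := by rw [ha, div_lt_one_of_neg (by linarith)]; linarith
  have hk : 0 < a * (1 - a) := mul_pos ha0 (by linarith)
  have hcr : -(2 * (1 - a) - 1) = 2 * a - 1 := by ring
  have hkr : (1 - a) * (1 - (1 - a)) = a * (1 - a) := by ring
  refine ⟨⟨fun h => ?_, fun h => ?_, fun h => ?_⟩, ?_⟩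
  · obtain ⟨w, v, hs, hb, ht⟩ := exists_heteroclinic hp1 h ha1
    exact ⟨_, hs.isPosSol haσ, hasRatioLimits_of_logCoord ha hk (by simpa using hb)
      (by simpa using ht)⟩
  · obtain ⟨w, v, hs, hb, ht⟩ := exists_homoclinic hp1
    have hs' : EFSol p (2 * a - 1) (a * (1 - a)) w v := by
      rw [h]; convert hs using 1 <;> norm_num
    exact ⟨_, hs'.isPosSol haσ, hasRatioLimits_of_logCoord ha hk (by simpa using hb)
      (by simpa using ht)⟩
  · obtain ⟨w, v, hs, hb, ht⟩ := exists_heteroclinic (a := 1 - a) hp1 (by linarith) (by linarith)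
    have hs' := hs.reflect
    rw [hcr, hkr] at hs'
    rw [hkr] at ht
    exact ⟨_, hs'.isPosSol haσ, hasRatioLimits_of_logCoord (L0 := 1) (Linf := 0)
      (w := fun t => w (-t)) ha hk
      (by rw [mul_one]; exact ht.comp tendsto_neg_atBot_atTop)
      (by rw [mul_zero]; exact hb.comp tendsto_neg_atTop_atBot)⟩
  · intro L0 Linf hL u v hu hur hv hvr
    obtain ⟨du, hu'⟩ := hu.exists_efSol haσ
    obtain ⟨dv, hv'⟩ := hv.exists_efSol haσ
    obtain ⟨hub, hut⟩ := hur.logCoord ha hk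
    obtain ⟨hvb, hvt⟩ := hvr.logCoord ha hk
    have hcases : L0 = 0 ∨ Linf = 0 := by tauto
    rcases hcases with rfl | rfl
    · rw [mul_zero] at hub hvb
      obtain ⟨τ, hτ⟩ := hu'.unique_up_to_shift hv' hp1 hk hub hvb
      exact scaling_of_shift hτ
    · rw [mul_zero] at hut hvt
      obtain ⟨τ, hτ⟩ := hu'.reflect.unique_up_to_shift hv'.reflect hp1 hk
        (hut.comp tendsto_neg_atBot_atTop) (hvt.comp tendsto_neg_atBot_atTop)
      refine scaling_of_shift (τ := -τ) fun t => ?_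
      have := hτ (-t)
      rwa [neg_neg, neg_add, neg_neg] at this
end

section
/- Let δ > 0, let F ∈ C¹([0,δ) × (-δ,δ)^m; ℝᵐ), and let w₀ ∈ ℝᵐ satisfy F(0,w₀) = w₀ and (∂F/∂w)(0,w₀) = 0. Then there exist T > 0 and a unique function w ∈ C([0,T)) ∩ C¹((0,T)) such that w(0) = w₀ and w(x) = (1/x)∫₀ˣ F(s, w(s)) ds for all x ∈ (0,T). -/
open Set Filter

open MeasureTheory Topology Metric

section IntegralAverage

variable {E : Type*} [NormedAddCommGroup E] [NormedSpace ℝ E]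

/-- A `C¹` function on `[0,δ) × U` whose partial derivative in the second variable vanishes at
`(0, w₀)` is `1/2`-Lipschitz in the second variable on a small cylinder around `(0, w₀)`. -/
lemma exists_cylinder_half_lipschitz {δ : ℝ} (hδ : 0 < δ) {U : Set E} (hU : IsOpen U)
    {F : ℝ × E → E} (hF : ContDiffOn ℝ 1 F (Ico 0 δ ×ˢ U)) {w₀ : E} (hw₀ : w₀ ∈ U)
    (hpartial : fderiv ℝ (fun w => F (0, w)) w₀ = 0) :
    ∃ r > 0, ∃ T₀ > 0, Icc 0 T₀ ×ˢ closedBall w₀ r ⊆ Ico 0 δ ×ˢ U ∧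
      ∀ s ∈ Icc 0 T₀, ∀ v ∈ closedBall w₀ r, ∀ w ∈ closedBall w₀ r,
        ‖F (s, v) - F (s, w)‖ ≤ 1 / 2 * ‖v - w‖ := by
  set D := Ico 0 δ ×ˢ U with hD
  have hUD : UniqueDiffOn ℝ D := (uniqueDiffOn_Ico 0 δ).prod hU.uniqueDiffOn
  have hmem : ((0 : ℝ), w₀) ∈ D := ⟨⟨le_rfl, hδ⟩, hw₀⟩
  have hslice : ∀ p ∈ D, HasFDerivWithinAt (fun w => F (p.1, w))
      ((fderivWithin ℝ F D p).comp (ContinuousLinearMap.inr ℝ ℝ E)) U p.2 := by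
    intro p hp
    have h1 : HasFDerivWithinAt F (fderivWithin ℝ F D p) D (p.1, p.2) :=
      ((hF.differentiableOn one_ne_zero) p hp).hasFDerivWithinAt
    exact h1.comp p.2 (hasFDerivAt_prodMk_right p.1 p.2).hasFDerivWithinAt
      (fun w hw => ⟨hp.1, hw⟩)
  have hzero : (fderivWithin ℝ F D (0, w₀)).comp (ContinuousLinearMap.inr ℝ ℝ E) = 0 := by
    rw [← hpartial]
    exact ((hslice _ hmem).hasFDerivAt (hU.mem_nhds hw₀)).fderiv.symm
  have hcont : ContinuousOn
      (fun p => ‖(fderivWithin ℝ F D p).comp (ContinuousLinearMap.inr ℝ ℝ E)‖) D :=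
    ((hF.continuousOn_fderivWithin hUD le_rfl).clm_comp continuousOn_const).norm
  have hev : ∀ᶠ p in 𝓝[D] ((0 : ℝ), w₀),
      ‖(fderivWithin ℝ F D p).comp (ContinuousLinearMap.inr ℝ ℝ E)‖ < 1 / 2 := by
    refine (hcont _ hmem).eventually_lt_const ?_
    simp only [hzero, norm_zero]
    norm_num
  have hev' := hev.and self_mem_nhdsWithin
  rw [hD, nhdsWithin_prod_eq, hU.nhdsWithin_eq hw₀, nhdsWithin_Ico_eq_nhdsGE hδ,
    ((nhdsGE_basis_Icc (a := (0 : ℝ))).prod nhds_basis_closedBall).eventually_iff] at hev'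
  obtain ⟨⟨T₀, r⟩, ⟨hT₀, hr⟩, h⟩ := hev'
  refine ⟨r, hr, T₀, hT₀, fun p hp => (h hp).2, fun s hs v hv w hw => ?_⟩
  refine (convex_closedBall w₀ r).norm_image_sub_le_of_norm_hasFDerivWithin_le
    (f := fun w => F (s, w)) (fun x hx => ?_) (fun x hx => (h (x := (s, x)) ⟨hs, hx⟩).1.le) hw hv
  exact (hslice (s, x) (h (x := (s, x)) ⟨hs, hx⟩).2).mono
    (fun y hy => (h (x := (s, y)) ⟨hs, hy⟩).2.2)

lemma norm_average_sub_le [CompleteSpace E] {f : ℝ → E} {c : E} {x C : ℝ} (hx : 0 < x)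
    (hf : ContinuousOn f (Icc 0 x)) (h : ∀ s ∈ Ioo 0 x, ‖f s - c‖ ≤ C) :
    ‖(1 / x) • (∫ s in (0 : ℝ)..x, f s) - c‖ ≤ C := by
  have hle : ∀ s ∈ Icc 0 x, ‖f s - c‖ ≤ C := by
    have hm : MapsTo (fun s => ‖f s - c‖) (Ioo 0 x) (Iic C) := h
    have := hm.closure_of_continuousOn
      (by rw [closure_Ioo hx.ne]; exact (hf.sub continuousOn_const).norm)
    rwa [closure_Ioo hx.ne, isClosed_Iic.closure_eq] at this
  have hi : IntervalIntegrable f volume 0 x :=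
    ContinuousOn.intervalIntegrable (by rwa [uIcc_of_le hx.le])
  have hc : (1 / x) • (∫ s in (0 : ℝ)..x, f s) - c
      = (1 / x) • ∫ s in (0 : ℝ)..x, (f s - c) := by
    rw [intervalIntegral.integral_sub hi intervalIntegrable_const,
      intervalIntegral.integral_const, smul_sub, smul_smul]
    simp [hx.ne']
  have hb := intervalIntegral.norm_integral_le_of_norm_le_const (a := 0) (b := x)
    (f := fun s => f s - c) (C := C) (fun s hs => hle s (by
      rw [uIoc_of_le hx.le] at hs; exact Ioc_subset_Icc_self hs))
  rw [hc, norm_smul, Real.norm_of_nonneg (by positivity)]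
  rw [sub_zero, abs_of_pos hx] at hb
  calc 1 / x * _ ≤ 1 / x * (C * x) := by gcongr
    _ = C := by field_simp

lemma norm_average_sub_average_le [CompleteSpace E] {f g : ℝ → E} {x C : ℝ} (hx : 0 < x)
    (hf : ContinuousOn f (Icc 0 x)) (hg : ContinuousOn g (Icc 0 x))
    (h : ∀ s ∈ Ioo 0 x, ‖f s - g s‖ ≤ C) :
    ‖(1 / x) • (∫ s in (0 : ℝ)..x, f s) - (1 / x) • ∫ s in (0 : ℝ)..x, g s‖ ≤ C := by
  have hi : ∀ {k : ℝ → E}, ContinuousOn k (Icc 0 x) → IntervalIntegrable k volume 0 x :=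
    fun hk => ContinuousOn.intervalIntegrable (by rwa [uIcc_of_le hx.le])
  rw [← smul_sub, ← intervalIntegral.integral_sub (hi hf) (hi hg)]
  simpa using norm_average_sub_le (c := 0) hx (hf.sub hg) (by simpa using h)

/-- Two solutions of `w(x) = (1/x) ∫₀ˣ F(s, w(s)) ds` with values in a ball on which `F` is
`1/2`-Lipschitz coincide. -/
lemma average_equation_eqOn [CompleteSpace E] {F : ℝ × E → E} {w₀ : E} {r b : ℝ}
    (hFc : ContinuousOn F (Icc 0 b ×ˢ closedBall w₀ r))
    (hL : ∀ s ∈ Icc 0 b, ∀ v ∈ closedBall w₀ r, ∀ w ∈ closedBall w₀ r,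
      ‖F (s, v) - F (s, w)‖ ≤ 1 / 2 * ‖v - w‖) {u v : ℝ → E}
    (hu : ContinuousOn u (Icc 0 b)) (hv : ContinuousOn v (Icc 0 b))
    (hur : MapsTo u (Icc 0 b) (closedBall w₀ r)) (hvr : MapsTo v (Icc 0 b) (closedBall w₀ r))
    (h0 : u 0 = v 0)
    (hue : ∀ x ∈ Ioc 0 b, u x = (1 / x) • ∫ s in (0 : ℝ)..x, F (s, u s))
    (hve : ∀ x ∈ Ioc 0 b, v x = (1 / x) • ∫ s in (0 : ℝ)..x, F (s, v s)) :
    EqOn u v (Icc 0 b) := by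
  intro y hy
  obtain ⟨x, hx, hmax⟩ := isCompact_Icc.exists_isMaxOn ⟨y, hy⟩ (hu.sub hv).norm
  have hmax' : ∀ s ∈ Icc 0 b, ‖u s - v s‖ ≤ ‖u x - v x‖ := fun s hs => hmax hs
  suffices ‖u x - v x‖ ≤ 0 from
    sub_eq_zero.1 (norm_le_zero_iff.1 ((hmax' y hy).trans this))
  rcases hx.1.eq_or_lt with rfl | hx0
  · simp [h0]
  have hsub : Icc 0 x ⊆ Icc 0 b := Icc_subset_Icc_right hx.2
  have hcomp : ∀ {k : ℝ → E}, ContinuousOn k (Icc 0 b) → MapsTo k (Icc 0 b) (closedBall w₀ r) →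
      ContinuousOn (fun s => F (s, k s)) (Icc 0 x) := fun hk hkr =>
    (hFc.comp (continuousOn_id.prodMk hk) (fun s hs => ⟨hs, hkr hs⟩)).mono hsub
  have key := norm_average_sub_average_le (C := 1 / 2 * ‖u x - v x‖) hx0 (hcomp hu hur)
    (hcomp hv hvr) (fun s hs => by
      have hs' := hsub (Ioo_subset_Icc_self hs)
      exact (hL s hs' _ (hur hs') _ (hvr hs')).trans (by gcongr; exact hmax' s hs'))
  rw [← hue x ⟨hx0, hx.2⟩, ← hve x ⟨hx0, hx.2⟩] at key
  linarith

/-- A solution of `w(x) = (1/x) ∫₀ˣ F(s, w(s)) ds` starting at the center of a ball cannot leave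
it, if `F` maps this ball into a strictly smaller concentric one. -/
lemma average_equation_mapsTo [CompleteSpace E] {F : ℝ × E → E} {w₀ : E} {r ρ b : ℝ}
    (hr : 0 < r) (hρ : ρ < r) (hFc : ContinuousOn F (Icc 0 b ×ˢ closedBall w₀ r))
    (hB : ∀ s ∈ Icc 0 b, ∀ v ∈ closedBall w₀ r, ‖F (s, v) - w₀‖ ≤ ρ) {u : ℝ → E}
    (hu : ContinuousOn u (Icc 0 b)) (h0 : u 0 = w₀)
    (hue : ∀ x ∈ Ioc 0 b, u x = (1 / x) • ∫ s in (0 : ℝ)..x, F (s, u s)) :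
    MapsTo u (Icc 0 b) (closedBall w₀ r) := by
  by_contra hcon
  obtain ⟨y, hy, hyr⟩ : ∃ y ∈ Icc 0 b, r < ‖u y - w₀‖ := by
    simpa [MapsTo, dist_eq_norm, and_assoc] using hcon
  have hnc : ContinuousOn (fun x => ‖u x - w₀‖) (Icc 0 b) := (hu.sub continuousOn_const).norm
  have hK : IsCompact (Icc 0 b ∩ (fun x => ‖u x - w₀‖) ⁻¹' Ici r) :=
    isCompact_Icc.of_isClosed_subset (hnc.preimage_isClosed_of_isClosed isClosed_Icc isClosed_Ici)
      inter_subset_left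
  obtain ⟨x, ⟨hx, hxr⟩, hleast⟩ := hK.exists_isLeast ⟨y, hy, hyr.le⟩
  have hx0 : 0 < x := hx.1.lt_of_ne (by
    rintro rfl
    simp [h0] at hxr
    linarith)
  have hsub : Icc 0 x ⊆ Icc 0 b := Icc_subset_Icc_right hx.2
  have hin : MapsTo u (Icc 0 x) (closedBall w₀ r) := by
    have h1 : MapsTo u (Ico 0 x) (closedBall w₀ r) := fun s hs => by
      rw [mem_closedBall, dist_eq_norm]
      by_contra! hlt
      exact hs.2.not_ge (hleast ⟨hsub (Ico_subset_Icc_self hs), hlt.le⟩)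
    have := h1.closure_of_continuousOn (by rw [closure_Ico hx0.ne]; exact hu.mono hsub)
    rwa [closure_Ico hx0.ne, isClosed_closedBall.closure_eq] at this
  have key := norm_average_sub_le (f := fun s => F (s, u s)) (c := w₀) (C := ρ) hx0
    (hFc.comp (continuousOn_id.prodMk (hu.mono hsub)) (fun s hs => ⟨hsub hs, hin hs⟩))
    (fun s hs => hB s (hsub (Ioo_subset_Icc_self hs)) _ (hin (Ioo_subset_Icc_self hs)))
  rw [← hue x ⟨hx0, hx.2⟩] at key
  exact (key.trans_lt hρ).not_ge hxr

/-- Existence of a solution of `w(x) = (1/x) ∫₀ˣ F(s, w(s)) ds` by the contraction principle. -/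
lemma exists_average_equation_solution [CompleteSpace E] {F : ℝ × E → E} {w₀ : E} {r T : ℝ}
    (hT : 0 < T) (hr : 0 < r) (hFc : ContinuousOn F (Icc 0 T ×ˢ closedBall w₀ r))
    (hL : ∀ s ∈ Icc 0 T, ∀ v ∈ closedBall w₀ r, ∀ w ∈ closedBall w₀ r,
      ‖F (s, v) - F (s, w)‖ ≤ 1 / 2 * ‖v - w‖)
    (hB : ∀ s ∈ Icc 0 T, ∀ v ∈ closedBall w₀ r, ‖F (s, v) - w₀‖ ≤ r)
    (hfix : F (0, w₀) = w₀) :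
    ∃ w : ℝ → E, Continuous w ∧ (∀ x, w x ∈ closedBall w₀ r) ∧ w 0 = w₀ ∧
      ContDiffOn ℝ 1 w (Ioo 0 T) ∧
      ∀ x ∈ Ioc 0 T, w x = (1 / x) • ∫ s in (0 : ℝ)..x, F (s, w s) := by
  let X := C(Icc 0 T, closedBall w₀ r)
  let f : X → ℝ → E := fun w s => F (projIcc 0 T hT.le s, w (projIcc 0 T hT.le s))
  have hf : ∀ w, Continuous (f w) := fun w =>
    hFc.comp_continuous (by fun_prop) (fun s => ⟨(projIcc 0 T hT.le s).2, (w _).2⟩)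
  have hfB : ∀ w s, ‖f w s - w₀‖ ≤ r := fun w s => hB _ (projIcc 0 T hT.le s).2 _ (w _).2
  have hAc : ∀ w, Continuous fun x : ℝ => ∫ t in (0 : ℝ)..1, f w (x * t) := fun w =>
    intervalIntegral.continuous_parametric_intervalIntegral_of_continuous'
      (by have := hf w; fun_prop) 0 1
  have hAB : ∀ w x, (∫ t in (0 : ℝ)..1, f w (x * t)) ∈ closedBall w₀ r := fun w x => by
    have := norm_average_sub_le (f := fun t => f w (x * t)) (c := w₀) (C := r) one_pos
      (by have := hf w; fun_prop) (fun s _ => hfB w _)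
    rw [mem_closedBall, dist_eq_norm]
    simpa using this
  let A : X → X := fun w =>
    ⟨fun x => ⟨∫ t in (0 : ℝ)..1, f w (x * t), hAB w x⟩,
      ((hAc w).comp continuous_subtype_val).subtype_mk _⟩
  have hA : ContractingWith (1 / 2) A := by
    refine ⟨by norm_num, LipschitzWith.of_dist_le_mul fun u v => ?_⟩
    refine (ContinuousMap.dist_le (by positivity)).2 fun x => ?_
    have := norm_average_sub_average_le (f := fun t => f u (x * t)) (g := fun t => f v (x * t))
      (C := 1 / 2 * dist u v) one_pos
      (by have := hf u; fun_prop) (by have := hf v; fun_prop) (fun s _ => by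
        refine (hL _ (projIcc 0 T hT.le _).2 _ (u _).2 _ (v _).2).trans ?_
        rw [← dist_eq_norm]
        gcongr
        exact ContinuousMap.dist_apply_le_dist (f := u) (g := v) _)
    rw [Subtype.dist_eq, dist_eq_norm]
    simpa [A] using this
  have : CompleteSpace (closedBall w₀ r) := isClosed_closedBall.completeSpace_coe
  have : Nonempty X := ⟨ContinuousMap.const _ ⟨w₀, mem_closedBall_self hr.le⟩⟩
  obtain ⟨w, hw⟩ : ∃ w, A w = w := ⟨_, hA.fixedPoint_isFixedPt⟩
  have hwA : ∀ x : Icc 0 T, (w x : E) = ∫ t in (0 : ℝ)..1, f w (x * t) := fun x => by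
    conv_lhs => rw [← hw]
    rfl
  have hproj : ∀ x (hx : x ∈ Icc 0 T), projIcc 0 T hT.le x = ⟨x, hx⟩ := fun x hx =>
    projIcc_of_mem hT.le hx
  have heq : ∀ x ∈ Ioc 0 T, (w (projIcc 0 T hT.le x) : E)
      = (1 / x) • ∫ s in (0 : ℝ)..x, f w s := fun x hx => by
    rw [hproj x (Ioc_subset_Icc_self hx), hwA, intervalIntegral.integral_comp_mul_left _ hx.1.ne']
    simp
  refine ⟨fun x => w (projIcc 0 T hT.le x), by fun_prop, fun x => (w _).2, ?_, ?_, ?_⟩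
  · have h0 : (0 : ℝ) ∈ Icc 0 T := ⟨le_rfl, hT.le⟩
    have h1 : (w ⟨0, h0⟩ : E) = F (0, (w ⟨0, h0⟩ : E)) := by
      conv_lhs => rw [hwA]
      simp [f]
    have h2 := hL 0 h0 _ (w ⟨0, h0⟩).2 _ (mem_closedBall_self hr.le)
    rw [← h1, hfix] at h2
    simp only [hproj 0 h0]
    exact sub_eq_zero.1 (norm_le_zero_iff.1 (by linarith))
  · have hprim : ContDiff ℝ 1 fun x => ∫ s in (0 : ℝ)..x, f w s := by
      have hd : ∀ x, HasDerivAt (fun x => ∫ s in (0 : ℝ)..x, f w s) (f w x) x := fun x =>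
        intervalIntegral.integral_hasDerivAt_right ((hf w).intervalIntegrable _ _)
          ((hf w).stronglyMeasurableAtFilter _ _) (hf w).continuousAt
      refine contDiff_one_iff_deriv.2 ⟨fun x => (hd x).differentiableAt, ?_⟩
      rw [show deriv (fun x => ∫ s in (0 : ℝ)..x, f w s) = f w from funext fun x => (hd x).deriv]
      exact hf w
    refine ContDiffOn.congr (f := fun x : ℝ => (1 / x) • ∫ s in (0 : ℝ)..x, f w s) ?_
      (fun x hx => heq x (Ioo_subset_Ioc_self hx))
    exact (contDiffOn_const.div contDiffOn_id fun x hx => hx.1.ne').smul hprim.contDiffOn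
  · intro x hx
    simp only [heq x hx]
    congr 1
    refine intervalIntegral.integral_congr fun s hs => ?_
    rw [uIcc_of_le hx.1.le] at hs
    simp only [f, hproj s ⟨hs.1, hs.2.trans hx.2⟩]

end IntegralAverage

/-- **Lemma 5.4** (Giga–Giga). If `F` is `C¹` on `[0,δ) × (-δ,δ)^m`, `F(0,w₀) = w₀` and
`(∂F/∂w)(0,w₀) = 0`, then the integral equation `w(x) = (1/x)∫₀ˣ F(s,w(s)) ds`, `w(0) = w₀`,
has a unique solution `w ∈ C([0,T)) ∩ C¹((0,T))` for some small `T > 0`. -/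
theorem integral_equation_unique_local_solution (m : ℕ) (δ : ℝ) (hδ : 0 < δ)
    (F : ℝ × EuclideanSpace ℝ (Fin m) → EuclideanSpace ℝ (Fin m))
    (hF : ContDiffOn ℝ 1 F
      (Set.Ico 0 δ ×ˢ {w : EuclideanSpace ℝ (Fin m) | ∀ i, w i ∈ Set.Ioo (-δ) δ}))
    (w₀ : EuclideanSpace ℝ (Fin m)) (hw₀ : ∀ i, w₀ i ∈ Set.Ioo (-δ) δ)
    (hfix : F (0, w₀) = w₀)
    (hpartial : fderiv ℝ (fun w => F (0, w)) w₀ = 0) :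
    ∃ T > (0 : ℝ), ∃ w : ℝ → EuclideanSpace ℝ (Fin m),
      ContinuousOn w (Set.Ico 0 T) ∧ ContDiffOn ℝ 1 w (Set.Ioo 0 T) ∧ w 0 = w₀ ∧
      (∀ x ∈ Set.Ioo (0 : ℝ) T, w x = (1 / x) • ∫ s in (0 : ℝ)..x, F (s, w s)) ∧
      ∀ w' : ℝ → EuclideanSpace ℝ (Fin m),
        ContinuousOn w' (Set.Ico 0 T) → ContDiffOn ℝ 1 w' (Set.Ioo 0 T) → w' 0 = w₀ →
        (∀ x ∈ Set.Ioo (0 : ℝ) T, w' x = (1 / x) • ∫ s in (0 : ℝ)..x, F (s, w' s)) →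
        Set.EqOn w' w (Set.Ico 0 T) := by
  have hU : IsOpen {w : EuclideanSpace ℝ (Fin m) | ∀ i, w i ∈ Set.Ioo (-δ) δ} := by
    simp only [ofPred_forall]
    exact isOpen_iInter_of_finite fun i => isOpen_Ioo.preimage (by fun_prop)
  obtain ⟨r, hr, T₀, hT₀, hD, hL⟩ := exists_cylinder_half_lipschitz hδ hU hF hw₀ hpartial
  have hFc : ContinuousOn F (Icc 0 T₀ ×ˢ closedBall w₀ r) := hF.continuousOn.mono hD
  have hw₀r : w₀ ∈ closedBall w₀ r := mem_closedBall_self hr.le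
  have hFw₀ : ContinuousOn (fun s => ‖F (s, w₀) - w₀‖) (Icc 0 T₀) :=
    ((hFc.comp (continuousOn_id.prodMk continuousOn_const) fun s hs => ⟨hs, hw₀r⟩).sub
      continuousOn_const).norm
  have hev : ∀ᶠ s in 𝓝[≥] (0 : ℝ), ‖F (s, w₀) - w₀‖ < r / 4 := by
    rw [← nhdsWithin_Icc_eq_nhdsGE hT₀]
    refine (hFw₀ 0 ⟨le_rfl, hT₀.le⟩).eventually_lt_const ?_
    simp only [hfix, sub_self, norm_zero]
    positivity
  obtain ⟨T₁, hT₁, hsmall⟩ := (nhdsGE_basis_Icc (a := (0 : ℝ))).eventually_iff.1 hev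
  obtain ⟨T, hT, hTT₀, hTT₁⟩ : ∃ T > 0, T ≤ T₀ ∧ T ≤ T₁ :=
    ⟨min T₀ T₁, lt_min hT₀ hT₁, min_le_left _ _, min_le_right _ _⟩
  replace hFc : ContinuousOn F (Icc 0 T ×ˢ closedBall w₀ r) :=
    hFc.mono (prod_mono_left (Icc_subset_Icc_right hTT₀))
  replace hL : ∀ s ∈ Icc 0 T, ∀ v ∈ closedBall w₀ r, ∀ w ∈ closedBall w₀ r,
      ‖F (s, v) - F (s, w)‖ ≤ 1 / 2 * ‖v - w‖ := fun s hs => hL s ⟨hs.1, hs.2.trans hTT₀⟩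
  have hB : ∀ s ∈ Icc 0 T, ∀ v ∈ closedBall w₀ r, ‖F (s, v) - w₀‖ ≤ 3 / 4 * r := by
    intro s hs v hv
    have h1 := hL s hs v hv w₀ hw₀r
    have h2 := hsmall ⟨hs.1, hs.2.trans hTT₁⟩
    have h3 := norm_sub_le_norm_sub_add_norm_sub (F (s, v)) (F (s, w₀)) w₀
    rw [mem_closedBall, dist_eq_norm] at hv
    linarith
  obtain ⟨w, hwc, hwr, hw0, hwd, hwe⟩ := exists_average_equation_solution hT hr hFc hL
    (fun s hs v hv => (hB s hs v hv).trans (by linarith)) hfix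
  refine ⟨T, hT, w, hwc.continuousOn, hwd, hw0, fun x hx => hwe x (Ioo_subset_Ioc_self hx), ?_⟩
  intro u huc _ hu0 hue b hb
  have hsub : Icc 0 b ⊆ Icc 0 T := Icc_subset_Icc_right hb.2.le
  have hFb := hFc.mono (prod_mono_left hsub)
  have hub : ContinuousOn u (Icc 0 b) := huc.mono (Icc_subset_Ico_right hb.2)
  have hueb : ∀ x ∈ Ioc 0 b, u x = (1 / x) • ∫ s in (0 : ℝ)..x, F (s, u s) :=
    fun x hx => hue x ⟨hx.1, hx.2.trans_lt hb.2⟩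
  exact average_equation_eqOn hFb (fun s hs => hL s (hsub hs)) hub hwc.continuousOn
    (average_equation_mapsTo hr (by linarith) hFb (fun s hs => hB s (hsub hs)) hub hu0 hueb)
    (fun x _ => hwr x) (hu0.trans hw0.symm) hueb
    (fun x hx => hwe x ⟨hx.1, hx.2.trans hb.2.le⟩) ⟨hb.1, le_rfl⟩
end
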